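/- Killip–Simon sum rule: Let μ be a nontrivial probability measure on ℝ with compact support and Jacobi coefficients (a_k)_{k≥1}, (b_k)_{k≥1}. Define G(x) = x − 1 − log x, I_H(μ) = (1/2)∑_{k=1}^∞ b_k² + ∑_{k=1}^∞ G(a_k²), and F_SC(x) = (|x|/2)√(x²−4) − 2·log((|x| + √(x²−4))/2) for |x| ≥ 2, F_SC(x) = +∞ for |x| < 2. If μ ∉ 𝒮₁(−2,2) then I_H(μ) = +∞. If μ ∈ 𝒮₁(−2,2) then K(SC | μ) + ∑_{λ ∈ E(μ)} F_SC(λ) = I_H(μ), where both sides may be infinite simultaneously. -/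

import Mathlib

open MeasureTheory Real Filter Set Topology Polynomial
open scoped ENNReal ComplexConjugate

noncomputable section

namespace SumRules

-- Kullback–Leibler divergence `K(ν | μ)`.
open Classical in
def KLdiv {α : Type*} [MeasurableSpace α] (ν μ : Measure α) : ℝ≥0∞ :=
  if ν ≪ μ ∧ Integrable (llr ν μ) ν then ENNReal.ofReal (∫ x, llr ν μ x ∂ν) else ⊤

/-- The (topological) support of a measure. -/
def suppSet {α : Type*} [TopologicalSpace α] [MeasurableSpace α] (μ : Measure α) : Set α :=
  {x | ∀ U ∈ nhds x, μ U ≠ 0}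

/-- A measure is nontrivial if its support is infinite, i.e. it is not carried
by any finite set. -/
def InfiniteSupport {α : Type*} [MeasurableSpace α] (μ : Measure α) : Prop :=
  ∀ s : Finset α, μ (↑s : Set α)ᶜ ≠ 0

/-- The set of support points outside `[cm, cp]`. -/
def ES (μ : Measure ℝ) (cm cp : ℝ) : Set ℝ := suppSet μ \ Icc cm cp

/-- `μ ∈ 𝒮₁(cm, cp)`: the support of `μ` is contained in `[cm, cp]` together with an
at most countable set of points outside this interval. -/
def InS1 (μ : Measure ℝ) (cm cp : ℝ) : Prop := (ES μ cm cp).Countable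

/-- `a b` (indexed so that `a (k+1) = a_{k+1}`, `b (k+1) = b_{k+1}`, `k ≥ 0`) are the Jacobi
coefficients of `μ`: there is a sequence of orthonormal polynomials (with positive leading
coefficients, obtained by Gram-Schmidt from `1, x, x², …`) satisfying the three-term recursion. -/
def IsJacobi (μ : Measure ℝ) (a b : ℕ → ℝ) : Prop :=
  (∀ k : ℕ, 0 < a (k+1)) ∧
  ∃ p : ℕ → Polynomial ℝ,
    (∀ k, (p k).natDegree = k) ∧ (∀ k, 0 < (p k).leadingCoeff) ∧
    (∀ j k, ∫ x, (p j).eval x * (p k).eval x ∂μ = if j = k then 1 else 0) ∧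
    (∀ (k : ℕ) (x : ℝ), x * (p k).eval x =
      a (k+1) * (p (k+1)).eval x + b (k+1) * (p k).eval x +
        (if k = 0 then 0 else a k * (p (k-1)).eval x))

/-- `u` is the sequence of canonical moments of a measure on `[-2,2]` (with `u 0 = -1`). -/
def IsCanonicalMoments (μ : Measure ℝ) (u : ℕ → ℝ) : Prop :=
  u 0 = -1 ∧ (∀ k : ℕ, u (k+1) ∈ Ioo (-1 : ℝ) 1) ∧
  ∃ a b : ℕ → ℝ, IsJacobi μ a b ∧
    (∀ k : ℕ, b (k+1) = (1 - u (2*k)) * u (2*k+1) - (1 + u (2*k)) * u (2*k-1)) ∧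
    (∀ k : ℕ, (a (k+1))^2 = (1 - u (2*k)) * (1 - (u (2*k+1))^2) * (1 + u (2*k+2)))

/-- `z` is the sequence of canonical coefficients of a measure supported in `[0,∞)`. -/
def IsCanonicalZ (μ : Measure ℝ) (z : ℕ → ℝ) : Prop :=
  z 0 = 0 ∧ (∀ k : ℕ, 0 ≤ z (k+1)) ∧
  ∃ a b : ℕ → ℝ, IsJacobi μ a b ∧
    (∀ k : ℕ, b (k+1) = z (2*k) + z (2*k+1)) ∧
    (∀ k : ℕ, (a (k+1))^2 = z (2*k+1) * z (2*k+2))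

def Gfun (x : ℝ) : ℝ := x - 1 - Real.log x

/-- The semicircle law. -/
def SCm : Measure ℝ :=
  volume.withDensity fun x => ENNReal.ofReal (Real.sqrt (4 - x^2) / (2*π))

/-- The arcsine law on `(-2,2)`. -/
def ArcsineM : Measure ℝ :=
  volume.withDensity fun x => ENNReal.ofReal (1 / (π * Real.sqrt (4 - x^2)))

/-- The measure with density `(2/(π|q-p|)) √((x-p)/(q-x))` between `p` and `q`. -/
def Dmeas (p q : ℝ) : Measure ℝ :=
  volume.withDensity fun x => ENNReal.ofReal (2/(π * |q - p|) * Real.sqrt ((x - p)/(q - x)))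

/-- The point `e^{iθ}` on the unit circle. -/
def ctheta (θ : ℝ) : ℂ := Complex.exp (θ * Complex.I)

/-- Reversed polynomial `Φ*` with conjugated coefficients: `Φ*(z) = z^k conj(Φ(1/conj z))`. -/
def polyStar (P : Polynomial ℂ) : Polynomial ℂ := (P.map (starRingEnd ℂ)).reverse

/-- `α` is the sequence of Verblunsky coefficients of the measure `ν` on the unit circle
(`ν` being given in angle coordinates, carried by `[0, 2π)`): the monic orthogonal
polynomials of `ν` satisfy the Szegő recursion with coefficients `α`. -/
def IsVerblunsky (ν : Measure ℝ) (α : ℕ → ℂ) : Prop :=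
  (∀ k, ‖α k‖ < 1) ∧
  ∃ Φ : ℕ → Polynomial ℂ,
    (∀ k, (Φ k).Monic) ∧ (∀ k, (Φ k).natDegree = k) ∧
    (∀ j k, j ≠ k →
      ∫ θ, conj ((Φ j).eval (ctheta θ)) * (Φ k).eval (ctheta θ) ∂ν = 0) ∧
    (∀ k, Φ (k+1) = Polynomial.X * Φ k - Polynomial.C (conj (α k)) * polyStar (Φ k))

/-- `γ` is the sequence of deformed Verblunsky coefficients of `ν`. -/
def IsDeformedVerblunsky (ν : Measure ℝ) (γ : ℕ → ℂ) : Prop :=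
  ∃ α : ℕ → ℂ, IsVerblunsky ν α ∧
    ∀ k : ℕ, γ k = conj (α k) * ∏ j ∈ Finset.range k, (1 - conj (γ j)) / (1 - γ j)

/-- Symmetry of a measure on the circle (in angle coordinates): invariance under conjugation. -/
def SymmCircle (ν : Measure ℝ) : Prop :=
  (ν.map ctheta).map (starRingEnd ℂ) = ν.map ctheta

/-- The uniform measure on the circle, in angle coordinates. -/
def UNIFm : Measure ℝ :=
  volume.withDensity fun θ => ENNReal.ofReal (if 0 ≤ θ ∧ θ < 2*π then 1/(2*π) else 0)

end SumRules

namespace SumRules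

/-- Outlier contribution for the Killip–Simon sum rule (`+∞` inside `(-2,2)`). -/
def FSC (x : ℝ) : ℝ≥0∞ :=
  if 2 ≤ |x| then
    ENNReal.ofReal (|x|/2 * Real.sqrt (x^2 - 4) - 2 * Real.log ((|x| + Real.sqrt (x^2 - 4))/2))
  else ⊤

/-- Coefficient side of the Killip–Simon sum rule. -/
def IH (a b : ℕ → ℝ) : ℝ≥0∞ :=
  (1/2 : ℝ≥0∞) * ∑' k : ℕ, ENNReal.ofReal ((b (k+1))^2)
    + ∑' k : ℕ, ENNReal.ofReal (Gfun ((a (k+1))^2))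

def tauM (τ : ℝ) : ℝ := (1 - Real.sqrt τ)^2
def tauP (τ : ℝ) : ℝ := (1 + Real.sqrt τ)^2

/-- The Marchenko–Pastur law with parameter `τ`. -/
def MPm (τ : ℝ) : Measure ℝ :=
  volume.withDensity fun x =>
    ENNReal.ofReal (Real.sqrt ((x - tauM τ) * (tauP τ - x)) / (2*π*τ*x))

/-- Outlier contribution for the Marchenko–Pastur sum rule. -/
def FMP (τ : ℝ) (x : ℝ) : ℝ≥0∞ :=
  if tauP τ ≤ x then
    ENNReal.ofReal (∫ t in (tauP τ)..x, Real.sqrt ((t - tauP τ) * (t - tauM τ)) / (τ*t))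
  else if 0 < x ∧ x ≤ tauM τ then
    ENNReal.ofReal (∫ t in x..(tauM τ), Real.sqrt ((t - tauP τ) * (t - tauM τ)) / (τ*t))
  else ⊤

/-- Coefficient side of the Marchenko–Pastur sum rule. -/
def IL (τ : ℝ) (z : ℕ → ℝ) : ℝ≥0∞ :=
  ∑' k : ℕ, ENNReal.ofReal (τ⁻¹ * Gfun (z (2*k+1)) + Gfun (τ⁻¹ * z (2*k+2)))

def uPl (κ₁ κ₂ : ℝ) : ℝ :=
  2*(κ₂^2 - κ₁^2 + 4*Real.sqrt ((1+κ₁)*(1+κ₂)*(1+κ₁+κ₂)))/(2+κ₁+κ₂)^2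
def uMi (κ₁ κ₂ : ℝ) : ℝ :=
  2*(κ₂^2 - κ₁^2 - 4*Real.sqrt ((1+κ₁)*(1+κ₂)*(1+κ₁+κ₂)))/(2+κ₁+κ₂)^2

/-- The Kesten–McKay law with parameters `κ₁, κ₂`. -/
def KMKm (κ₁ κ₂ : ℝ) : Measure ℝ :=
  volume.withDensity fun x =>
    ENNReal.ofReal ((2+κ₁+κ₂)/(2*π) * Real.sqrt ((x - uMi κ₁ κ₂) * (uPl κ₁ κ₂ - x)) / (4 - x^2))

def ue (κ₁ κ₂ : ℝ) : ℝ := -(κ₁+κ₂)/(2+κ₁+κ₂)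
def uo (κ₁ κ₂ : ℝ) : ℝ := (κ₂-κ₁)/(2+κ₁+κ₂)

def He (κ₁ κ₂ u : ℝ) : ℝ :=
  -(1+κ₁+κ₂) * Real.log ((1-u)/(1 - ue κ₁ κ₂)) - Real.log ((1+u)/(1 + ue κ₁ κ₂))
def Ho (κ₁ κ₂ u : ℝ) : ℝ :=
  -(1+κ₁) * Real.log ((1-u)/(1 - uo κ₁ κ₂)) - (1+κ₂) * Real.log ((1+u)/(1 + uo κ₁ κ₂))

/-- Coefficient side of the Kesten–McKay sum rule. -/
def IJ (κ₁ κ₂ : ℝ) (u : ℕ → ℝ) : ℝ≥0∞ :=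
  ∑' k : ℕ, (ENNReal.ofReal (Ho κ₁ κ₂ (u (2*k+1))) + ENNReal.ofReal (He κ₁ κ₂ (u (2*k+2))))

/-- Outlier contribution for the Kesten–McKay sum rule. -/
def FKMK (κ₁ κ₂ : ℝ) (x : ℝ) : ℝ≥0∞ :=
  if uPl κ₁ κ₂ ≤ x then
    ENNReal.ofReal (∫ t in (uPl κ₁ κ₂)..x,
      (2+κ₁+κ₂) * Real.sqrt ((t - uPl κ₁ κ₂) * (t - uMi κ₁ κ₂)) / (4 - t^2))
  else if x ≤ uMi κ₁ κ₂ then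
    ENNReal.ofReal (∫ t in x..(uMi κ₁ κ₂),
      (2+κ₁+κ₂) * Real.sqrt ((t - uPl κ₁ κ₂) * (t - uMi κ₁ κ₂)) / (4 - t^2))
  else ⊤

def Hgw (g : ℝ) : ℝ := 1 - Real.sqrt (1 - g^2) + Real.log ((1 + Real.sqrt (1 - g^2))/2)

def thetaG (g : ℝ) : ℝ := 2 * Real.arcsin (Real.sqrt (1/|g|))

/-- The Gross–Witten measures, in angle coordinates. -/
def GWm (g : ℝ) : Measure ℝ :=
  if |g| ≤ 1 then
    volume.withDensity fun θ =>
      ENNReal.ofReal (if 0 ≤ θ ∧ θ < 2*π then (1 + g * Real.cos θ)/(2*π) else 0)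
  else if g < -1 then
    volume.withDensity fun θ => ENNReal.ofReal (
      if π - thetaG g ≤ θ ∧ θ ≤ π + thetaG g then
        |g| / π * Real.sin (θ/2) * Real.sqrt (Real.sin (θ/2)^2 - Real.cos (thetaG g/2)^2)
      else 0)
  else
    volume.withDensity fun θ => ENNReal.ofReal (
      if -thetaG g ≤ θ ∧ θ ≤ thetaG g then
        g/π * Real.cos (θ/2) * Real.sqrt (Real.sin (thetaG g/2)^2 - Real.sin (θ/2)^2)
      else 0)

def thetaD (d : ℝ) : ℝ := 2 * Real.arcsin (d/(1+d))
def gammaD (d : ℝ) : ℝ := -d/(1+d)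

/-- The Hua–Pickrell measure, in angle coordinates. -/
def HPm (d : ℝ) : Measure ℝ :=
  volume.withDensity fun θ => ENNReal.ofReal (
    if thetaD d < θ ∧ θ < 2*π - thetaD d then
      (1+d) * Real.sqrt (Real.sin (θ/2)^2 - Real.sin (thetaD d/2)^2) / (2*π*Real.sin (θ/2))
    else 0)

/-- The entropy-like function appearing in the Hua–Pickrell sum rule. -/
def HHP (d : ℝ) (γ : ℂ) : ℝ :=
  -Real.log ((1 - ‖γ‖^2)/(1 - (gammaD d)^2)) - 2*d*Real.log (‖1 - γ‖/(1 - gammaD d))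

/-- Outlier contribution for the Hua–Pickrell sum rule (in angle coordinates). -/
def FHP (d : ℝ) (θ : ℝ) : ℝ≥0∞ :=
  if θ ≤ thetaD d then
    ENNReal.ofReal (∫ φ in θ..(thetaD d),
      (1+d) * Real.sqrt (Real.sin (thetaD d/2)^2 - Real.sin (φ/2)^2) / Real.sin (φ/2))
  else if 2*π - thetaD d ≤ θ then
    ENNReal.ofReal (∫ φ in (2*π - thetaD d)..θ,
      (1+d) * Real.sqrt (Real.sin (thetaD d/2)^2 - Real.sin (φ/2)^2) / Real.sin (φ/2))
  else ⊤

/-- Set of outlying support points for a measure on the circle, in angle coordinates. -/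
def EST (ν : Measure ℝ) (tm tp : ℝ) : Set ℝ := suppSet ν \ Icc tm tp

/-- `ν ∈ 𝒮₁^𝕋(tm, tp)` (in angle coordinates). -/
def InS1T (ν : Measure ℝ) (tm tp : ℝ) : Prop := (EST ν tm tp).Countable

/-- The measure `𝒟(2,-2)`, with density `(1/2π)√((2-x)/(2+x))` on `(-2,2)`
(a shift of the hard-edge Marchenko–Pastur law). -/
def Dhard : Measure ℝ :=
  volume.withDensity fun x => ENNReal.ofReal (Real.sqrt ((2 - x)/(2 + x)) / (2*π))

/-- The mixture `μ_g = |g| 𝒟(2,-2) + (1-|g|) Arcsine`. -/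
def mugMix (g : ℝ) : Measure ℝ :=
  ENNReal.ofReal |g| • Dhard + ENNReal.ofReal (1 - |g|) • ArcsineM

/-- The mixture `ρ_g = |g| SC + (1-|g|) Arcsine`. -/
def rhog (g : ℝ) : Measure ℝ :=
  ENNReal.ofReal |g| • SCm + ENNReal.ofReal (1 - |g|) • ArcsineM

def Cg (g : ℝ) : ℝ :=
  -|g| * (1 - Real.log 2) + 1 - Real.sqrt (1 - g^2) + Real.log ((1 + Real.sqrt (1 - g^2))/2)

/-- The measure with density `(1/2π)(2+x)^{3/2}(2-x)^{1/2}` on `[-2,2]`. -/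
def muHat : Measure ℝ :=
  volume.withDensity fun x =>
    ENNReal.ofReal ((2 + x) * Real.sqrt (2 + x) * Real.sqrt (2 - x) / (2*π))

/-- The Poisson kernel measure `Pois(ζ)`, in angle coordinates. -/
def PoisM (ζ : ℂ) : Measure ℝ :=
  volume.withDensity fun θ => ENNReal.ofReal (
    if 0 ≤ θ ∧ θ < 2*π then (1 - ‖ζ‖^2)/(2*π*‖ctheta θ - ζ‖^2) else 0)

/-- The Carathéodory function of a measure on the circle (angle coordinates). -/
def Cara (ν : Measure ℝ) (z : ℂ) : ℂ := ∫ θ, (ctheta θ + z)/(ctheta θ - z) ∂ν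

/-- `f` is the Schur function of `ν`. -/
def IsSchurFn (ν : Measure ℝ) (f : ℂ → ℂ) : Prop :=
  DifferentiableOn ℂ f (Metric.ball 0 1) ∧
  (∀ z ∈ Metric.ball (0:ℂ) 1, ‖f z‖ ≤ 1) ∧
  (∀ z ∈ Metric.ball (0:ℂ) 1, Cara ν z - 1 = z * f z * (Cara ν z + 1))

/-- Möbius transform of the unit disk. -/
def mtrans (ρ z : ℂ) : ℂ := (z - ρ)/(1 - conj ρ * z)

def npRaw (ρ : ℂ) (g : ℂ → ℂ) (z : ℂ) : ℂ :=
  ((-ρ/(‖ρ‖ : ℂ)) / mtrans ρ z) * ((g z - g ρ)/(1 - conj (g ρ) * g z))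

-- One step of the Nevanlinna–Pick algorithm at `ρ` (the removable singularity at `ρ`
-- is filled in by the limit).
open Classical in
def npStep (ρ : ℂ) (g : ℂ → ℂ) : ℂ → ℂ := fun z =>
  if z = ρ then limUnder (𝓝[≠] ρ) (npRaw ρ g) else npRaw ρ g z

def schurRaw (g : ℂ → ℂ) (z : ℂ) : ℂ := ((g z - g 0)/z)/(1 - conj (g 0) * g z)

-- One step of the classical Schur algorithm (the removable singularity at `0`
-- is filled in by the limit).
open Classical in
def schurStep (g : ℂ → ℂ) : ℂ → ℂ := fun z =>
  if z = 0 then limUnder (𝓝[≠] (0:ℂ)) (schurRaw g) else schurRaw g z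

def xdHP (d : ℝ) : ℝ := 2*(1 + 2*d - d^2)/(1+d)^2

def uKMK (d : ℝ) : ℝ := 2*Real.sqrt (1 + 2*d)/(1+d)

end SumRules

section
namespace SumRules

structure Rec (a b : ℕ → ℝ) (p : ℕ → ℝ[X]) : Prop where
  a_pos : ∀ k, 0 < a (k+1)
  deg : ∀ k, (p k).natDegree = k
  lead : ∀ k, 0 < (p k).leadingCoeff
  p0 : p 0 = 1
  step0 : C (a 1) * p 1 = X - C (b 1)
  step : ∀ k, C (a (k+2)) * p (k+2) = (X - C (b (k+2))) * p (k+1) - C (a (k+1)) * p k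

def Ap (a : ℕ → ℝ) (p : ℕ → ℝ[X]) (m : ℕ) : ℝ[X] := C (a (m+1)) * p (m+1)

/-- `D = A² + B² - x A B`. -/
def Dp (a : ℕ → ℝ) (p : ℕ → ℝ[X]) (m : ℕ) : ℝ[X] :=
  Ap a p m ^ 2 + p m ^ 2 - X * Ap a p m * p m

def hom (k : ℕ) (f : ℝ[X]) : ℝ[X] :=
  ∑ i ∈ Finset.range (k+1), C (f.coeff i) * (X^2+1)^i * X^(k-i)

def Ut (a : ℕ → ℝ) (p : ℕ → ℝ[X]) (m : ℕ) : ℝ[X] := hom (m+1) (Ap a p m) - X^2 * hom m (p m)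

lemma hom_sub (k : ℕ) (f g : ℝ[X]) : hom k (f - g) = hom k f - hom k g := by
  simp only [hom, coeff_sub, C_sub, sub_mul, Finset.sum_sub_distrib]

lemma hom_C_mul (k : ℕ) (c : ℝ) (f : ℝ[X]) : hom k (C c * f) = C c * hom k f := by
  simp only [hom, coeff_C_mul, C_mul, mul_assoc, Finset.mul_sum]

lemma hom_X_mul (k : ℕ) (f : ℝ[X]) : hom (k+1) (X * f) = (X^2+1) * hom k f := by
  unfold hom
  rw [Finset.sum_range_succ', Finset.mul_sum]
  simp only [coeff_X_mul, coeff_X_mul_zero, map_zero, zero_mul, add_zero]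
  refine Finset.sum_congr rfl fun i hi => ?_
  rw [Nat.add_sub_add_right]; ring

lemma hom_succ (k : ℕ) (f : ℝ[X]) (hf : f.natDegree ≤ k) : hom (k+1) f = X * hom k f := by
  unfold hom
  rw [Finset.sum_range_succ, Finset.mul_sum, coeff_eq_zero_of_natDegree_lt (by omega)]
  simp only [map_zero, zero_mul, add_zero]
  refine Finset.sum_congr rfl fun i hi => ?_
  have : k + 1 - i = (k - i) + 1 := by have := Finset.mem_range.1 hi; omega
  rw [this]; ring

lemma hom_eval_zero (k : ℕ) (f : ℝ[X]) : (hom k f).eval 0 = f.coeff k := by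
  unfold hom
  rw [eval_finsetSum, Finset.sum_range_succ, Finset.sum_eq_zero]
  · simp
  · intro i hi
    have := Finset.mem_range.1 hi
    have : k - i ≠ 0 := by omega
    simp [this]

lemma hom_aeval {K : Type*} [Field K] [Algebra ℝ K] (k : ℕ) (f : ℝ[X]) (hf : f.natDegree ≤ k)
    (z : K) (hz : z ≠ 0) : aeval z (hom k f) = z^k * aeval (z + z⁻¹) f := by
  rw [aeval_eq_sum_range' (Nat.lt_succ_of_le hf) (z + z⁻¹), Finset.mul_sum]
  unfold hom
  rw [map_sum]
  refine Finset.sum_congr rfl fun i hi => ?_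
  have hi' : i ≤ k := by have := Finset.mem_range.1 hi; omega
  simp only [map_mul, aeval_C, map_pow, map_add, aeval_X, map_one, Algebra.smul_def]
  have h1 : z^2+1 = z * (z + z⁻¹) := by field_simp
  have h2 : z^k = z^i * z^(k-i) := by rw [← pow_add]; congr 1; omega
  rw [h1, h2, mul_pow]; ring

namespace Rec
variable {a b : ℕ → ℝ} {p : ℕ → ℝ[X]}

lemma Ap_zero (h : Rec a b p) : Ap a p 0 = X - C (b 1) := h.step0

lemma Ap_succ (h : Rec a b p) (m : ℕ) :
    Ap a p (m+1) = (X - C (b (m+2))) * p (m+1) - C (a (m+1)) * p m := h.step m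

lemma Ap_deg (h : Rec a b p) (m : ℕ) : (Ap a p m).natDegree = m+1 := by
  rw [Ap, natDegree_C_mul (h.a_pos m).ne', h.deg]

lemma Ap_ne (h : Rec a b p) (m : ℕ) : Ap a p m ≠ 0 := by
  intro h0; have := h.Ap_deg m; rw [h0] at this; simp at this

lemma p_ne (h : Rec a b p) (m : ℕ) : p m ≠ 0 := by
  intro h0; have := h.lead m; rw [h0] at this; simp at this

lemma coprime (h : Rec a b p) (m : ℕ) : IsCoprime (Ap a p m) (p m) := by
  induction m with
  | zero => rw [h.p0]; exact isCoprime_one_right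
  | succ m ih =>
    rw [h.Ap_succ]
    have h1 : IsCoprime (p m) (p (m+1)) := by
      rw [Ap] at ih
      exact ih.symm.of_mul_right_right
    have h2 : IsCoprime (C (a (m+1)) * p m) (p (m+1)) :=
      IsCoprime.mul_left ⟨C (a (m+1))⁻¹, 0, by
        rw [zero_mul, add_zero, ← C_mul, inv_mul_cancel₀ (h.a_pos m).ne', C_1]⟩ h1
    have := (IsCoprime.neg_left h2).add_mul_right_left (X - C (b (m+2)))
    have e : (X - C (b (m+2))) * p (m+1) - C (a (m+1)) * p m
      = -(C (a (m+1)) * p m) + (X - C (b (m+2))) * p (m+1) := by ring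
    rw [e]; exact this

lemma cd_im (h : Rec a b p) (m : ℕ) (x : ℂ) :
    (aeval x (Ap a p m) * conj (aeval x (p m))).im
      = x.im * ∑ k ∈ Finset.range (m+1), ‖aeval x (p k)‖^2 := by
  induction m with
  | zero => rw [h.Ap_zero]; simp [h.p0]
  | succ m ih =>
    rw [Finset.sum_range_succ, mul_add, ← ih, h.Ap_succ, Ap]
    simp only [map_sub, map_mul, aeval_X, aeval_C, Complex.coe_algebraMap]
    rw [← Complex.normSq_eq_norm_sq, Complex.normSq_apply]
    simp [Complex.mul_im, Complex.mul_re, Complex.sub_re, Complex.sub_im]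
    ring

lemma cd_deriv (h : Rec a b p) (m : ℕ) :
    derivative (Ap a p m) * p m - Ap a p m * derivative (p m)
      = ∑ k ∈ Finset.range (m+1), p k ^ 2 := by
  induction m with
  | zero => rw [h.Ap_zero]; simp [h.p0]
  | succ m ih =>
    rw [Finset.sum_range_succ, ← ih, h.Ap_succ, Ap]
    simp only [derivative_sub, derivative_mul, derivative_X, derivative_C]
    ring

lemma Ut_zero (h : Rec a b p) : Ut a p 0 = 1 - C (b 1) * X := by
  rw [Ut, h.Ap_zero, h.p0]
  simp [hom, Finset.sum_range_succ, coeff_X, coeff_C]; ring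

lemma Ut_aeval {K : Type*} [Field K] [Algebra ℝ K] (h : Rec a b p) (m : ℕ) (z : K) (hz : z ≠ 0) :
    aeval z (Ut a p m) = z^(m+1) * (aeval (z + z⁻¹) (Ap a p m) - z * aeval (z + z⁻¹) (p m)) := by
  rw [Ut, map_sub, map_mul, hom_aeval _ _ (h.Ap_deg m).le _ hz, hom_aeval _ _ (h.deg m).le _ hz]
  simp only [map_pow, aeval_X]; ring

lemma Ut_eval (h : Rec a b p) (m : ℕ) (z : ℝ) (hz : z ≠ 0) :
    (Ut a p m).eval z = z^(m+1) * ((Ap a p m).eval (z + z⁻¹) - z * (p m).eval (z + z⁻¹)) := by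
  have := h.Ut_aeval (K := ℝ) m z hz
  simpa using this

lemma Ut_succ (h : Rec a b p) (m : ℕ) :
    C (a (m+1)) * Ut a p (m+1) = (1 - C (b (m+2)) * X) * Ut a p m
      + X^2 * hom m (p m) * (1 - C (a (m+1))^2 - C (b (m+2)) * X) := by
  have e1 : Ut a p (m+1) = (1 - C (b (m+2)) * X) * hom (m+1) (p (m+1))
      - C (a (m+1)) * X^2 * hom m (p m) := by
    rw [Ut, h.Ap_succ, sub_mul, hom_sub, hom_sub, hom_X_mul, hom_C_mul, hom_C_mul,
      hom_succ _ _ (h.deg (m+1)).le, hom_succ (m+1) (p m) (by rw [h.deg]; omega),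
      hom_succ m (p m) (by rw [h.deg])]
    ring
  have e2 : Ut a p m = C (a (m+1)) * hom (m+1) (p (m+1)) - X^2 * hom m (p m) := by
    rw [Ut, Ap, hom_C_mul]
  rw [e1, e2]; ring

lemma Ut_coeff_zero (h : Rec a b p) (m : ℕ) : (Ut a p m).coeff 0 = (p m).leadingCoeff := by
  rw [coeff_zero_eq_eval_zero, Ut]
  simp only [eval_sub, eval_mul, eval_pow, eval_X, hom_eval_zero]
  have := h.Ap_succ m
  cases m with
  | zero => rw [h.Ap_zero, h.p0]; simp [coeff_X, coeff_C]
  | succ m =>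
    rw [h.Ap_succ, sub_mul, coeff_sub, coeff_sub, coeff_X_mul, coeff_C_mul, coeff_C_mul,
      coeff_eq_zero_of_natDegree_lt (p := p (m+1)) (n := m+1+1) (by rw [h.deg]; omega),
      coeff_eq_zero_of_natDegree_lt (p := p m) (n := m+1+1) (by rw [h.deg]; omega), leadingCoeff, h.deg]
    ring

lemma lead_succ (h : Rec a b p) (m : ℕ) :
    a (m+1) * (p (m+1)).leadingCoeff = (p m).leadingCoeff := by
  have h1 := h.Ut_coeff_zero m
  rw [coeff_zero_eq_eval_zero, Ut] at h1
  simp only [eval_sub, eval_mul, eval_pow, eval_X, hom_eval_zero, Ap, coeff_C_mul] at h1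
  rw [leadingCoeff, h.deg]; linarith

/-- `I_m`. -/
def Isum (a b : ℕ → ℝ) (m : ℕ) : ℝ :=
  ∑ k ∈ Finset.range (m+1), (b (k+1))^2 / 2 + ∑ k ∈ Finset.range m, Gfun (a (k+1) ^ 2)

lemma Ut_coeffs (h : Rec a b p) (m : ℕ) :
    (((Ut a p m).coeff 1 / (Ut a p m).coeff 0)^2 - 2 * ((Ut a p m).coeff 2 / (Ut a p m).coeff 0)) / 2
      + Real.log ((Ut a p m).coeff 0 ^ 2) = Isum a b m := by
  induction m with
  | zero => rw [h.Ut_zero]; simp [Isum, coeff_one]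
  | succ m ih =>
    have ha := h.a_pos m
    have hs := h.Ut_succ m
    have k0 : (hom m (p m)).coeff 0 = (Ut a p m).coeff 0 := by
      rw [h.Ut_coeff_zero, coeff_zero_eq_eval_zero, hom_eval_zero, leadingCoeff, h.deg]
    have c0 := congrArg (fun q => coeff q 0) hs
    have c1 := congrArg (fun q => coeff q 1) hs
    have c2 := congrArg (fun q => coeff q 2) hs
    have e : (1 - C (b (m+2)) * X) * Ut a p m
      + X^2 * hom m (p m) * (1 - C (a (m+1))^2 - C (b (m+2)) * X)
      = Ut a p m - C (b (m+2)) * (X * Ut a p m) + X * (X * (C (1 - a (m+1)^2) * hom m (p m)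
        - C (b (m+2)) * (X * hom m (p m)))) := by
      simp only [C_sub, C_1, C_pow]; ring
    rw [e] at c0 c1 c2
    simp only [coeff_C_mul, coeff_add, coeff_sub, coeff_X_mul_zero] at c0 c1 c2
    rw [show (1:ℕ) = 0+1 from rfl, coeff_X_mul, coeff_X_mul] at c1
    rw [show (2:ℕ) = 0+1+1 from rfl, coeff_X_mul, coeff_X_mul, coeff_X_mul, coeff_sub,
      coeff_C_mul, coeff_C_mul] at c2
    simp only [coeff_X_mul_zero, zero_add, mul_zero, sub_zero, add_zero, k0] at c0 c1 c2
    norm_num at c2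
    have hpos : 0 < (Ut a p m).coeff 0 := by rw [h.Ut_coeff_zero]; exact h.lead m
    have d0 : (Ut a p (m+1)).coeff 0 = (Ut a p m).coeff 0 / a (m+1) := by
      rw [eq_div_iff ha.ne']; linarith
    have d1 : (Ut a p (m+1)).coeff 1 = ((Ut a p m).coeff 1 - b (m+2) * (Ut a p m).coeff 0)/ a (m+1) := by
      rw [eq_div_iff ha.ne']; linarith
    have d2 : (Ut a p (m+1)).coeff 2 = ((Ut a p m).coeff 2 - b (m+2) * (Ut a p m).coeff 1 +
       (1 - a (m+1)^2) * (Ut a p m).coeff 0)/ a (m+1) := by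
      rw [eq_div_iff ha.ne']; linarith
    have is : Isum a b (m+1) = Isum a b m + ((b (m+2))^2/2 + Gfun (a (m+1)^2)) := by
      unfold Isum
      rw [Finset.sum_range_succ _ (m+1), Finset.sum_range_succ (fun k => Gfun (a (k+1)^2)) m]; ring
    rw [is, ← ih, d0, d1, d2, div_pow _ (a (m+1)), Real.log_div (by positivity) (by positivity), Gfun]
    generalize (Ut a p m).coeff 0 = c0 at *
    generalize (Ut a p m).coeff 1 = c1 at *
    generalize (Ut a p m).coeff 2 = c2 at *
    field_simp
    ring

end Rec

lemma Rec.of_jacobi {μ : Measure ℝ} [IsProbabilityMeasure μ] {a b : ℕ → ℝ} (hab : IsJacobi μ a b) :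
    ∃ p, Rec a b p ∧
      (∀ j k, ∫ x, (p j).eval x * (p k).eval x ∂μ = if j = k then 1 else 0) := by
  obtain ⟨ha, p, hd, hl, ho, hr⟩ := hab
  have p0 : p 0 = 1 := by
    have h1 := eq_C_of_natDegree_eq_zero (hd 0)
    have h2 := ho 0 0
    have h3 := hl 0
    rw [h1] at h2 h3 ⊢
    simp at h2 h3
    have : (p 0).coeff 0 = 1 := by nlinarith
    rw [this]; simp
  refine ⟨p, ⟨ha, hd, hl, p0, ?_, ?_⟩, ho⟩
  · apply Polynomial.funext; intro x
    have := hr 0 x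
    simp [p0] at this ⊢; linarith
  · intro k
    apply Polynomial.funext; intro x
    have := hr (k+1) x
    simp at this ⊢; linarith

end SumRules
end

section
namespace SumRules

lemma eqOff {E : Type*} {f g : ℂ → E} (S : Set ℂ) (hS : S.Finite)
    (h : ∀ z, ‖z‖ = 1 → z ∉ S → f z = g z) :
    f =ᶠ[codiscreteWithin (Metric.sphere (0:ℂ) |1|)] g := by
  show {z | f z = g z} ∈ _
  rw [codiscreteWithin_iff_locallyFiniteComplementWithin]
  intro z _
  refine ⟨univ, univ_mem, hS.subset ?_⟩
  rintro w ⟨-, hw, hw2⟩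
  by_contra hwS
  exact hw2 (h w (by simpa using hw) hwS)

lemma avg_inv_sub {ζ : ℂ} (h0 : ζ ≠ 0) (h1 : ‖ζ‖ < 1) :
    CircleIntegrable (fun z => (z - ζ)⁻¹) 0 1 ∧ circleAverage (fun z => (z - ζ)⁻¹) 0 1 = 0 := by
  have hne : ∀ z ∈ Metric.sphere (0:ℂ) |1|, z - ζ ≠ 0 := by
    intro z hz h
    rw [sub_eq_zero] at h; subst h; simp at hz; linarith
  have hI : CircleIntegrable (fun z => (z - ζ)⁻¹) 0 1 := by
    apply ContinuousOn.circleIntegrable'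
    exact (continuousOn_id.sub continuousOn_const).inv₀ hne
  refine ⟨hI, ?_⟩
  have h2 : circleAverage (fun z ↦ ((z - 0) / (z - ζ)) • (fun _ : ℂ => (1:ℂ)) z) 0 1 = 1 :=
    DiffContOnCl.circleAverage_smul_div (c := (0:ℂ)) (R := 1) (w := ζ) (f := fun _ => (1:ℂ))
      diffContOnCl_const (by simpa using h1)
  have h3 : circleAverage (fun z ↦ ((z - 0) / (z - ζ)) • (fun _ : ℂ => (1:ℂ)) z) 0 1
      = circleAverage (fun z => (1:ℂ) + ζ • (z - ζ)⁻¹) 0 1 := by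
    apply circleAverage_congr_sphere
    intro z hz
    have := hne z hz
    simp only [smul_eq_mul]; field_simp; ring
  rw [h3, circleAverage_fun_add (circleIntegrable_const _ _ _) (hI.const_fun_smul),
    circleAverage_const] at h2
  have h4 : circleAverage (fun z => ζ • (z - ζ)⁻¹) 0 1 = ζ • circleAverage (fun z => (z - ζ)⁻¹) 0 1 :=
    circleAverage_fun_smul
  rw [h4] at h2
  simpa [h0] using h2

lemma avg_ratio (S : Finset ℂ) (V : ℂ[X]) (hV : ∀ z : ℂ, ‖z‖ ≤ 1 → V.eval z ≠ 0) :
    ∀ N : ℂ[X], (∀ ζ ∈ S, ζ ≠ 0 ∧ ‖ζ‖ ≤ 1 ∧ (‖ζ‖ = 1 → N.eval ζ = 0)) →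
    CircleIntegrable (fun z => N.eval z / ((∏ ζ ∈ S, (X - C ζ)) * V).eval z) 0 1 ∧
    circleAverage (fun z => N.eval z / ((∏ ζ ∈ S, (X - C ζ)) * V).eval z) 0 1 =
      N.eval 0 / ((∏ ζ ∈ S, (X - C ζ)) * V).eval 0 +
      ∑ ζ ∈ S, N.eval ζ / (ζ * (derivative ((∏ ζ ∈ S, (X - C ζ)) * V)).eval ζ) := by
  classical
  induction S using Finset.induction_on with
  | empty =>
    intro N _
    have hc : ContinuousOn (fun z => N.eval z / V.eval z) (Metric.closedBall 0 1) :=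
      N.continuous.continuousOn.div V.continuous.continuousOn (fun z hz => hV z (by simpa using hz))
    simp only [Finset.prod_empty, one_mul, Finset.sum_empty, add_zero]
    refine ⟨?_, ?_⟩
    · apply ContinuousOn.circleIntegrable'
      apply hc.mono
      intro z hz; simp at hz ⊢; exact hz.le
    · apply circleAverage_of_differentiable_on_off_countable (s := ∅) countable_empty
      · simpa using hc
      · intro z hz
        have : V.eval z ≠ 0 := hV z (by simp at hz; exact hz.le)
        exact N.differentiableAt.div V.differentiableAt this
  | insert ζ S hζ ih =>
    intro N hN
    set W1 := (∏ ζ ∈ S, (X - C ζ)) * V with hW1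
    have hW : (∏ ζ ∈ insert ζ S, (X - C ζ)) * V = (X - C ζ) * W1 := by
      rw [Finset.prod_insert hζ, hW1, mul_assoc]
    rw [hW]
    obtain ⟨hz0, hz1, hz2⟩ := hN ζ (Finset.mem_insert_self _ _)
    have hroot : ∀ z, ‖z‖ ≤ 1 → z ∉ S → W1.eval z ≠ 0 := by
      intro z hz hzS
      rw [hW1, eval_mul, eval_prod]
      refine mul_ne_zero (Finset.prod_ne_zero_iff.2 fun w hw => ?_) (hV z hz)
      simp only [eval_sub, eval_X, eval_C, sub_ne_zero]
      rintro rfl; exact hzS hw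
    have hroot2 : ∀ z ∈ S, W1.eval z = 0 := by
      intro z hz
      rw [hW1, eval_mul, eval_prod, Finset.prod_eq_zero hz (by simp), zero_mul]
    have hW1ζ : W1.eval ζ ≠ 0 := hroot ζ hz1 hζ
    set c := N.eval ζ / W1.eval ζ with hc
    obtain ⟨N1, hN1⟩ : (X - C ζ) ∣ N - C c * W1 := by
      rw [dvd_iff_isRoot]; simp [hc, hW1ζ]
    have hN1e : ∀ z, N.eval z = c * W1.eval z + (z - ζ) * N1.eval z := by
      intro z
      have := congrArg (eval z) hN1
      simp at this; linear_combination this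
    have hζS : ∀ w ∈ S, w - ζ ≠ 0 := by
      intro w hw h
      rw [sub_eq_zero] at h; subst h; exact hζ hw
    have hN1v : ∀ w ∈ S, N.eval w = (w - ζ) * N1.eval w := by
      intro w hw; rw [hN1e, hroot2 w hw]; ring
    obtain ⟨ihI, ihA⟩ := ih N1 (fun w hw => by
      obtain ⟨h1, h2, h3⟩ := hN w (Finset.mem_insert_of_mem hw)
      refine ⟨h1, h2, fun h => ?_⟩
      have := hN1v w hw
      rw [h3 h] at this
      exact (mul_eq_zero.1 this.symm).resolve_left (hζS w hw))
    have hcav : CircleIntegrable (fun z => c • (z - ζ)⁻¹) 0 1 ∧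
        circleAverage (fun z => c • (z - ζ)⁻¹) 0 1 = 0 := by
      rcases hz1.lt_or_eq with h | h
      · obtain ⟨h1, h2⟩ := avg_inv_sub hz0 h
        refine ⟨h1.const_fun_smul, ?_⟩
        have : circleAverage (fun z => c • (z - ζ)⁻¹) 0 1 = c • circleAverage (fun z => (z - ζ)⁻¹) 0 1 :=
          circleAverage_fun_smul
        rw [this, h2, smul_zero]
      · have : c = 0 := by rw [hc, hz2 h, zero_div]
        simp only [this, zero_smul]
        exact ⟨circleIntegrable_const _ _ _, circleAverage_const _ _ _⟩
    have heq : (fun z => N1.eval z / W1.eval z + c • (z - ζ)⁻¹) =ᶠ[codiscreteWithin (Metric.sphere (0:ℂ) |1|)]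
        (fun z => N.eval z / ((X - C ζ) * W1).eval z) := by
      apply eqOff (↑(insert ζ S) : Set ℂ) (Finset.finite_toSet _)
      intro z hz hzS
      simp at hzS
      have h1 : z - ζ ≠ 0 := sub_ne_zero.2 hzS.1
      have h2 := hroot z hz.le hzS.2
      rw [hN1e z]
      simp only [smul_eq_mul, eval_mul, eval_sub, eval_X, eval_C]
      field_simp; ring
    refine ⟨(ihI.add hcav.1).congr_codiscreteWithin heq, ?_⟩
    rw [← circleAverage_congr_codiscreteWithin heq one_ne_zero, circleAverage_fun_add ihI hcav.1,
      ihA, hcav.2, add_zero, Finset.sum_insert hζ]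
    have hd : ∀ w, (derivative ((X - C ζ) * W1)).eval w
        = W1.eval w + (w - ζ) * (derivative W1).eval w := by
      intro w; simp
    have hs : ∑ w ∈ S, N.eval w / (w * (derivative ((X - C ζ) * W1)).eval w)
        = ∑ w ∈ S, N1.eval w / (w * (derivative W1).eval w) := by
      refine Finset.sum_congr rfl fun w hw => ?_
      rw [hd, hroot2 w hw, hN1v w hw, zero_add, mul_left_comm,
        mul_div_mul_left _ _ (hζS w hw)]
    have h00 : W1.eval 0 ≠ 0 := hroot 0 (by simp) (fun h => (hN 0 (Finset.mem_insert_of_mem h)).1 rfl)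
    rw [hs, hd ζ, hN1e 0, ← add_assoc]
    congr 1
    rw [hN1e ζ]
    simp only [eval_mul, eval_sub, eval_X, eval_C, sub_self, zero_mul, add_zero, zero_sub]
    field_simp; ring

namespace Rec
variable {a b : ℕ → ℝ} {p : ℕ → ℝ[X]}

def Kp (p : ℕ → ℝ[X]) (m : ℕ) : ℝ[X] := ∑ k ∈ Finset.range (m+1), p k ^ 2

lemma Kp_ge (h : Rec a b p) (m : ℕ) (x : ℝ) : 1 ≤ (Kp p m).eval x := by
  rw [Kp, eval_finsetSum]
  have := Finset.single_le_sum (f := fun k => (p k ^ 2).eval x) (s := Finset.range (m+1))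
    (fun k _ => by rw [eval_pow]; positivity) (Finset.mem_range.2 (Nat.succ_pos m))
  simpa [h.p0] using this

lemma no_common (h : Rec a b p) (m : ℕ) {K : Type*} [Field K] [Algebra ℝ K] (x : K)
    (hA : aeval x (Ap a p m) = 0) (hB : aeval x (p m) = 0) : False := by
  obtain ⟨u, v, huv⟩ := h.coprime m
  have := congrArg (aeval x) huv
  simp [hA, hB] at this

lemma Ut_eval_zero (h : Rec a b p) (m : ℕ) : 0 < (Ut a p m).eval 0 := by
  rw [← coeff_zero_eq_eval_zero, h.Ut_coeff_zero]; exact h.lead m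

lemma root_ne_zero (h : Rec a b p) (m : ℕ) {z : ℂ} (hz : aeval z (Ut a p m) = 0) : z ≠ 0 := by
  rintro rfl
  have h1 : aeval (0:ℂ) (Ut a p m) = (((Ut a p m).eval 0 : ℝ) : ℂ) := by
    have := aeval_algebraMap_apply ℂ (0:ℝ) (Ut a p m)
    simpa using this
  rw [h1] at hz
  exact (h.Ut_eval_zero m).ne' (by exact_mod_cast hz)

lemma root_real (h : Rec a b p) (m : ℕ) {z : ℂ} (hz : aeval z (Ut a p m) = 0) (hz1 : ‖z‖ ≤ 1) :
    z.im = 0 := by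
  have h0 := h.root_ne_zero m hz
  rw [h.Ut_aeval m z h0] at hz
  have hA : aeval (z + z⁻¹) (Ap a p m) = z * aeval (z + z⁻¹) (p m) := by
    rcases mul_eq_zero.1 hz with h1 | h1
    · exact absurd h1 (pow_ne_zero _ h0)
    · exact sub_eq_zero.1 h1
  have hcd := h.cd_im m (z + z⁻¹)
  rw [hA, mul_assoc, Complex.mul_conj, Complex.normSq_eq_norm_sq, Complex.im_mul_ofReal] at hcd
  set S := ∑ k ∈ Finset.range (m+1), ‖aeval (z + z⁻¹) (p k)‖^2 with hS
  have hS1 : 1 ≤ S := by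
    have := Finset.single_le_sum (f := fun k => ‖aeval (z + z⁻¹) (p k)‖^2) (s := Finset.range (m+1))
      (fun k _ => by positivity) (Finset.mem_range.2 (Nat.succ_pos m))
    simpa [h.p0] using this
  have hn : 0 < Complex.normSq z := Complex.normSq_pos.2 h0
  have hn1 : Complex.normSq z ≤ 1 := by rw [Complex.normSq_eq_norm_sq]; nlinarith [norm_nonneg z]
  have hx : (z + z⁻¹).im = z.im * (1 - (Complex.normSq z)⁻¹) := by
    simp [Complex.inv_im]; field_simp; ring
  by_contra hne
  rw [hx, mul_assoc] at hcd
  have h2 := mul_left_cancel₀ hne hcd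
  have h3 : 1 ≤ (Complex.normSq z)⁻¹ := (one_le_inv₀ hn).2 hn1
  have h4 : ‖aeval (z + z⁻¹) (p m)‖^2 ≤ 0 := by rw [h2]; nlinarith
  have h5 : aeval (z + z⁻¹) (p m) = 0 := by
    have : ‖aeval (z + z⁻¹) (p m)‖ = 0 := by nlinarith [norm_nonneg (aeval (z + z⁻¹) (p m))]
    exact norm_eq_zero.1 this
  exact h.no_common m _ (by rw [hA, h5, mul_zero]) h5

/-- Real roots in the closed disc. -/
def Zs (a : ℕ → ℝ) (p : ℕ → ℝ[X]) (m : ℕ) : Finset ℝ :=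
  (Ut a p m).roots.toFinset.filter (fun z => |z| ≤ 1)

lemma Ut_ne (h : Rec a b p) (m : ℕ) : Ut a p m ≠ 0 := by
  intro h0; have := h.Ut_eval_zero m; rw [h0] at this; simp at this

lemma mem_Zs (h : Rec a b p) (m : ℕ) (z : ℝ) :
    z ∈ Zs a p m ↔ z ≠ 0 ∧ |z| ≤ 1 ∧
      (Ap a p m).eval (z + z⁻¹) = z * (p m).eval (z + z⁻¹) := by
  rw [Zs, Finset.mem_filter, Multiset.mem_toFinset, mem_roots (h.Ut_ne m), IsRoot.def]
  constructor
  · rintro ⟨h1, h2⟩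
    have h0 : z ≠ 0 := by rintro rfl; exact (h.Ut_eval_zero m).ne' h1
    rw [h.Ut_eval m z h0] at h1
    refine ⟨h0, h2, ?_⟩
    rcases mul_eq_zero.1 h1 with h1 | h1
    · exact absurd h1 (pow_ne_zero _ h0)
    · exact sub_eq_zero.1 h1
  · rintro ⟨h0, h1, h2⟩
    refine ⟨?_, h1⟩
    rw [h.Ut_eval m z h0, h2]; ring

lemma B_ne (h : Rec a b p) (m : ℕ) {z : ℝ} (hz : z ∈ Zs a p m) : (p m).eval (z + z⁻¹) ≠ 0 := by
  obtain ⟨h0, h1, h2⟩ := (h.mem_Zs m z).1 hz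
  intro hB
  exact h.no_common (K := ℝ) m (z + z⁻¹) (by simp [h2, hB]) (by simpa using hB)

lemma Ut_deriv (h : Rec a b p) (m : ℕ) {z : ℝ} (hz : z ∈ Zs a p m) :
    (derivative (Ut a p m)).eval z * (p m).eval (z + z⁻¹) =
      z^(m+1) * ((1 - (z^2)⁻¹) * (Kp p m).eval (z + z⁻¹) - (p m).eval (z + z⁻¹)^2) := by
  obtain ⟨h0, h1, h2⟩ := (h.mem_Zs m z).1 hz
  have hx : HasDerivAt (fun z : ℝ => z + z⁻¹) (1 - (z^2)⁻¹) z := by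
    have := (hasDerivAt_id z).add (hasDerivAt_inv h0)
    rw [sub_eq_add_neg]; exact this
  have hA : HasDerivAt (fun z : ℝ => (Ap a p m).eval (z + z⁻¹))
      ((derivative (Ap a p m)).eval (z + z⁻¹) * (1 - (z^2)⁻¹)) z :=
    HasDerivAt.comp z (h₂ := fun y => eval y (Ap a p m)) ((Ap a p m).hasDerivAt (z + z⁻¹)) hx
  have hB : HasDerivAt (fun z : ℝ => (p m).eval (z + z⁻¹))
      ((derivative (p m)).eval (z + z⁻¹) * (1 - (z^2)⁻¹)) z :=
    HasDerivAt.comp z (h₂ := fun y => eval y (p m)) ((p m).hasDerivAt (z + z⁻¹)) hx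
  have hU := (hasDerivAt_pow (m+1) z).mul (hA.sub ((hasDerivAt_id z).mul hB))
  have hev : (fun z : ℝ => (Ut a p m).eval z) =ᶠ[𝓝 z] ((fun z => z^(m+1)) * ((fun z : ℝ => (Ap a p m).eval (z + z⁻¹)) - (id * fun z : ℝ => (p m).eval (z + z⁻¹)))) := by
    filter_upwards [isOpen_ne.mem_nhds h0] with w hw
    rw [h.Ut_eval m w hw]; rfl
  have hun := ((Ut a p m).hasDerivAt z).unique (hU.congr_of_eventuallyEq hev)
  have hcd := congrArg (eval (z + z⁻¹)) (h.cd_deriv m)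
  rw [hun]
  simp only [eval_sub, eval_mul] at hcd
  rw [Kp, ← hcd]
  simp only [Pi.sub_apply, Pi.mul_apply, id, h2]
  ring

lemma deriv_ne (h : Rec a b p) (m : ℕ) {z : ℝ} (hz : z ∈ Zs a p m) :
    (1 - (z^2)⁻¹) * (Kp p m).eval (z + z⁻¹) - (p m).eval (z + z⁻¹)^2 < 0 := by
  obtain ⟨h0, h1, h2⟩ := (h.mem_Zs m z).1 hz
  have hB := h.B_ne m hz
  have h3 : 1 ≤ (z^2)⁻¹ := (one_le_inv₀ (by positivity)).2 (by rw [← sq_abs]; nlinarith [abs_nonneg z])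
  have := h.Kp_ge m (z + z⁻¹)
  have : 0 < (p m).eval (z + z⁻¹)^2 := by positivity
  nlinarith

lemma Ut_deriv_ne (h : Rec a b p) (m : ℕ) {z : ℝ} (hz : z ∈ Zs a p m) :
    (derivative (Ut a p m)).eval z ≠ 0 := by
  intro h0
  have := h.Ut_deriv m hz
  rw [h0, zero_mul] at this
  exact mul_ne_zero (pow_ne_zero _ ((h.mem_Zs m z).1 hz).1) (h.deriv_ne m hz).ne this.symm

lemma mem_Zs_of_complex (h : Rec a b p) (m : ℕ) {z : ℂ} (hz : aeval z (Ut a p m) = 0) (hz1 : ‖z‖ ≤ 1) :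
    ∃ r ∈ Zs a p m, z = (r : ℂ) := by
  have him := h.root_real m hz hz1
  have hzr : z = (z.re : ℂ) := by apply Complex.ext <;> simp [him]
  refine ⟨z.re, ?_, hzr⟩
  rw [Zs, Finset.mem_filter, Multiset.mem_toFinset, mem_roots (h.Ut_ne m), IsRoot.def]
  rw [hzr] at hz hz1
  constructor
  · have := aeval_algebraMap_apply ℂ (z.re:ℝ) (Ut a p m)
    simp only [Complex.coe_algebraMap, hz] at this
    simpa using this.symm
  · simpa using hz1

lemma Ut_factor (h : Rec a b p) (m : ℕ) : ∃ V : ℂ[X], (∀ z : ℂ, ‖z‖ ≤ 1 → V.eval z ≠ 0) ∧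
    (Ut a p m).map (algebraMap ℝ ℂ) = (∏ ζ ∈ (Zs a p m).image (fun r : ℝ => (r : ℂ)), (X - C ζ)) * V := by
  classical
  have hdv : (∏ r ∈ Zs a p m, (X - C r)) ∣ Ut a p m := by
    have : (Multiset.map (fun a => X - C a) (Zs a p m).val).prod ∣ Ut a p m := by
      rw [Multiset.prod_X_sub_C_dvd_iff_le_roots (h.Ut_ne m)]
      refine (Multiset.le_iff_subset (Zs a p m).nodup).2 ?_
      intro r hr
      have := (Finset.mem_filter.1 (Finset.mem_def.2 hr)).1
      exact Multiset.mem_toFinset.1 this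
    exact this
  obtain ⟨V, hV⟩ := hdv
  have hprod : (∏ ζ ∈ (Zs a p m).image (fun r : ℝ => (r : ℂ)), (X - C ζ))
      = (∏ r ∈ Zs a p m, (X - C r)).map (algebraMap ℝ ℂ) := by
    rw [Finset.prod_image (fun _ _ _ _ h => Complex.ofReal_injective h), Polynomial.map_prod]
    simp
  refine ⟨V.map (algebraMap ℝ ℂ), ?_, ?_⟩
  · intro z hz hVz
    have hVz' : aeval z V = 0 := by rw [← hVz, eval_map_algebraMap]
    have : aeval z (Ut a p m) = 0 := by rw [hV, map_mul, hVz', mul_zero]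
    obtain ⟨r, hr, rfl⟩ := h.mem_Zs_of_complex m this hz
    have hVr : V.eval r = 0 := by
      have := aeval_algebraMap_apply ℂ (r:ℝ) V
      simp only [Complex.coe_algebraMap, hVz'] at this
      simpa using this.symm
    apply h.Ut_deriv_ne m hr
    have h0 : (∏ x ∈ Zs a p m, eval r (X - C x)) = 0 := Finset.prod_eq_zero hr (by simp)
    rw [hV, derivative_mul, eval_add, eval_mul, eval_mul, hVr, eval_prod, h0]
    ring
  · rw [hprod, ← Polynomial.map_mul, ← hV]

end Rec
end SumRules
end

section
namespace SumRules

def wt (z : ℂ) : ℝ := 1 - (z^2).re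

lemma wt_circle (θ : ℝ) : wt (circleMap 0 1 θ) = 2 * sin θ ^ 2 := by
  have h1 : circleMap 0 1 θ = (cos θ : ℂ) + sin θ * Complex.I := by
    rw [circleMap, zero_add, Complex.exp_mul_I]; simp
  rw [wt, h1, pow_two]
  simp only [Complex.mul_re, Complex.add_re, Complex.add_im, Complex.ofReal_re, Complex.ofReal_im,
    Complex.I_re, Complex.I_im, Complex.mul_im]
  have := sin_sq_add_cos_sq θ
  simp; linarith

lemma re_circle (θ : ℝ) : (circleMap 0 1 θ).re = cos θ := by
  rw [circleMap, zero_add, Complex.exp_mul_I]; simp [Complex.cos_ofReal_re]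

lemma continuous_wt : Continuous wt := by unfold wt; fun_prop

lemma sc_meas : Measurable fun x : ℝ => ENNReal.ofReal (Real.sqrt (4 - x^2) / (2*π)) := by fun_prop

lemma SC_int (h : ℝ → ℝ) (hI : CircleIntegrable (fun z => wt z * h (2 * z.re)) 0 1) :
    Integrable h SCm ∧ ∫ x, h x ∂SCm = circleAverage (fun z => wt z * h (2 * z.re)) 0 1 := by
  set φ : ℝ → ℝ := fun θ => 2 * sin θ ^ 2 * h (2 * cos θ) with hφ
  have hφe : (fun θ => (fun z => wt z * h (2 * z.re)) (circleMap 0 1 θ)) = φ := by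
    funext θ; simp only [wt_circle, re_circle, hφ]
  have hI' : IntervalIntegrable φ volume 0 (2*π) := by
    have := hI; rw [CircleIntegrable, hφe] at this; exact this
  set g : ℝ → ℝ := fun x => Real.sqrt (4 - x^2) / (2*π) * h x with hg
  have hgd : (fun x => (ENNReal.ofReal (Real.sqrt (4 - x^2) / (2*π))).toReal • h x) = g := by
    funext x; rw [ENNReal.toReal_ofReal (by positivity)]; rfl
  have hsupp : Function.support g ⊆ Ioo (-2) 2 := by
    intro x hx
    by_contra hc
    apply hx
    have : 4 - x^2 ≤ 0 := by
      simp only [mem_Ioo, not_and_or, not_lt] at hc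
      rcases hc with hc | hc <;> nlinarith
    simp [hg, Real.sqrt_eq_zero_of_nonpos this]
  have himg : (fun θ => 2 * cos θ) '' (Ioo 0 π) = Ioo (-2) 2 := by
    ext x; constructor
    · rintro ⟨θ, ⟨h0, h1⟩, rfl⟩
      have e1 : cos θ < 1 := by
        have := cos_lt_cos_of_nonneg_of_le_pi (le_refl 0) h1.le h0
        simpa using this
      have e2 : -1 < cos θ := by
        have := cos_lt_cos_of_nonneg_of_le_pi h0.le (le_refl π) h1
        simpa using this
      constructor <;> simp <;> linarith
    · rintro ⟨h1, h2⟩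
      refine ⟨arccos (x/2), ⟨arccos_pos.2 (by linarith), ?_⟩, ?_⟩
      · rcases (arccos_le_pi (x/2)).lt_or_eq with h | h
        · exact h
        · have := cos_arccos (x := x/2) (by linarith) (by linarith)
          rw [h, cos_pi] at this; linarith
      · simp only; rw [cos_arccos (by linarith) (by linarith)]; ring
  have hinj : InjOn (fun θ => 2 * cos θ) (Ioo 0 π) := by
    intro x hx y hy hxy
    exact injOn_cos (Ioo_subset_Icc_self hx) (Ioo_subset_Icc_self hy) (by simp at hxy; exact hxy)
  have hder : ∀ x ∈ Ioo 0 π, HasDerivWithinAt (fun θ => 2 * cos θ) (2 * (-sin x)) (Ioo 0 π) x :=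
    fun x _ => ((hasDerivAt_cos x).const_mul 2).hasDerivWithinAt
  have hptw : ∀ θ ∈ Ioo 0 π, |2 * (-sin θ)| • g (2 * cos θ) = π⁻¹ * φ θ := by
    intro θ hθ
    have hs : 0 < sin θ := sin_pos_of_mem_Ioo hθ
    have : Real.sqrt (4 - (2 * cos θ)^2) = 2 * sin θ := by
      rw [show 4 - (2 * cos θ)^2 = (2 * sin θ)^2 by have := sin_sq_add_cos_sq θ; nlinarith]
      exact Real.sqrt_sq (by positivity)
    rw [mul_neg, abs_neg, abs_of_pos (by positivity)]
    simp only [hg, this, hφ, smul_eq_mul]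
    have := pi_ne_zero
    field_simp
  have hφI : IntegrableOn φ (Ioo 0 π) := by
    have := (hI'.mono_set (c := 0) (d := π) (by
      rw [uIcc_of_le pi_pos.le, uIcc_of_le (by positivity)]
      exact Icc_subset_Icc_right (by linarith [pi_pos])))
    rw [intervalIntegrable_iff_integrableOn_Ioo_of_le pi_pos.le] at this
    exact this
  have hgI : Integrable g := by
    rw [← integrableOn_iff_integrable_of_support_subset hsupp, ← himg,
      integrableOn_image_iff_integrableOn_abs_deriv_smul measurableSet_Ioo hder hinj]
    exact IntegrableOn.congr_fun (hφI.const_mul π⁻¹) (fun θ hθ => (hptw θ hθ).symm) measurableSet_Ioo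
  refine ⟨?_, ?_⟩
  · rw [SCm, integrable_withDensity_iff_integrable_smul' sc_meas (by simp), hgd]
    exact hgI
  · rw [SCm, integral_withDensity_eq_integral_toReal_smul sc_meas (by simp), hgd,
      ← setIntegral_eq_integral_of_forall_compl_eq_zero (s := Ioo (-2) 2) (fun x hx => by
        by_contra hc; exact hx (hsupp hc)), ← himg,
      integral_image_eq_integral_abs_deriv_smul measurableSet_Ioo hder hinj,
      setIntegral_congr_fun measurableSet_Ioo hptw, integral_const_mul]
    rw [circleAverage_def]
    have e : ∫ θ in (0:ℝ)..(2*π), wt (circleMap 0 1 θ) * h (2 * (circleMap 0 1 θ).re) = ∫ θ in (0:ℝ)..(2*π), φ θ := by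
      congr 1
    rw [e]
    have hI1 : IntervalIntegrable φ volume 0 π := by
      rw [intervalIntegrable_iff_integrableOn_Ioo_of_le pi_pos.le]; exact hφI
    have hI2 : IntervalIntegrable φ volume π (2*π) :=
      hI'.mono_set (by
        rw [uIcc_of_le (by linarith [pi_pos]), uIcc_of_le (by positivity)]
        exact Icc_subset_Icc_left (by linarith [pi_pos]))
    rw [← intervalIntegral.integral_add_adjacent_intervals hI1 hI2]
    have hsym : ∫ θ in π..(2*π), φ θ = ∫ θ in (0:ℝ)..π, φ θ := by
      have := intervalIntegral.integral_comp_sub_left (a := 0) (b := π) φ (2*π)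
      rw [show 2*π - π = π by ring, sub_zero] at this
      rw [← this]
      congr 1; funext θ
      simp only [hφ, sin_two_pi_sub, cos_two_pi_sub]; ring
    rw [hsym, intervalIntegral.integral_of_le pi_pos.le, integral_Ioc_eq_integral_Ioo, smul_eq_mul]
    have := pi_ne_zero
    field_simp; ring

instance : IsProbabilityMeasure SCm := by
  have hI : CircleIntegrable (fun z => wt z * (fun _ : ℝ => (1:ℝ)) (2 * z.re)) 0 1 :=
    (continuous_wt.mul continuous_const).continuousOn.circleIntegrable'
  obtain ⟨h1, h2⟩ := SC_int (fun _ => 1) hI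
  have h3 : circleAverage (fun z => wt z * (fun _ : ℝ => (1:ℝ)) (2 * z.re)) 0 1 = 1 := by
    have e : circleAverage (fun z : ℂ => (1:ℂ) - z^2) 0 1 = 1 := by
      rw [circleAverage_of_differentiable_on_off_countable (s := ∅) countable_empty
        (by fun_prop) (fun z _ => by fun_prop)]
      simp
    have e2 := ContinuousLinearMap.circleAverage_comp_comm (c := 0) (R := 1)
      (f := fun z : ℂ => (1:ℂ) - z^2) Complex.reCLM
      (Continuous.continuousOn (by fun_prop)).circleIntegrable'
    rw [e] at e2
    simp only [mul_one]
    have e3 : (fun z => wt z) = (⇑Complex.reCLM ∘ fun z : ℂ => (1:ℂ) - z ^ 2) := by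
      funext z; simp [wt]
    rw [e3, e2]; simp
  rw [h3] at h2
  have hfin : IsFiniteMeasure SCm := by
    have := (integrable_const_iff (c := (1:ℝ)) (μ := SCm)).1 h1
    simpa using this
  constructor
  simp only [integral_const, smul_eq_mul, mul_one, measureReal_def] at h2
  rw [← ENNReal.ofReal_toReal (measure_ne_top SCm univ), h2, ENNReal.ofReal_one]

lemma SC_compl : SCm (Ioo (-2) 2)ᶜ = 0 := by
  rw [SCm, withDensity_apply _ measurableSet_Ioo.compl]
  apply (setLIntegral_congr_fun measurableSet_Ioo.compl (g := fun _ => 0) ?_).trans (by simp)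
  intro x hc
  have : 4 - x^2 ≤ 0 := by
    simp only [mem_compl_iff, mem_Ioo, not_and_or, not_lt] at hc
    rcases hc with hc | hc <;> nlinarith
  simp [Real.sqrt_eq_zero_of_nonpos this]

end SumRules
end

section
namespace SumRules

lemma log_h_tendsto (w : ℂ) : Tendsto (fun z : ℂ => (Complex.log (1 - w*z) + w*z)/z^2) (𝓝[≠] 0) (𝓝 (-w^2/2)) := by
  have hsmall : ∀ᶠ z : ℂ in 𝓝[≠] 0, ‖w*z‖ ≤ 1/2 := by
    have : Tendsto (fun z : ℂ => ‖w*z‖) (𝓝[≠] 0) (𝓝 0) := by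
      have : Continuous (fun z : ℂ => ‖w*z‖) := by fun_prop
      have := this.tendsto 0
      simp at this
      simpa using this.mono_left nhdsWithin_le_nhds
    exact this.eventually_le_const (by norm_num)
  rw [tendsto_iff_norm_sub_tendsto_zero]
  have hb : Tendsto (fun z : ℂ => ‖w‖^3 * ‖z‖) (𝓝[≠] 0) (𝓝 0) := by
    have : Continuous (fun z : ℂ => ‖w‖^3 * ‖z‖) := by fun_prop
    have := this.tendsto 0
    simp at this
    simpa using this.mono_left nhdsWithin_le_nhds
  refine squeeze_zero' (Eventually.of_forall fun z => norm_nonneg _) ?_ hb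
  filter_upwards [hsmall, self_mem_nhdsWithin] with z hz hz0
  have hz0' : z ≠ 0 := hz0
  have h1 := Complex.norm_log_sub_logTaylor_le 2 (z := -(w*z)) (by rw [norm_neg]; linarith)
  have h2 : (Complex.log (1 - w*z) + w*z)/z^2 - -w^2/2
     = (Complex.log (1 + -(w*z)) - Complex.logTaylor (2+1) (-(w*z)))/z^2 := by
    rw [Complex.logTaylor_succ, Complex.logTaylor_succ, Complex.logTaylor_succ, Complex.logTaylor_zero]
    simp
    field_simp; ring
  rw [h2, norm_div, norm_pow, div_le_iff₀ (by positivity)]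
  refine h1.trans ?_
  rw [norm_neg]
  have h3 : (1 - ‖w*z‖)⁻¹ ≤ 2 := by
    rw [inv_le_comm₀ (by linarith) (by norm_num)]; linarith
  have : ‖w‖^3 * ‖z‖ * ‖z‖^2 = ‖w*z‖^3 := by rw [norm_mul]; ring
  rw [this]
  have h4 : 0 ≤ ‖w*z‖^3 := by positivity
  norm_num
  rw [norm_mul] at *
  nlinarith

lemma wt_eq {z : ℂ} (hz : ‖z‖ = 1) : (wt z : ℂ) = 1 - (z^2 + (z^2)⁻¹)/2 := by
  have h1 : (z^2)⁻¹ = conj (z^2) := by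
    rw [Complex.inv_def, Complex.normSq_eq_norm_sq, norm_pow, hz]; simp
  rw [h1, Complex.add_conj, wt]; push_cast; ring

lemma avg_log_lt {w : ℂ} (hw : ‖w‖ < 1) :
    CircleIntegrable (fun z => wt z * Real.log (‖1 - w*z‖^2)) 0 1 ∧
    circleAverage (fun z => wt z * Real.log (‖1 - w*z‖^2)) 0 1 = (w^2).re/2 := by
  have hslit : ∀ z ∈ Metric.closedBall (0:ℂ) 1, 1 - w*z ∈ Complex.slitPlane := by
    intro z hz
    left
    have : ‖w*z‖ < 1 := by
      rw [norm_mul]; simp at hz; nlinarith [norm_nonneg w, norm_nonneg z]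
    have := (Complex.re_le_norm (w*z))
    simp only [Complex.sub_re, Complex.one_re]; linarith
  have hfd : ∀ z ∈ Metric.closedBall (0:ℂ) 1, DifferentiableAt ℂ (fun z => Complex.log (1 - w*z)) z :=
    fun z hz => DifferentiableAt.clog (by fun_prop) (hslit z hz)
  have hfc : ContinuousOn (fun z => Complex.log (1 - w*z)) (Metric.closedBall (0:ℂ) 1) :=
    fun z hz => (hfd z hz).continuousAt.continuousWithinAt
  have hsph : Metric.sphere (0:ℂ) |1| ⊆ Metric.closedBall (0:ℂ) 1 := by
    intro z hz; simp at hz ⊢; exact hz.le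
  set h : ℂ → ℂ := Function.update (fun z : ℂ => (Complex.log (1 - w*z) + w*z)/z^2) 0 (-w^2/2) with hh
  have hhd : ∀ z ∈ Metric.closedBall (0:ℂ) 1, z ≠ 0 → DifferentiableAt ℂ h z := by
    intro z hz hz0
    have : DifferentiableAt ℂ (fun z : ℂ => (Complex.log (1 - w*z) + w*z)/z^2) z :=
      ((hfd z hz).add (by fun_prop)).div (by fun_prop) (by positivity)
    refine this.congr_of_eventuallyEq ?_
    filter_upwards [isOpen_ne.mem_nhds hz0] with y hy
    rw [hh, Function.update_of_ne hy]
  have hhc : ContinuousOn h (Metric.closedBall (0:ℂ) 1) := by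
    intro z hz
    by_cases hz0 : z = 0
    · subst hz0
      apply ContinuousAt.continuousWithinAt
      rw [hh, continuousAt_update_same]
      exact log_h_tendsto w
    · exact (hhd z hz hz0).continuousAt.continuousWithinAt
  -- the auxiliary analytic function
  set F : ℂ → ℂ := fun z => 2 * Complex.log (1 - w*z) - z^2 * Complex.log (1 - w*z) - h z with hF
  have hFc : ContinuousOn F (Metric.closedBall (0:ℂ) 1) := by
    apply ContinuousOn.sub (ContinuousOn.sub (continuousOn_const.mul hfc) (ContinuousOn.mul (by fun_prop) hfc)) hhc
  have hFa : circleAverage F 0 1 = w^2/2 := by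
    rw [circleAverage_of_differentiable_on_off_countable (s := {0}) (countable_singleton 0)
      (by simpa using hFc)]
    · simp [hF, hh]; ring
    · rintro z ⟨hz, hz0⟩
      have hz' : z ∈ Metric.closedBall (0:ℂ) 1 := by simp at hz ⊢; exact hz.le
      exact (((differentiableAt_const _).mul (hfd z hz')).sub
        ((differentiableAt_id.pow 2).mul (hfd z hz'))).sub (hhd z hz' (by simpa using hz0))
  have hFi : CircleIntegrable F 0 1 := (hFc.mono hsph).circleIntegrable'
  have hVc : ContinuousOn (fun z : ℂ => w * (z)⁻¹) (Metric.sphere (0:ℂ) |1|) := by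
    apply continuousOn_const.mul
    apply continuousOn_id.inv₀
    rintro z hz rfl; simp at hz
  have hVi : CircleIntegrable (fun z : ℂ => w * (z)⁻¹) 0 1 := hVc.circleIntegrable'
  have hVa : circleAverage (fun z : ℂ => w * z⁻¹) 0 1 = 0 := by
    have e := circleAverage_zero_one_congr_inv (f := fun z : ℂ => w * z)
    have e2 : circleAverage (fun z : ℂ => w * z) 0 1 = 0 := by
      rw [circleAverage_of_differentiable_on_off_countable (s := ∅) countable_empty
        (by fun_prop) (fun z _ => by fun_prop)]
      simp
    exact e.trans e2
  have hsum : circleAverage (fun z => F z + w * z⁻¹) 0 1 = w^2/2 := by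
    rw [circleAverage_fun_add hFi hVi, hFa, hVa, add_zero]
  have hre := ContinuousLinearMap.circleAverage_comp_comm (c := 0) (R := 1)
      (f := fun z => F z + w * z⁻¹) Complex.reCLM (hFi.add hVi)
  have hptw : EqOn (fun z => wt z * Real.log (‖1 - w*z‖^2)) (⇑Complex.reCLM ∘ fun z => F z + w * z⁻¹)
      (Metric.sphere (0:ℂ) |1|) := by
    intro z hz
    have hz1 : ‖z‖ = 1 := by simpa using hz
    have hz0 : z ≠ 0 := by rintro rfl; simp at hz1
    have e : F z + w * z⁻¹ = ((2 * wt z : ℝ) : ℂ) * Complex.log (1 - w*z) := by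
      push_cast
      rw [wt_eq hz1]
      simp only [hF, hh, Function.update_of_ne hz0]
      field_simp; ring
    simp only [Function.comp_apply, Complex.reCLM_apply]
    rw [e, Complex.re_ofReal_mul, Complex.log_re, Real.log_pow]
    push_cast; ring
  refine ⟨?_, ?_⟩
  · have : ContinuousOn (⇑Complex.reCLM ∘ fun z => F z + w * z⁻¹) (Metric.sphere (0:ℂ) |1|) :=
      Complex.reCLM.continuous.comp_continuousOn ((hFc.mono hsph).add hVc)
    exact (this.congr hptw).circleIntegrable'
  · rw [circleAverage_congr_sphere hptw, hre, hsum]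
    simp

lemma log_int (w : ℂ) :
    CircleIntegrable (fun z => wt z * Real.log (‖1 - w*z‖^2)) 0 1 := by
  have h1 : CircleIntegrable (fun z => Real.log ‖1 - w*z‖) 0 1 :=
    MeromorphicOn.circleIntegrable_log_norm (fun z hz ↦ by fun_prop)
  have h2 : IntervalIntegrable (fun θ => (2 * wt (circleMap 0 1 θ)) * Real.log ‖1 - w* circleMap 0 1 θ‖) volume 0 (2*π) := by
    apply IntervalIntegrable.continuousOn_mul h1
    apply Continuous.continuousOn
    have := continuous_wt
    fun_prop
  unfold CircleIntegrable
  convert h2 using 2 with θ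
  simp only [Real.log_pow]; push_cast; ring

lemma avg_log_one {w : ℂ} (hw : ‖w‖ = 1) :
    circleAverage (fun z => wt z * Real.log (‖1 - w*z‖^2)) 0 1 = (w^2).re/2 := by
  set r : ℕ → ℝ := fun n => 1 - 1/((n:ℝ)+2) with hr
  have hr0 : ∀ n, 0 ≤ r n ∧ r n < 1 := by
    intro n
    have : 1/((n:ℝ)+2) ≤ 1 := by rw [div_le_one (by positivity)]; linarith [(Nat.cast_nonneg n : (0:ℝ) ≤ n)]
    have : 0 < 1/((n:ℝ)+2) := by positivity
    constructor <;> simp only [hr] <;> linarith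
  have hrt : Tendsto r atTop (𝓝 1) := by
    have : Tendsto (fun n : ℕ => 1/((n:ℝ)+2)) atTop (𝓝 0) := by
      have := (tendsto_const_div_atTop_nhds_zero_nat (1:ℝ)).comp (tendsto_add_atTop_nat 2)
      simpa [Function.comp_def] using this
    simpa [hr] using this.const_sub 1
  have hL : ∀ n, circleAverage (fun z => wt z * Real.log (‖1 - (r n * w)*z‖^2)) 0 1 = (r n)^2 * ((w^2).re/2) := by
    intro n
    rw [(avg_log_lt (w := r n * w) (by rw [norm_mul, hw, Complex.norm_real, Real.norm_of_nonneg (hr0 n).1]; linarith [(hr0 n).2])).2]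
    rw [mul_pow, ← Complex.ofReal_pow, Complex.re_ofReal_mul]; ring
  have hlim1 : Tendsto (fun n => (r n)^2 * ((w^2).re/2)) atTop (𝓝 ((w^2).re/2)) := by
    simpa using (hrt.pow 2).mul_const ((w^2).re/2)
  refine tendsto_nhds_unique ?_ hlim1
  simp_rw [← hL]
  simp only [circleAverage_def]
  apply Tendsto.const_smul
  have hb : ∀ u : ℂ, ‖u‖ = 1 → u ≠ 1 → ∀ t : ℝ, 0 ≤ t → t < 1 →
      |Real.log (‖1 - t*u‖^2)| ≤ 2 * Real.log 2 + |Real.log (‖1-u‖^2)| := by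
    intro u hu hu1 t ht0 ht1
    have e1 : ‖1 - t*u‖ ≤ 2 := by
      calc ‖1 - t*u‖ ≤ ‖(1:ℂ)‖ + ‖t*u‖ := norm_sub_le _ _
        _ ≤ 2 := by rw [norm_mul, hu, Complex.norm_real, Real.norm_of_nonneg ht0]; simp; linarith
    have e2 : 1 - t ≤ ‖1 - t*u‖ := by
      have := norm_sub_norm_le (1:ℂ) (t*u)
      rw [norm_mul, hu, Complex.norm_real, Real.norm_of_nonneg ht0] at this
      simpa using this
    have e3 : ‖1 - u‖ ≤ 2 * ‖1 - t*u‖ := by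
      have : (1 - u) = (1 - t*u) + ((t-1:ℝ):ℂ) * u := by push_cast; ring
      calc ‖1-u‖ = ‖(1 - t*u) + ((t-1:ℝ):ℂ) * u‖ := by rw [← this]
        _ ≤ ‖1 - t*u‖ + ‖((t-1:ℝ):ℂ) * u‖ := norm_add_le _ _
        _ = ‖1 - t*u‖ + (1 - t) := by
            rw [norm_mul, hu, Complex.norm_real, Real.norm_eq_abs, abs_of_neg (by linarith)]; ring
        _ ≤ _ := by linarith
    have e4 : 0 < ‖1 - u‖ := norm_pos_iff.2 (sub_ne_zero.2 (Ne.symm hu1))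
    have e5 : 0 < ‖1 - t*u‖ := by linarith
    have l1 : Real.log ‖1 - t*u‖ ≤ Real.log 2 := Real.log_le_log e5 e1
    have l2 : Real.log ‖1 - u‖ ≤ Real.log 2 + Real.log ‖1 - t*u‖ := by
      rw [← Real.log_mul (by norm_num) e5.ne']
      exact Real.log_le_log e4 e3
    rw [Real.log_pow, Real.log_pow]
    push_cast
    have := neg_abs_le (2 * Real.log ‖1-u‖)
    have := abs_nonneg (2 * Real.log ‖1-u‖)
    rw [abs_le]; constructor <;> linarith
  have hae : ∀ᵐ θ : ℝ, w * circleMap 0 1 θ ≠ 1 := by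
    have hc := (countable_singleton (w⁻¹)).preimage_circleMap 0 (R := 1) one_ne_zero
    filter_upwards [hc.ae_notMem volume] with θ hθ h
    apply hθ
    have hw0 : w ≠ 0 := by rintro rfl; simp at hw
    simp only [mem_preimage, mem_singleton_iff]
    field_simp; rw [mul_comm]; exact h
  apply intervalIntegral.tendsto_integral_filter_of_dominated_convergence
    (fun θ => 2 * (2 * Real.log 2) + |wt (circleMap 0 1 θ) * Real.log (‖1 - w * circleMap 0 1 θ‖^2)|)
  · refine Eventually.of_forall fun n => ?_
    exact (log_int (r n * w)).def'.aestronglyMeasurable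
  · refine Eventually.of_forall fun n => ?_
    filter_upwards [hae] with θ hθ _
    have hn : ‖w * circleMap 0 1 θ‖ = 1 := by simp [hw]
    have := hb _ hn hθ (r n) (hr0 n).1 (hr0 n).2
    have hw0 : 0 ≤ wt (circleMap 0 1 θ) := by rw [wt_circle]; positivity
    have hw2 : wt (circleMap 0 1 θ) ≤ 2 := by rw [wt_circle]; nlinarith [sin_sq_le_one θ]
    rw [Real.norm_eq_abs, abs_mul, abs_mul, abs_of_nonneg hw0, mul_assoc (r n : ℂ)]
    have hl2 : 0 ≤ Real.log 2 := Real.log_nonneg (by norm_num)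
    nlinarith
  · exact (intervalIntegrable_const).add (log_int w).abs
  · filter_upwards [hae] with θ hθ _
    apply Tendsto.const_mul
    have hne : ‖1 - w * circleMap 0 1 θ‖^2 ≠ 0 := by
      rw [Ne, pow_eq_zero_iff two_ne_zero, norm_eq_zero, sub_eq_zero]; exact fun h => hθ h.symm
    apply Tendsto.log _ hne
    apply Tendsto.pow
    apply Tendsto.norm
    have : Tendsto (fun n => 1 - (r n : ℂ) * w * circleMap 0 1 θ) atTop (𝓝 (1 - ((1:ℝ):ℂ) * w * circleMap 0 1 θ)) :=
      ((((Complex.continuous_ofReal.tendsto 1).comp hrt).mul_const _).mul_const _).const_sub _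
    simpa using this

lemma avg_wt : circleAverage wt 0 1 = 1 := by
  have := (avg_log_lt (w := 0) (by simp))
  have h := (SC_int (fun _ => 1) ((continuous_wt.mul continuous_const).continuousOn.circleIntegrable')).2
  simpa using h.symm

def Fw (w : ℂ) : ℝ := if ‖w‖ ≤ 1 then 0 else Real.log (‖w‖^2) + ((w^2)⁻¹.re - (w^2).re)/2

lemma avg_log (w : ℂ) :
    circleAverage (fun z => wt z * Real.log (‖1 - w*z‖^2)) 0 1 = (w^2).re/2 + Fw w := by
  rw [Fw]
  split_ifs with h
  · rw [add_zero]
    rcases h.lt_or_eq with h | h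
    · exact (avg_log_lt h).2
    · exact avg_log_one h
  · push Not at h
    have hw0 : w ≠ 0 := by rintro rfl; simp at h; linarith
    set v := (conj w)⁻¹ with hv
    have hv1 : ‖v‖ < 1 := by rw [hv, norm_inv, RCLike.norm_conj]; exact inv_lt_one_of_one_lt₀ h
    have hpt : EqOn (fun z => wt z * Real.log (‖1 - w*z‖^2))
        (fun z => Real.log (‖w‖^2) • wt z + wt z * Real.log (‖1 - v*z‖^2)) (Metric.sphere (0:ℂ) |1|) := by
      intro z hz
      have hz1 : ‖z‖ = 1 := by simpa using hz
      have hz0 : z ≠ 0 := by rintro rfl; simp at hz1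
      have hzc : z * conj z = 1 := by rw [Complex.mul_conj, Complex.normSq_eq_norm_sq, hz1]; simp
      have hvz : 1 - v*z ≠ 0 := by
        intro h0
        have : ‖v*z‖ = 1 := by rw [← sub_eq_zero.1 h0]; simp
        rw [norm_mul, hz1] at this; linarith
      have hcw : conj w ≠ 0 := by simpa using hw0
      have e : ‖1 - w*z‖ = ‖w‖ * ‖1 - v*z‖ := by
        calc ‖1 - w*z‖ = ‖conj (1 - w*z)‖ := (RCLike.norm_conj _).symm
          _ = ‖(-conj w * conj z) * (1 - v*z)‖ := by
              congr 1
              simp only [map_sub, map_one, map_mul, hv]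
              have : -conj w * conj z * (1 - (conj w)⁻¹ * z) = -conj w * conj z + (conj w * (conj w)⁻¹) * (z * conj z) := by ring
              rw [this, hzc, mul_inv_cancel₀ hcw]; ring
          _ = _ := by rw [norm_mul, norm_mul, norm_neg, RCLike.norm_conj, RCLike.norm_conj, hz1, mul_one]
      simp only [smul_eq_mul]
      rw [e, mul_pow, Real.log_mul (by positivity) (by positivity)]
      ring
    have hwi : CircleIntegrable wt 0 1 := continuous_wt.continuousOn.circleIntegrable'
    rw [circleAverage_congr_sphere hpt, circleAverage_fun_add hwi.const_fun_smul (log_int v),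
      (avg_log_lt hv1).2]
    have : circleAverage (fun z => Real.log (‖w‖^2) • wt z) 0 1 = Real.log (‖w‖^2) • circleAverage wt 0 1 :=
      circleAverage_fun_smul
    rw [this, avg_wt]
    have : (v^2).re = (w^2)⁻¹.re := by
      rw [hv, inv_pow, ← map_pow, ← map_inv₀, Complex.conj_re]
    rw [this, smul_eq_mul]; ring

lemma avg_log_poly (c : ℂ) (hc : c ≠ 0) (s : Multiset ℂ) (hs : ∀ ζ ∈ s, ζ ≠ 0) :
    (C c * (s.map (fun ζ => X - C ζ)).prod).coeff 0 ≠ 0 ∧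
    CircleIntegrable (fun z => wt z * Real.log (‖(C c * (s.map (fun ζ => X - C ζ)).prod).eval z‖^2)) 0 1 ∧
    circleAverage (fun z => wt z * Real.log (‖(C c * (s.map (fun ζ => X - C ζ)).prod).eval z‖^2)) 0 1
     = Real.log (‖(C c * (s.map (fun ζ => X - C ζ)).prod).coeff 0‖^2)
      + (((C c * (s.map (fun ζ => X - C ζ)).prod).coeff 1 / (C c * (s.map (fun ζ => X - C ζ)).prod).coeff 0)^2
        - 2 * ((C c * (s.map (fun ζ => X - C ζ)).prod).coeff 2 / (C c * (s.map (fun ζ => X - C ζ)).prod).coeff 0)).re / 2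
      + (s.map (fun ζ => Fw ζ⁻¹)).sum := by
  induction s using Multiset.induction_on with
  | empty =>
    simp only [Multiset.map_zero, Multiset.prod_zero, mul_one, coeff_C_zero, eval_C, Multiset.sum_zero]
    have h1 : (C c).coeff 1 = 0 := by simp [coeff_C]
    have h2 : (C c).coeff 2 = 0 := by simp [coeff_C]
    refine ⟨hc, (continuous_wt.mul continuous_const).continuousOn.circleIntegrable', ?_⟩
    rw [h1, h2]
    have : circleAverage (fun z => wt z * Real.log (‖c‖^2)) 0 1 = Real.log (‖c‖^2) • circleAverage wt 0 1 := by
      rw [← circleAverage_fun_smul]; congr 1; funext z; simp [mul_comm]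
    rw [this, avg_wt]; simp
  | cons ζ s ih =>
    obtain ⟨i0, i1, i2⟩ := ih (fun w hw => hs w (Multiset.mem_cons_of_mem hw))
    have hζ := hs ζ (Multiset.mem_cons_self _ _)
    have e : C c * (Multiset.map (fun ζ => X - C ζ) (ζ ::ₘ s)).prod
        = X * (C c * (s.map (fun ζ => X - C ζ)).prod) - C ζ * (C c * (s.map (fun ζ => X - C ζ)).prod) := by
      rw [Multiset.map_cons, Multiset.prod_cons]; ring
    rw [e]
    generalize C c * (s.map (fun ζ => X - C ζ)).prod = Q at *
    have c0 : (X * Q - C ζ * Q).coeff 0 = -ζ * Q.coeff 0 := by simp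
    have c1 : (X * Q - C ζ * Q).coeff 1 = Q.coeff 0 - ζ * Q.coeff 1 := by
      rw [coeff_sub, show (1:ℕ) = 0+1 from rfl, coeff_X_mul, coeff_C_mul]
    have c2 : (X * Q - C ζ * Q).coeff 2 = Q.coeff 1 - ζ * Q.coeff 2 := by
      rw [coeff_sub, show (2:ℕ) = 1+1 from rfl, coeff_X_mul, coeff_C_mul]
    have hQ : Q ≠ 0 := by rintro rfl; simp at i0
    have heq : (fun z => (Real.log (‖ζ‖^2) • wt z + wt z * Real.log (‖1 - ζ⁻¹*z‖^2)) + wt z * Real.log (‖Q.eval z‖^2))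
        =ᶠ[codiscreteWithin (Metric.sphere (0:ℂ) |1|)]
        (fun z => wt z * Real.log (‖(X * Q - C ζ * Q).eval z‖^2)) := by
      apply eqOff (↑(insert ζ Q.roots.toFinset) : Set ℂ) (Finset.finite_toSet _)
      intro z hz hzS
      simp [hQ] at hzS
      have h1 : 1 - ζ⁻¹*z ≠ 0 := by
        intro h; apply hzS.1; field_simp at h; rw [mul_zero] at h; exact (sub_eq_zero.1 h).symm
      have h2 : (X * Q - C ζ * Q).eval z = -ζ * (1 - ζ⁻¹ * z) * Q.eval z := by
        simp only [eval_sub, eval_mul, eval_X, eval_C]; field_simp; ring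
      have h3 : Q.eval z ≠ 0 := hzS.2
      rw [h2, norm_mul, norm_mul, norm_neg, mul_pow, mul_pow,
        Real.log_mul (by positivity) (by positivity), Real.log_mul (by positivity) (by positivity)]
      simp only [smul_eq_mul]; ring
    have hwi : CircleIntegrable wt 0 1 := continuous_wt.continuousOn.circleIntegrable'
    have hI1 : CircleIntegrable (fun z => Real.log (‖ζ‖^2) • wt z + wt z * Real.log (‖1 - ζ⁻¹*z‖^2)) 0 1 := (hwi.const_fun_smul (a := Real.log (‖ζ‖^2))).add (log_int ζ⁻¹)
    refine ⟨by rw [c0]; exact mul_ne_zero (neg_ne_zero.2 hζ) i0, (hI1.add i1).congr_codiscreteWithin heq, ?_⟩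
    rw [← circleAverage_congr_codiscreteWithin heq one_ne_zero, circleAverage_fun_add hI1 i1,
      circleAverage_fun_add (hwi.const_fun_smul) (log_int ζ⁻¹), avg_log, i2, c0, c1, c2]
    have : circleAverage (fun z => Real.log (‖ζ‖^2) • wt z) 0 1 = Real.log (‖ζ‖^2) • circleAverage wt 0 1 :=
      circleAverage_fun_smul
    rw [this, avg_wt, norm_mul, norm_neg, mul_pow, Real.log_mul (by positivity) (by positivity),
      Multiset.map_cons, Multiset.sum_cons]
    have e3 : ((Q.coeff 0 - ζ * Q.coeff 1) / (-ζ * Q.coeff 0))^2 - 2 * ((Q.coeff 1 - ζ * Q.coeff 2)/(-ζ * Q.coeff 0))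
      = ((Q.coeff 1 / Q.coeff 0)^2 - 2 * (Q.coeff 2 / Q.coeff 0)) + (ζ⁻¹)^2 := by
      field_simp; ring
    rw [e3, Complex.add_re, smul_eq_mul]; ring

end SumRules
end

section
namespace SumRules

def Fz (r : ℝ) : ℝ := ((r^2)⁻¹ - r^2)/2 + Real.log (r^2)

lemma Fw_inv {r : ℝ} (h0 : r ≠ 0) (h1 : |r| ≤ 1) : Fw ((r:ℂ)⁻¹) = - Fz r := by
  unfold Fw Fz
  have e1 : ‖((r:ℂ)⁻¹)‖ = |r|⁻¹ := by rw [norm_inv, Complex.norm_real, Real.norm_eq_abs]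
  have hp : 0 < |r| := abs_pos.2 h0
  split_ifs with h
  · rw [e1] at h
    have : 1 ≤ |r| := by
      have := (inv_le_one₀ hp).1 h; exact this
    have h2 : r^2 = 1 := by rw [← sq_abs, le_antisymm h1 this]; norm_num
    rw [h2]; simp
  · rw [e1, ← Complex.ofReal_inv, ← Complex.ofReal_pow, ← Complex.ofReal_inv, Complex.ofReal_re, Complex.ofReal_re,
      inv_pow, sq_abs, Real.log_inv, inv_pow, inv_inv]
    ring

lemma add_inv_circle {z : ℂ} (hz : ‖z‖ = 1) : z + z⁻¹ = ((2 * z.re : ℝ) : ℂ) := by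
  rw [Complex.inv_eq_conj hz, Complex.add_conj]

lemma aeval_ofReal (f : ℝ[X]) (x : ℝ) : aeval (x:ℂ) f = ((f.eval x : ℝ) : ℂ) := by
  rw [← Polynomial.coe_aeval_eq_eval]
  exact aeval_algebraMap_apply ℂ x f

namespace Rec
variable {a b : ℕ → ℝ} {p : ℕ → ℝ[X]}

lemma eval_map_Ut (m : ℕ) (z : ℂ) : ((Ut a p m).map (algebraMap ℝ ℂ)).eval z = aeval z (Ut a p m) := by
  rw [eval_map_algebraMap]

lemma Ut_circle (h : Rec a b p) (m : ℕ) {z : ℂ} (hz : ‖z‖ = 1) :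
    aeval z (Ut a p m) = z^(m+1) * (((Ap a p m).eval (2*z.re) : ℝ) - z * ((p m).eval (2*z.re) : ℝ)) := by
  have hz0 : z ≠ 0 := by rintro rfl; simp at hz
  rw [h.Ut_aeval m z hz0, add_inv_circle hz, aeval_ofReal, aeval_ofReal]

lemma norm_Ut_sq (h : Rec a b p) (m : ℕ) {z : ℂ} (hz : ‖z‖ = 1) :
    ‖aeval z (Ut a p m)‖^2 = (Dp a p m).eval (2*z.re) := by
  rw [h.Ut_circle m hz, norm_mul, norm_pow, hz, one_pow, one_mul, ← Complex.normSq_eq_norm_sq, Complex.normSq_apply]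
  have h2 : z.re^2 + z.im^2 = 1 := by
    have := Complex.normSq_eq_norm_sq z; rw [hz, Complex.normSq_apply] at this; nlinarith
  simp only [Complex.sub_re, Complex.sub_im, Complex.ofReal_re, Complex.ofReal_im, Complex.mul_re, Complex.mul_im,
    Dp, eval_sub, eval_add, eval_mul, eval_pow, eval_X]
  generalize (Ap a p m).eval (2*z.re) = A
  generalize (p m).eval (2*z.re) = B
  linear_combination B^2 * h2

lemma log_D (h : Rec a b p) (m : ℕ) : Integrable (fun x => Real.log ((Dp a p m).eval x)) SCm ∧
    ∫ x, Real.log ((Dp a p m).eval x) ∂SCm = Isum a b m - ∑ r ∈ Zs a p m, Fz r := by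
  classical
  obtain ⟨V, hV, hUV⟩ := h.Ut_factor m
  set U := (Ut a p m).map (algebraMap ℝ ℂ) with hU
  have hU0 : U ≠ 0 := (Polynomial.map_ne_zero_iff (algebraMap ℝ ℂ).injective).2 (h.Ut_ne m)
  have hsplit : U = C U.leadingCoeff * (U.roots.map (fun ζ => X - C ζ)).prod :=
    (IsAlgClosed.splits U).eq_prod_roots
  have hroots : U.roots = ((Zs a p m).image (fun r : ℝ => (r : ℂ))).val + V.roots := by
    rw [hUV, roots_mul (hUV ▸ hU0), roots_prod_X_sub_C]
  have hrne : ∀ ζ ∈ U.roots, ζ ≠ 0 := by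
    intro ζ hζ
    have : U.eval ζ = 0 := (mem_roots hU0).1 hζ
    rw [hU, eval_map_Ut] at this
    exact h.root_ne_zero m this
  obtain ⟨-, h2, h3⟩ := avg_log_poly U.leadingCoeff (leadingCoeff_ne_zero.2 hU0) U.roots hrne
  rw [← hsplit] at h2 h3
  have heq : EqOn (fun z => wt z * Real.log (‖U.eval z‖^2))
     (fun z => wt z * Real.log ((Dp a p m).eval (2*z.re))) (Metric.sphere (0:ℂ) |1|) := by
    intro z hz
    have hz1 : ‖z‖ = 1 := by simpa using hz
    show wt z * Real.log (‖U.eval z‖^2) = _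
    rw [hU, eval_map_Ut, h.norm_Ut_sq m hz1]
  have h2' := h2.congr_codiscreteWithin (eqOff ∅ finite_empty fun z hz _ => heq (x := z) (by simpa using hz))
  obtain ⟨k1, k2⟩ := SC_int (fun x => Real.log ((Dp a p m).eval x)) h2'
  refine ⟨k1, ?_⟩
  rw [k2, ← circleAverage_congr_sphere heq, h3, ← h.Ut_coeffs m]
  have hsum : (U.roots.map (fun ζ => Fw ζ⁻¹)).sum = - ∑ r ∈ Zs a p m, Fz r := by
    rw [hroots, Multiset.map_add, Multiset.sum_add]
    have e1 : (Multiset.map (fun ζ => Fw ζ⁻¹) V.roots).sum = 0 := by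
      apply Multiset.sum_eq_zero
      intro y hy
      obtain ⟨ζ, hζ, rfl⟩ := Multiset.mem_map.1 hy
      have hn : 1 < ‖ζ‖ := by
        by_contra hc
        have hV0 : V ≠ 0 := by rintro rfl; simp at hζ
        exact hV ζ (not_lt.1 hc) ((mem_roots hV0).1 hζ)
      unfold Fw
      rw [if_pos]
      rw [norm_inv]; exact inv_le_one_of_one_le₀ hn.le
    rw [e1, add_zero]
    change ∑ ζ ∈ (Zs a p m).image (fun r : ℝ => (r:ℂ)), Fw ζ⁻¹ = _
    rw [Finset.sum_image (fun x _ y _ hxy => Complex.ofReal_injective hxy), ← Finset.sum_neg_distrib]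
    refine Finset.sum_congr rfl fun r hr => ?_
    obtain ⟨r0, r1, -⟩ := (h.mem_Zs m r).1 hr
    exact Fw_inv r0 r1
  rw [hsum, hU]
  simp only [coeff_map, Complex.coe_algebraMap, Complex.norm_real]
  have e4 : (((((Ut a p m).coeff 1 : ℝ):ℂ) / ((Ut a p m).coeff 0 : ℝ))^2 - 2 * (((Ut a p m).coeff 2 : ℝ) / ((Ut a p m).coeff 0 : ℝ))).re
    = ((Ut a p m).coeff 1 / (Ut a p m).coeff 0)^2 - 2 * ((Ut a p m).coeff 2 / (Ut a p m).coeff 0) := by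
    rw [← Complex.ofReal_re (((Ut a p m).coeff 1 / (Ut a p m).coeff 0)^2 - 2 * ((Ut a p m).coeff 2 / (Ut a p m).coeff 0))]
    push_cast; rfl
  rw [e4, Real.norm_eq_abs, sq_abs]; ring

lemma D_pos (h : Rec a b p) (m : ℕ) {x : ℝ} (hx : x ∈ Ioo (-2:ℝ) 2) : 0 < (Dp a p m).eval x := by
  simp only [Dp, eval_sub, eval_add, eval_mul, eval_pow, eval_X]
  have hc := fun hA hB => h.no_common (K := ℝ) m x hA hB
  simp only [coe_aeval_eq_eval] at hc
  generalize (Ap a p m).eval x = A at *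
  generalize (p m).eval x = B at *
  obtain ⟨h1, h2⟩ := hx
  have e : A^2 + B^2 - x*A*B = (2-x)/4*(A+B)^2 + (2+x)/4*(A-B)^2 := by ring
  rw [e]
  by_cases hAB : A + B = 0
  · have : A - B ≠ 0 := by
      intro h'; apply hc <;> linarith
    have : 0 < (A-B)^2 := by positivity
    rw [hAB]; nlinarith
  · have : 0 < (A+B)^2 := by positivity
    nlinarith [sq_nonneg (A-B)]

end Rec
end SumRules
end

section
namespace SumRules

lemma ptw_re {z : ℂ} (hz : ‖z‖ = 1) (m : ℕ) (f A B : ℝ) :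
    -(z^m * f * (z^2-1) / (z^(m+1) * (A - z*B)) : ℂ).re = wt z * (f * B / (A^2+B^2-2*z.re*A*B)) ∧
    -(z * (z^m * f * (z^2-1)) / (z^(m+1) * (A - z*B)) : ℂ).re = wt z * (f * A / (A^2+B^2-2*z.re*A*B)) := by
  have hz0 : z ≠ 0 := by rintro rfl; simp at hz
  have h2 : z.re^2 + z.im^2 = 1 := by
    have := Complex.normSq_eq_norm_sq z; rw [hz, Complex.normSq_apply] at this; nlinarith
  have hq : z^2 - 1 = z * (z - conj z) := by
    have : z * conj z = 1 := by rw [Complex.mul_conj, Complex.normSq_eq_norm_sq, hz]; simp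
    rw [mul_sub, this]; ring
  have hw : wt z = 2 * z.im^2 := by
    unfold wt; rw [pow_two z, Complex.mul_re]; nlinarith
  have hN : Complex.normSq ((A:ℂ) - z*B) = A^2+B^2-2*z.re*A*B := by
    rw [Complex.normSq_apply]
    simp only [Complex.sub_re, Complex.sub_im, Complex.ofReal_re, Complex.ofReal_im, Complex.mul_re, Complex.mul_im]
    linear_combination B^2 * h2
  have e1 : (z^m * f * (z^2-1) / (z^(m+1) * (A - z*B)) : ℂ) = f * (z - conj z) * (A - z*B)⁻¹ := by
    rw [hq, div_eq_mul_inv, mul_inv, pow_succ]; field_simp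
  have e2 : (z * (z^m * f * (z^2-1)) / (z^(m+1) * (A - z*B)) : ℂ) = z * f * (z - conj z) * (A - z*B)⁻¹ := by
    rw [mul_div_assoc, e1]; ring
  rw [e1, e2, Complex.inv_def, hN, hw]
  constructor
  · rw [← mul_assoc, Complex.re_mul_ofReal]
    simp only [Complex.sub_re, Complex.sub_im, Complex.ofReal_re, Complex.ofReal_im, Complex.mul_re, Complex.mul_im,
      Complex.conj_re, Complex.conj_im]
    ring
  · rw [← mul_assoc, Complex.re_mul_ofReal]
    simp only [Complex.sub_re, Complex.sub_im, Complex.ofReal_re, Complex.ofReal_im, Complex.mul_re, Complex.mul_im,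
      Complex.conj_re, Complex.conj_im]
    rw [div_eq_mul_inv]
    linear_combination (2*f*B*z.im*z.im*z.re-2*f*B*z.im*z.im*z.re) * h2

namespace Rec
variable {a b : ℕ → ℝ} {p : ℕ → ℝ[X]}

def wz (p : ℕ → ℝ[X]) (m : ℕ) (z : ℝ) : ℝ :=
  (1 - (z^2)⁻¹) / ((1 - (z^2)⁻¹) * (Kp p m).eval (z + z⁻¹) - (p m).eval (z + z⁻¹)^2)

lemma wz_nonneg (h : Rec a b p) (m : ℕ) {z : ℝ} (hz : z ∈ Zs a p m) : 0 ≤ wz p m z := by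
  obtain ⟨h0, h1, h2⟩ := (h.mem_Zs m z).1 hz
  apply div_nonneg_of_nonpos _ (h.deriv_ne m hz).le
  have h3 : 0 < z^2 := by positivity
  have h4 : z^2 ≤ 1 := by rw [← sq_abs]; nlinarith [abs_nonneg z]
  linarith [(one_le_inv₀ h3).2 h4]

lemma sc_aux (h : Rec a b p) (m : ℕ) (N : ℝ[X]) (hN : N.eval 1 = 0 ∧ N.eval (-1) = 0) (u : ℝ → ℝ)
    (hu : ∀ z : ℂ, ‖z‖ = 1 → -(aeval z N / aeval z (Ut a p m)).re = wt z * u (2*z.re)) :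
    Integrable u SCm ∧ ∫ x, u x ∂SCm = - (N.eval 0 / (p m).leadingCoeff +
      ∑ z ∈ Zs a p m, N.eval z / (z * (derivative (Ut a p m)).eval z)) := by
  classical
  obtain ⟨V, hV, hUV⟩ := h.Ut_factor m
  have key := avg_ratio ((Zs a p m).image (fun r : ℝ => (r:ℂ))) V hV (N.map (algebraMap ℝ ℂ)) (by
    intro ζ hζ
    obtain ⟨r, hr, rfl⟩ := Finset.mem_image.1 hζ
    obtain ⟨h0, h1, h2⟩ := (h.mem_Zs m r).1 hr
    refine ⟨by exact_mod_cast h0, by simpa using h1, fun h3 => ?_⟩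
    have : |r| = 1 := by simpa using h3
    rw [eval_map_algebraMap, aeval_ofReal]
    rcases eq_or_eq_neg_of_abs_eq this with h4 | h4
    · rw [h4, hN.1]; simp
    · rw [h4, hN.2]; simp)
  rw [← hUV] at key
  obtain ⟨k1, k2⟩ := key
  have k3 := ContinuousLinearMap.circleAverage_comp_comm (c := 0) (R := 1) Complex.reCLM k1
  have heq : EqOn (fun z => (-1:ℝ) • (⇑Complex.reCLM ∘ fun z => (N.map (algebraMap ℝ ℂ)).eval z / ((Ut a p m).map (algebraMap ℝ ℂ)).eval z) z)
      (fun z => wt z * u (2*z.re)) (Metric.sphere (0:ℂ) |1|) := by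
    intro z hz
    have hz1 : ‖z‖ = 1 := by simpa using hz
    simp only [Function.comp_apply, Complex.reCLM_apply, eval_map_algebraMap]
    rw [← hu z hz1]; simp
  have i1 : CircleIntegrable (⇑Complex.reCLM ∘ fun z => (N.map (algebraMap ℝ ℂ)).eval z / ((Ut a p m).map (algebraMap ℝ ℂ)).eval z) 0 1 :=
    ContinuousLinearMap.integrable_comp (μ := volume.restrict (Set.uIoc 0 (2*π))) Complex.reCLM (by simpa [CircleIntegrable, intervalIntegrable_iff, IntegrableOn] using k1) |> fun q => by
      simpa [CircleIntegrable, intervalIntegrable_iff, IntegrableOn] using q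
  have i2 := (i1.const_fun_smul (a := (-1:ℝ))).congr_codiscreteWithin
    (eqOff ∅ finite_empty fun z hz _ => heq (x := z) (by simpa using hz))
  obtain ⟨l1, l2⟩ := SC_int u i2
  refine ⟨l1, ?_⟩
  rw [l2, ← circleAverage_congr_sphere heq, circleAverage_fun_smul]
  rw [k3, k2]
  rw [Finset.sum_image (fun x _ y _ hxy => Complex.ofReal_injective hxy)]
  rw [← h.Ut_coeff_zero m, coeff_zero_eq_eval_zero]
  rw [smul_eq_mul, neg_one_mul, neg_inj]
  rw [← Complex.ofReal_re (N.eval 0 / (Ut a p m).eval 0 + _)]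
  rw [Complex.reCLM_apply]
  congr 1
  push_cast
  simp only [derivative_map, eval_map_algebraMap, aeval_ofReal]
  rw [← Complex.ofReal_zero, aeval_ofReal, aeval_ofReal]

lemma sc_B (h : Rec a b p) (m : ℕ) (f : ℝ[X]) (hf : f.natDegree ≤ m) :
    (Integrable (fun x => f.eval x * (p m).eval x / (Dp a p m).eval x) SCm ∧
    ∫ x, f.eval x * (p m).eval x / (Dp a p m).eval x ∂SCm = f.coeff m / (p m).leadingCoeff -
      ∑ z ∈ Zs a p m, wz p m z * (f.eval (z+z⁻¹) * (p m).eval (z+z⁻¹))) ∧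
    (Integrable (fun x => f.eval x * (Ap a p m).eval x / (Dp a p m).eval x) SCm ∧
    ∫ x, f.eval x * (Ap a p m).eval x / (Dp a p m).eval x ∂SCm = -
      ∑ z ∈ Zs a p m, wz p m z * (f.eval (z+z⁻¹) * (Ap a p m).eval (z+z⁻¹))) := by
  have hD : ∀ z : ℂ, (Dp a p m).eval (2*z.re) = (Ap a p m).eval (2*z.re)^2 + (p m).eval (2*z.re)^2
     - 2*z.re* (Ap a p m).eval (2*z.re) * (p m).eval (2*z.re) := by intro z; simp [Dp]
  have hfz : ∀ z : ℂ, ‖z‖ = 1 → aeval z (hom m f) = z^m * (f.eval (2*z.re) : ℝ) := by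
    intro z hz
    have hz0 : z ≠ 0 := by rintro rfl; simp at hz
    rw [hom_aeval m f hf z hz0, add_inv_circle hz, aeval_ofReal]
  have hterm : ∀ z ∈ Zs a p m, (hom m f).eval z * (z^2-1) / (z * (derivative (Ut a p m)).eval z)
      = wz p m z * (f.eval (z+z⁻¹) * (p m).eval (z+z⁻¹)) := by
    intro z hz
    obtain ⟨h0, h1, h2⟩ := (h.mem_Zs m z).1 hz
    have e1 := h.Ut_deriv m hz
    have e2 := h.deriv_ne m hz
    have e3 := h.B_ne m hz
    have e4 := h.Ut_deriv_ne m hz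
    have e5 : (hom m f).eval z = z^m * f.eval (z+z⁻¹) := by
      have := hom_aeval (K := ℝ) m f hf z h0
      simpa using this
    rw [wz, e5, div_mul_eq_mul_div, div_eq_div_iff (mul_ne_zero h0 e4) e2.ne]
    have e6 : z^2 - 1 = z^2 * (1 - (z^2)⁻¹) := by field_simp
    rw [e6]
    generalize (1 - (z^2)⁻¹) * (Kp p m).eval (z + z⁻¹) - (p m).eval (z + z⁻¹)^2 = Δ at *
    generalize (1 - (z^2)⁻¹) = W at *
    generalize f.eval (z+z⁻¹) = F at *
    linear_combination (-F * W * z) * e1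
  constructor
  · have := h.sc_aux m (hom m f * (X^2-1)) (by simp) (fun x => f.eval x * (p m).eval x / (Dp a p m).eval x) (by
      intro z hz
      have := (ptw_re hz m (f.eval (2*z.re)) ((Ap a p m).eval (2*z.re)) ((p m).eval (2*z.re))).1
      rw [h.Ut_circle m hz, map_mul, hfz z hz, hD, ← this]
      simp)
    refine ⟨this.1, this.2.trans ?_⟩
    rw [neg_add]
    congr 1
    · simp [hom_eval_zero, neg_div]
    · congr 1
      refine Finset.sum_congr rfl fun z hz => ?_
      rw [← hterm z hz]; simp
  · have := h.sc_aux m (X * (hom m f * (X^2-1))) (by simp) (fun x => f.eval x * (Ap a p m).eval x / (Dp a p m).eval x) (by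
      intro z hz
      have := (ptw_re hz m (f.eval (2*z.re)) ((Ap a p m).eval (2*z.re)) ((p m).eval (2*z.re))).2
      rw [h.Ut_circle m hz, map_mul, map_mul, hfz z hz, hD, ← this]
      simp)
    refine ⟨this.1, this.2.trans ?_⟩
    rw [neg_inj]
    simp only [eval_mul, eval_X, zero_mul, zero_div, zero_add]
    refine Finset.sum_congr rfl fun z hz => ?_
    have e := hterm z hz
    rw [((h.mem_Zs m z).1 hz).2.2]
    rw [mul_div_assoc]
    simp only [eval_sub, eval_pow, eval_X, eval_one]
    rw [e]; ring

variable {μ : Measure ℝ}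

lemma orth (h : Rec a b p) (hint : ∀ q : ℝ[X], Integrable (fun x => q.eval x) μ)
    (ho : ∀ j k, ∫ x, (p j).eval x * (p k).eval x ∂μ = if j = k then 1 else 0) (n : ℕ) :
    ∀ d ≤ n, ∀ r : ℝ[X], r.degree < d → ∫ x, r.eval x * (p n).eval x ∂μ = 0 := by
  intro d
  induction d with
  | zero => intro _ r hr; have : r = 0 := by simpa using hr
            simp [this]
  | succ d ih =>
    intro hd r hr
    have hl := h.lead d
    have hr' : (r - C (r.coeff d / (p d).leadingCoeff) * p d).degree < d := by
      rw [degree_lt_iff_coeff_zero]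
      intro k hk
      rcases hk.eq_or_lt with rfl | hk
      · have : (p d).coeff d = (p d).leadingCoeff := by rw [leadingCoeff, h.deg]
        rw [coeff_sub, coeff_C_mul, this, div_mul_cancel₀ _ hl.ne', sub_self]
      · rw [coeff_sub, coeff_C_mul, (degree_lt_iff_coeff_zero _ _).1 hr k (by omega),
          coeff_eq_zero_of_natDegree_lt (p := p d) (n := k) (by rw [h.deg]; omega)]; simp
    have e := ih (by omega) _ hr'
    have i1 : Integrable (fun x => r.eval x * (p n).eval x) μ := by
      simpa using hint (r * p n)
    have i2 : Integrable (fun x => (p d).eval x * (p n).eval x) μ := by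
      simpa using hint (p d * p n)
    have e2 : ∀ x, (r - C (r.coeff d / (p d).leadingCoeff) * p d).eval x * (p n).eval x
      = r.eval x * (p n).eval x - (r.coeff d / (p d).leadingCoeff) * ((p d).eval x * (p n).eval x) := by
      intro x; simp; ring
    simp_rw [e2] at e
    rw [integral_sub i1 (i2.const_mul _), integral_const_mul, ho, if_neg (by omega)] at e
    linarith

lemma int_fB (h : Rec a b p) (hint : ∀ q : ℝ[X], Integrable (fun x => q.eval x) μ)
    (ho : ∀ j k, ∫ x, (p j).eval x * (p k).eval x ∂μ = if j = k then 1 else 0) (m : ℕ)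
    (f : ℝ[X]) (hf : f.natDegree ≤ m) :
    ∫ x, f.eval x * (p m).eval x ∂μ = f.coeff m / (p m).leadingCoeff := by
  have hl := h.lead m
  have hr' : (f - C (f.coeff m / (p m).leadingCoeff) * p m).degree < m := by
    rw [degree_lt_iff_coeff_zero]
    intro k hk
    rcases hk.eq_or_lt with rfl | hk
    · have : (p m).coeff m = (p m).leadingCoeff := by rw [leadingCoeff, h.deg]
      rw [coeff_sub, coeff_C_mul, this, div_mul_cancel₀ _ hl.ne', sub_self]
    · rw [coeff_sub, coeff_C_mul, coeff_eq_zero_of_natDegree_lt (p := f) (n := k) (by omega),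
        coeff_eq_zero_of_natDegree_lt (p := p m) (n := k) (by rw [h.deg]; omega)]; simp
  have e := h.orth hint ho m m le_rfl _ hr'
  have i1 : Integrable (fun x => f.eval x * (p m).eval x) μ := by
    simpa using hint (f * p m)
  have i2 : Integrable (fun x => (p m).eval x * (p m).eval x) μ := by
    simpa using hint (p m * p m)
  have e2 : ∀ x, (f - C (f.coeff m / (p m).leadingCoeff) * p m).eval x * (p m).eval x
    = f.eval x * (p m).eval x - (f.coeff m / (p m).leadingCoeff) * ((p m).eval x * (p m).eval x) := by
    intro x; simp; ring
  simp_rw [e2] at e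
  rw [integral_sub i1 (i2.const_mul _), integral_const_mul, ho, if_pos rfl] at e
  linarith

theorem quad (h : Rec a b p) (hint : ∀ q : ℝ[X], Integrable (fun x => q.eval x) μ)
    (ho : ∀ j k, ∫ x, (p j).eval x * (p k).eval x ∂μ = if j = k then 1 else 0) (m : ℕ)
    (g : ℝ[X]) (hg : g.natDegree ≤ 2*m+1) :
    Integrable (fun x => g.eval x / (Dp a p m).eval x) SCm ∧
    ∫ x, g.eval x ∂μ = ∫ x, g.eval x / (Dp a p m).eval x ∂SCm + ∑ z ∈ Zs a p m, wz p m z * g.eval (z+z⁻¹) := by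
  obtain ⟨u, v, huv⟩ := h.coprime m
  set A := Ap a p m with hA
  have hA0 : A ≠ 0 := h.Ap_ne m
  set f := (g * v) % A with hf
  set k := g * u + p m * ((g*v)/A) with hk
  have hdm := EuclideanDomain.div_add_mod (g*v) A
  have hgfk : g = f * p m + k * A := by
    rw [hf, hk]
    linear_combination (-g) * huv - p m * hdm
  have hfd : f.natDegree ≤ m := by
    have h1 : f.natDegree < A.natDegree := by
      apply natDegree_mod_lt
      rw [h.Ap_deg m]; omega
    rw [h.Ap_deg m] at h1; omega
  have hkd : k.natDegree ≤ m := by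
    by_cases hk0 : k = 0
    · rw [hk0]; simp
    have h1 : (k * A).natDegree ≤ 2*m+1 := by
      rw [show k * A = g - f * p m by rw [hgfk]; ring]
      refine (natDegree_sub_le _ _).trans (max_le hg ?_)
      refine natDegree_mul_le.trans ?_
      rw [h.deg]; omega
    rw [natDegree_mul hk0 hA0, h.Ap_deg m] at h1
    omega
  obtain ⟨⟨b1, b2⟩, -⟩ := h.sc_B m f hfd
  obtain ⟨-, ⟨c1, c2⟩⟩ := h.sc_B m k hkd
  rw [← hA] at c1 c2
  have eD : ∀ x, g.eval x / (Dp a p m).eval x = f.eval x * (p m).eval x / (Dp a p m).eval x + k.eval x * A.eval x / (Dp a p m).eval x := by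
    intro x; rw [← add_div]; congr 1
    conv_lhs => rw [hgfk]
    simp
  have eg : ∀ x, g.eval x = f.eval x * (p m).eval x + a (m+1) * (k.eval x * (p (m+1)).eval x) := by
    intro x
    conv_lhs => rw [hgfk]
    simp [hA, Ap]; ring
  have eg' : ∀ x, g.eval x = f.eval x * (p m).eval x + k.eval x * A.eval x := by
    intro x
    conv_lhs => rw [hgfk]
    simp
  simp_rw [eD]
  refine ⟨b1.add c1, ?_⟩
  rw [integral_add b1 c1, b2, c2]
  have i1 : Integrable (fun x => f.eval x * (p m).eval x) μ := by
    simpa using hint (f * p m)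
  have i2 : Integrable (fun x => k.eval x * (p (m+1)).eval x) μ := by
    simpa using hint (k * p (m+1))
  have e0 := h.orth hint ho (m+1) (m+1) le_rfl k (by
    refine degree_le_natDegree.trans_lt ?_
    exact_mod_cast Nat.lt_succ_of_le hkd)
  have e3 : ∫ x, g.eval x ∂μ = f.coeff m / (p m).leadingCoeff := by
    simp_rw [eg]
    rw [integral_add i1 (i2.const_mul _), integral_const_mul, e0, h.int_fB hint ho m f hfd]; simp
  rw [e3]
  simp_rw [eg', mul_add, Finset.sum_add_distrib]
  ring

end Rec
end SumRules
end

section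
namespace SumRules

def Fx (x : ℝ) : ℝ := |x|/2*√(x^2-4) - 2*Real.log ((|x|+√(x^2-4))/2)

lemma FSC_eq {x : ℝ} (h : 2 ≤ |x|) : FSC x = ENNReal.ofReal (Fx x) := by
  rw [FSC, if_pos h]; rfl

lemma Fx_neg (x : ℝ) : Fx (-x) = Fx x := by simp [Fx]

lemma Fx_abs (x : ℝ) : Fx |x| = Fx x := by simp [Fx]

lemma Fx_two : Fx 2 = 0 := by norm_num [Fx]

lemma Fx_z {z : ℝ} (h0 : z ≠ 0) (h1 : |z| ≤ 1) : Fx (z + z⁻¹) = Fz z := by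
  have hp : 0 < |z| := abs_pos.2 h0
  have e1 : |z + z⁻¹| = |z| + |z|⁻¹ := by
    rcases lt_or_gt_of_ne h0 with h | h
    · have : z⁻¹ < 0 := inv_lt_zero.2 h
      rw [abs_of_neg h, abs_of_neg (by linarith), neg_add, inv_neg]
    · have : 0 < z⁻¹ := inv_pos.2 h
      rw [abs_of_pos h, abs_of_pos (by linarith)]
  have hi : 1 ≤ |z|⁻¹ := (one_le_inv₀ hp).2 h1
  have e2 : √((z+z⁻¹)^2 - 4) = |z|⁻¹ - |z| := by
    rw [← sq_abs, e1, show (|z| + |z|⁻¹)^2 - 4 = (|z|⁻¹ - |z|)^2 by field_simp; ring,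
      Real.sqrt_sq (by linarith)]
  rw [Fx, Fz, e1, e2, show (|z| + |z|⁻¹ + (|z|⁻¹ - |z|))/2 = |z|⁻¹ by ring, Real.log_inv,
    ← sq_abs z, Real.log_pow]
  push_cast; field_simp; ring

lemma Fx_arg_pos {x : ℝ} (hx : 0 < |x|) : 0 < (|x|+√(x^2-4))/2 := by positivity

lemma Fx_cont {x : ℝ} (hx : x ≠ 0) : ContinuousAt Fx x := by
  have := (Fx_arg_pos (abs_pos.2 hx)).ne'
  unfold Fx
  fun_prop (disch := assumption)

lemma Fx_deriv {x : ℝ} (hx : 2 < x) : HasDerivAt Fx √(x^2-4) x := by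
  have hs : 0 < x^2 - 4 := by nlinarith
  have hs' : 0 < √(x^2-4) := Real.sqrt_pos.2 hs
  have h2 : √(x^2-4)^2 = x^2-4 := Real.sq_sqrt hs.le
  have d1 : HasDerivAt (fun x : ℝ => √(x^2-4)) ((2*x) / (2 * √(x^2-4))) x := by
    have : HasDerivAt (fun x : ℝ => x^2 - 4) (2*x) x := by
      simpa using (hasDerivAt_pow 2 x).sub_const 4
    exact this.sqrt hs.ne'
  have d2 := (((hasDerivAt_id x).div_const 2).mul d1).sub
    (((((hasDerivAt_id x).add d1).div_const 2).log (by simp only [Pi.add_apply, id]; positivity)).const_mul 2)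
  have hev : Fx =ᶠ[𝓝 x] fun x => x/2*√(x^2-4) - 2*Real.log ((x+√(x^2-4))/2) := by
    filter_upwards [lt_mem_nhds (show (0:ℝ) < x by linarith)] with y hy
    rw [Fx, abs_of_pos hy]
  refine HasDerivAt.congr_of_eventuallyEq ?_ hev
  refine HasDerivAt.congr_deriv (f' := 1 / 2 * √(x ^ 2 - 4) + x / 2 * (2 * x / (2 * √(x ^ 2 - 4))) -
      2 * ((1 + 2 * x / (2 * √(x ^ 2 - 4))) / 2 / ((x + √(x ^ 2 - 4)) / 2))) d2 ?_
  clear hev d2 d1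
  have : x + √(x^2-4) ≠ 0 := by positivity
  generalize √(x^2-4) = s at *
  have e : (1 + 2*x/(2*s))/2/((x+s)/2) = 1/s := by field_simp; ring
  rw [e]
  field_simp
  nlinarith [h2]

lemma Fx_mono : MonotoneOn Fx (Ici 2) := by
  apply monotoneOn_of_deriv_nonneg (convex_Ici 2)
  · intro x hx
    exact (Fx_cont (by simp at hx; linarith)).continuousWithinAt
  · intro x hx
    rw [interior_Ici] at hx
    exact (Fx_deriv hx).differentiableAt.differentiableWithinAt
  · intro x hx
    rw [interior_Ici] at hx
    rw [(Fx_deriv hx).deriv]; positivity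

lemma Fx_nonneg {x : ℝ} (h : 2 ≤ |x|) : 0 ≤ Fx x := by
  rw [← Fx_two, ← Fx_abs x]
  exact Fx_mono (by simp) h h

lemma abs_E {z : ℝ} (h0 : z ≠ 0) : 2 ≤ |z + z⁻¹| := by
  rw [← abs_of_pos (two_pos : (0:ℝ) < 2)]
  apply sq_le_sq.1
  have : (z + z⁻¹)^2 - 2^2 = (z - z⁻¹)^2 := by field_simp; ring
  nlinarith [sq_nonneg (z - z⁻¹)]

lemma Fz_nonneg {z : ℝ} (h0 : z ≠ 0) (h1 : |z| ≤ 1) : 0 ≤ Fz z := by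
  rw [← Fx_z h0 h1]; exact Fx_nonneg (abs_E h0)

variable {μ : Measure ℝ}

lemma KL_eq [IsProbabilityMeasure μ] : KLdiv SCm μ = InformationTheory.klDiv SCm μ := by
  unfold KLdiv
  split_ifs with h
  · have h1 := InformationTheory.klDiv_ne_top_iff.2 h
    rw [← InformationTheory.toReal_klDiv_of_measure_eq h.1 (by simp), ENNReal.ofReal_toReal h1]
  · by_contra h2
    exact h (InformationTheory.klDiv_ne_top_iff.1 (Ne.symm h2))

lemma clip_h {f M : ℝ} (hf : 0 ≤ f) (hM : 1 ≤ M) :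
    0 ≤ f * Real.log (max M⁻¹ (min f M)) - max M⁻¹ (min f M) + 1 := by
  have key : ∀ t : ℝ, 0 < t → 0 ≤ t * Real.log t - t + 1 := by
    intro t ht
    have := Real.one_sub_inv_le_log_of_pos ht
    have h2 := mul_le_mul_of_nonneg_left this ht.le
    rw [mul_sub, mul_inv_cancel₀ ht.ne'] at h2; linarith
  have hM0 : 0 < M := by linarith
  have hi : M⁻¹ ≤ 1 := inv_le_one_of_one_le₀ hM
  have hi0 : 0 < M⁻¹ := inv_pos.2 hM0
  rcases le_total f M with h1 | h1
  · rw [min_eq_left h1]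
    rcases le_total f M⁻¹ with h2 | h2
    · rw [max_eq_left h2]
      have := key _ hi0
      have hl : Real.log M⁻¹ ≤ 0 := Real.log_nonpos hi0.le hi
      nlinarith [mul_le_mul_of_nonpos_right h2 hl]
    · rw [max_eq_right h2]; exact key f (by linarith)
  · rw [min_eq_right h1, max_eq_right (by linarith)]
    have hl : 0 ≤ Real.log M := Real.log_nonneg hM
    have := key M hM0
    nlinarith [mul_le_mul_of_nonneg_right h1 hl]

lemma clip_mem {f M : ℝ} (hM : 1 ≤ M) : M⁻¹ ≤ max M⁻¹ (min f M) ∧ max M⁻¹ (min f M) ≤ M :=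
  ⟨le_max_left _ _, max_le ((inv_le_one_of_one_le₀ hM).trans hM) (min_le_right _ _)⟩

lemma bdd_int {g : ℝ → ℝ} (hg : Measurable g) {M : ℝ} (hM0 : 0 < M) (hM : ∀ x, M⁻¹ ≤ g x ∧ g x ≤ M) (ν : Measure ℝ) [IsFiniteMeasure ν] :
    Integrable g ν ∧ Integrable (fun x => Real.log (g x)) ν := by
  have hi0 : 0 < M⁻¹ := inv_pos.2 hM0
  constructor
  · refine Integrable.of_bound hg.aestronglyMeasurable M (ae_of_all _ fun x => ?_)
    rw [Real.norm_of_nonneg (hi0.le.trans (hM x).1)]; exact (hM x).2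
  · refine Integrable.of_bound hg.log.aestronglyMeasurable (Real.log M) (ae_of_all _ fun x => ?_)
    rw [Real.norm_eq_abs, abs_le]
    have := hi0.trans_le (hM x).1
    constructor
    · rw [← Real.log_inv]; exact Real.log_le_log hi0 (hM x).1
    · exact Real.log_le_log this (hM x).2

lemma kl_dual [IsProbabilityMeasure μ] (C : ℝ)
    (hC : ∀ g : ℝ → ℝ, Measurable g → ∀ M : ℝ, 1 ≤ M → (∀ x, M⁻¹ ≤ g x ∧ g x ≤ M) →
      ∫ x, Real.log (g x) ∂SCm + 1 - ∫ x, g x ∂μ ≤ C) : KLdiv SCm μ ≤ ENNReal.ofReal C := by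
  classical
  have hac : SCm ≪ μ := by
    refine Measure.AbsolutelyContinuous.mk fun N hN hN0 => ?_
    by_contra hne
    have hpos : 0 < SCm.real N := by
      rw [measureReal_def, ENNReal.toReal_pos_iff]; exact ⟨pos_iff_ne_zero.2 hne, measure_lt_top _ _⟩
    obtain ⟨t, ht⟩ : ∃ t : ℝ, 0 < t ∧ C < Real.log (1+t) * SCm.real N := by
      have h1 : Tendsto (fun t : ℝ => Real.log (1+t) * SCm.real N) atTop atTop :=
        (Real.tendsto_log_atTop.comp (tendsto_atTop_add_const_left _ 1 tendsto_id)).atTop_mul_const hpos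
      exact ((eventually_gt_atTop 0).and (h1.eventually_gt_atTop C)).exists
    have h2 := hC (fun x => 1 + N.indicator (fun _ => t) x) (by
      exact measurable_const.add (measurable_const.indicator hN)) (1+t) (by linarith) (by
      intro x
      have : (1+t)⁻¹ ≤ 1 := inv_le_one_of_one_le₀ (by linarith)
      by_cases hx : x ∈ N <;> simp only [hx, indicator_of_mem, indicator_of_notMem, not_false_eq_true] <;> constructor <;> linarith [ht.1])
    have e1 : (fun x => Real.log (1 + N.indicator (fun _ => t) x)) = N.indicator (fun _ => Real.log (1+t)) := by
      funext x; by_cases hx : x ∈ N <;> simp [hx]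
    have e2 : ∫ x, (1 + N.indicator (fun _ => t) x) ∂μ = 1 := by
      rw [integral_add (integrable_const _) ((integrable_const t).indicator hN), integral_indicator hN]
      simp [measureReal_def, hN0]
    rw [e1, e2, integral_indicator hN, setIntegral_const, smul_eq_mul] at h2
    linarith [ht.2, mul_comm (Real.log (1+t)) (SCm.real N)]
  rw [KL_eq, InformationTheory.klDiv_eq_lintegral_klFun_of_ac hac]
  set f : ℝ → ℝ := fun x => (SCm.rnDeriv μ x).toReal with hf
  have hfm : Measurable f := (Measure.measurable_rnDeriv _ _).ennreal_toReal
  set g : ℕ → ℝ → ℝ := fun n x => max ((n:ℝ)+1)⁻¹ (min (f x) ((n:ℝ)+1)) with hg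
  have hgm : ∀ n, Measurable (g n) := fun n => by
    exact measurable_const.max (hfm.min measurable_const)
  have hn1 : ∀ n : ℕ, (1:ℝ) ≤ (n:ℝ)+1 := fun n => by linarith [(Nat.cast_nonneg n : (0:ℝ) ≤ n)]
  have hb : ∀ (n : ℕ) x, ((n:ℝ)+1)⁻¹ ≤ g n x ∧ g n x ≤ (n:ℝ)+1 := fun n x => clip_mem (hn1 n)
  set H : ℕ → ℝ → ℝ := fun n x => f x * Real.log (g n x) - g n x + 1 with hH
  have hH0 : ∀ n x, 0 ≤ H n x := fun n x => clip_h ENNReal.toReal_nonneg (hn1 n)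
  have hHm : ∀ n, Measurable (H n) := fun n => ((hfm.mul (hgm n).log).sub (hgm n)).add_const 1
  have hlim : ∀ x, Tendsto (fun n => ENNReal.ofReal (H n x)) atTop (𝓝 (ENNReal.ofReal (InformationTheory.klFun (f x)))) := by
    intro x
    refine ENNReal.tendsto_ofReal ?_
    have hk : InformationTheory.klFun (f x) = f x * Real.log (f x) - f x + 1 := by
      rw [InformationTheory.klFun]; ring
    rw [hk]
    have hf0 : 0 ≤ f x := ENNReal.toReal_nonneg
    rcases hf0.eq_or_lt with h0 | h0
    · have e : ∀ n : ℕ, H n x = 1 - ((n:ℝ)+1)⁻¹ := by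
        intro n
        have h3 : g n x = ((n:ℝ)+1)⁻¹ := by
          simp only [hg]; rw [← h0, min_eq_left (by linarith [hn1 n]), max_eq_left (by positivity)]
        simp only [hH]
        rw [h3, ← h0]; ring
      simp_rw [e, ← h0]
      have := tendsto_one_div_add_atTop_nhds_zero_nat (𝕜 := ℝ)
      simpa using this.const_sub 1
    · have hev : ∀ᶠ n : ℕ in atTop, f x * Real.log (f x) - f x + 1 = H n x := by
        have h1 : ∀ᶠ n : ℕ in atTop, f x ≤ n := by
          obtain ⟨N, hN⟩ := exists_nat_ge (f x)
          filter_upwards [eventually_ge_atTop N] with n hn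
          exact hN.trans (by exact_mod_cast hn)
        have h2 : ∀ᶠ n : ℕ in atTop, 1/((n:ℝ)+1) < f x :=
          (tendsto_one_div_add_atTop_nhds_zero_nat (𝕜 := ℝ)).eventually_lt_const h0
        filter_upwards [h1, h2] with n h1 h2
        have : g n x = f x := by
          simp only [hg]; rw [min_eq_left (by linarith), max_eq_right (by rw [← one_div]; exact h2.le)]
        simp only [hH, this]
      exact tendsto_const_nhds.congr' hev
  have hle : ∀ n, ∫⁻ x, ENNReal.ofReal (H n x) ∂μ ≤ ENNReal.ofReal C := by
    intro n
    obtain ⟨i1, i2⟩ := bdd_int (hgm n) (by linarith [hn1 n]) (hb n) μ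
    obtain ⟨j1, j2⟩ := bdd_int (hgm n) (by linarith [hn1 n]) (hb n) SCm
    have i3 : Integrable (fun x => f x * Real.log (g n x)) μ := by
      have := (integrable_rnDeriv_smul_iff hac (f := fun x => Real.log (g n x))).2 j2
      simpa [smul_eq_mul] using this
    have i4 : Integrable (H n) μ := (i3.sub i1).add (integrable_const 1)
    rw [← ofReal_integral_eq_lintegral_ofReal i4 (ae_of_all _ (hH0 n))]
    apply ENNReal.ofReal_le_ofReal
    have e : ∫ x, f x * Real.log (g n x) ∂μ = ∫ x, Real.log (g n x) ∂SCm := by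
      rw [← integral_rnDeriv_smul hac]; rfl
    have e2 : ∫ x, H n x ∂μ = ∫ x, Real.log (g n x) ∂SCm - ∫ x, g n x ∂μ + 1 := by
      simp only [hH]
      rw [integral_add (f := fun x => f x * Real.log (g n x) - g n x) (i3.sub i1) (integrable_const 1), integral_sub i3 i1, e]; simp
    rw [e2]
    linarith [hC (g n) (hgm n) _ (hn1 n) (hb n)]
  calc ∫⁻ x, ENNReal.ofReal (InformationTheory.klFun (f x)) ∂μ
      = ∫⁻ x, liminf (fun n => ENNReal.ofReal (H n x)) atTop ∂μ :=
        lintegral_congr fun x => (hlim x).liminf_eq.symm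
    _ ≤ liminf (fun n => ∫⁻ x, ENNReal.ofReal (H n x) ∂μ) atTop :=
        lintegral_liminf_le fun n => (hHm n).ennreal_ofReal
    _ ≤ ENNReal.ofReal C := by
        refine (liminf_le_liminf (Eventually.of_forall hle)).trans ?_
        simp

lemma log_lip {x y M : ℝ} (hM : 0 < M) (hx : M⁻¹ ≤ x) (hy : M⁻¹ ≤ y) :
    Real.log x - Real.log y ≤ M * |x - y| := by
  have hi : 0 < M⁻¹ := inv_pos.2 hM
  have hx0 := hi.trans_le hx
  have hy0 := hi.trans_le hy
  rw [← Real.log_div hx0.ne' hy0.ne']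
  have h1 := Real.log_le_sub_one_of_pos (div_pos hx0 hy0)
  have h2 : x / y - 1 = (x-y) * y⁻¹ := by field_simp
  rw [h2] at h1
  have h3 : y⁻¹ ≤ M := by rw [inv_le_comm₀ hy0 hM]; exact hy
  calc _ ≤ (x-y) * y⁻¹ := h1
    _ ≤ |x-y| * y⁻¹ := mul_le_mul_of_nonneg_right (le_abs_self _) (inv_pos.2 hy0).le
    _ ≤ |x-y| * M := mul_le_mul_of_nonneg_left h3 (abs_nonneg _)
    _ = _ := mul_comm _ _

lemma kl_cont [IsProbabilityMeasure μ] (C : ℝ)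
    (hC : ∀ g : ℝ → ℝ, Continuous g → ∀ M : ℝ, 1 ≤ M → (∀ x, M⁻¹ ≤ g x ∧ g x ≤ M) →
      ∫ x, Real.log (g x) ∂SCm + 1 - ∫ x, g x ∂μ ≤ C) : KLdiv SCm μ ≤ ENNReal.ofReal C := by
  apply kl_dual
  intro g hg M hM hb
  have hM0 : 0 < M := by linarith
  apply le_of_forall_pos_le_add
  intro ε hε
  obtain ⟨g1, g2⟩ := bdd_int hg hM0 hb SCm
  obtain ⟨g3, g4⟩ := bdd_int hg hM0 hb μ
  obtain ⟨g5, -⟩ := bdd_int hg hM0 hb (SCm + μ)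
  have hδ : 0 < ε / (M+1) := by positivity
  obtain ⟨φ, h1, h2⟩ := g5.exists_boundedContinuous_integral_sub_le hδ
  set ψ : ℝ → ℝ := fun x => max M⁻¹ (min (φ x) M) with hψ
  have hψc : Continuous ψ := continuous_const.max (φ.continuous.min continuous_const)
  have hψb : ∀ x, M⁻¹ ≤ ψ x ∧ ψ x ≤ M := fun x => clip_mem hM
  have hgψ : ∀ x, |g x - ψ x| ≤ ‖g x - φ x‖ := by
    intro x
    rw [Real.norm_eq_abs]
    have : g x = max M⁻¹ (min (g x) M) := by rw [min_eq_left (hb x).2, max_eq_right (hb x).1]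
    rw [this]
    simp only [hψ]
    refine (abs_max_sub_max_le_max _ _ _ _).trans ?_
    rw [sub_self, abs_zero]
    refine max_le (abs_nonneg _) ((abs_min_sub_min_le_max _ _ _ _).trans ?_)
    rw [sub_self, abs_zero, ← this]
    exact max_le le_rfl (abs_nonneg _)
  obtain ⟨p1, p2⟩ := bdd_int hψc.measurable hM0 hψb SCm
  obtain ⟨p3, p4⟩ := bdd_int hψc.measurable hM0 hψb μ
  have q1 : Integrable (fun x => |g x - ψ x|) SCm := (g1.sub p1).abs
  have q2 : Integrable (fun x => |g x - ψ x|) μ := (g3.sub p3).abs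
  have key := hC ψ hψc M hM hψb
  have e1 : ∫ x, Real.log (g x) ∂SCm - ∫ x, Real.log (ψ x) ∂SCm ≤ M * ∫ x, |g x - ψ x| ∂SCm := by
    rw [← integral_sub g2 p2, ← integral_const_mul]
    exact integral_mono (g2.sub p2) (q1.const_mul M) fun x => log_lip hM0 (hb x).1 (hψb x).1
  have e2 : ∫ x, ψ x ∂μ - ∫ x, g x ∂μ ≤ ∫ x, |g x - ψ x| ∂μ := by
    rw [← integral_sub p3 g3]
    exact integral_mono (p3.sub g3) q2 fun x => by
      simp only [Pi.sub_apply]; rw [abs_sub_comm]; exact le_abs_self _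
  have e3 : ∫ x, |g x - ψ x| ∂SCm + ∫ x, |g x - ψ x| ∂μ ≤ ε / (M+1) := by
    rw [← integral_add_measure q1 q2]
    exact (integral_mono (q1.add_measure q2) (g5.sub h2).norm hgψ).trans h1
  have n1 : 0 ≤ ∫ x, |g x - ψ x| ∂SCm := integral_nonneg fun x => abs_nonneg _
  have n2 : 0 ≤ ∫ x, |g x - ψ x| ∂μ := integral_nonneg fun x => abs_nonneg _
  have e4 : M * ∫ x, |g x - ψ x| ∂SCm + ∫ x, |g x - ψ x| ∂μ ≤ ε := by
    calc _ ≤ (M+1) * (∫ x, |g x - ψ x| ∂SCm + ∫ x, |g x - ψ x| ∂μ) := by nlinarith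
      _ ≤ (M+1) * (ε / (M+1)) := by gcongr
      _ = ε := by field_simp
  linarith

lemma kl_poly [IsProbabilityMeasure μ] (C T : ℝ) (hT : 2 ≤ T) (hμ : μ (Icc (-T) T)ᶜ = 0)
    (hC : ∀ q : ℝ[X], (∀ x ∈ Icc (-T) T, 0 < q.eval x) →
      ∫ x, Real.log (q.eval x) ∂SCm + 1 - ∫ x, q.eval x ∂μ ≤ C) : KLdiv SCm μ ≤ ENNReal.ofReal C := by
  apply kl_cont
  intro g hg M hM hb
  have hM0 : 0 < M := by linarith
  have hS : SCm (Icc (-T) T)ᶜ = 0 := by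
    refine measure_mono_null (compl_subset_compl.2 ?_) SC_compl
    intro x hx; exact ⟨by linarith [hx.1], by linarith [hx.2]⟩
  have haeS : ∀ᵐ x ∂SCm, x ∈ Icc (-T) T := by rw [ae_iff]; exact hS
  have haeμ : ∀ᵐ x ∂μ, x ∈ Icc (-T) T := by rw [ae_iff]; exact hμ
  apply le_of_forall_pos_le_add
  intro ε hε
  obtain ⟨q, hq⟩ := exists_polynomial_near_of_continuousOn (-T) T (fun x => g x + ε/2) (by fun_prop) (ε/2) (by positivity)
  have hi0 : 0 < M⁻¹ := inv_pos.2 hM0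
  have hq1 : ∀ x ∈ Icc (-T) T, g x ≤ q.eval x ∧ q.eval x ≤ g x + ε := by
    intro x hx
    have := abs_lt.1 (hq x hx)
    constructor <;> linarith
  have key := hC q (fun x hx => by linarith [(hq1 x hx).1, (hb x).1])
  obtain ⟨g1, g2⟩ := bdd_int hg.measurable hM0 hb SCm
  obtain ⟨g3, g4⟩ := bdd_int hg.measurable hM0 hb μ
  have hqi : Integrable (fun x => q.eval x) μ := by
    refine Integrable.of_bound q.continuous.aestronglyMeasurable (M + ε) ?_
    filter_upwards [haeμ] with x hx
    rw [Real.norm_of_nonneg (by linarith [(hq1 x hx).1, (hb x).1])]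
    linarith [(hq1 x hx).2, (hb x).2]
  have hqS : Integrable (fun x => Real.log (q.eval x)) SCm := by
    refine Integrable.of_bound (q.continuous.measurable.log).aestronglyMeasurable (Real.log (M + ε)) ?_
    filter_upwards [haeS] with x hx
    have h1 := hq1 x hx
    have h2 := hb x
    rw [Real.norm_eq_abs, abs_le]
    constructor
    · rw [← Real.log_inv]
      refine Real.log_le_log (by positivity) (le_trans ?_ (h2.1.trans h1.1))
      gcongr; linarith
    · exact Real.log_le_log (by linarith) (by linarith)
  have e1 : ∫ x, Real.log (g x) ∂SCm ≤ ∫ x, Real.log (q.eval x) ∂SCm := by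
    apply integral_mono_ae g2 hqS
    filter_upwards [haeS] with x hx
    exact Real.log_le_log (by linarith [(hb x).1]) (hq1 x hx).1
  have e2 : ∫ x, q.eval x ∂μ ≤ ∫ x, g x ∂μ + ε := by
    have : ∫ x, (g x + ε) ∂μ = ∫ x, g x ∂μ + ε := by
      rw [integral_add g3 (integrable_const _)]; simp
    rw [← this]
    apply integral_mono_ae hqi (g3.add (integrable_const _))
    filter_upwards [haeμ] with x hx
    exact (hq1 x hx).2
  linarith

end SumRules
end

section
namespace SumRules

structure OP (μ : Measure ℝ) (a b : ℕ → ℝ) (p : ℕ → ℝ[X]) (R : ℝ) : Prop extends Rec a b p where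
  int : ∀ q : ℝ[X], Integrable (fun x => q.eval x) μ
  ho : ∀ j k, ∫ x, (p j).eval x * (p k).eval x ∂μ = if j = k then 1 else 0
  supp : μ (Icc (-R) R)ᶜ = 0
  R2 : 2 ≤ R

lemma poly_int {μ : Measure ℝ} [IsProbabilityMeasure μ] {R : ℝ} (hR : μ (Icc (-R) R)ᶜ = 0) (f : ℝ → ℝ)
    (hf : ContinuousOn f (Icc (-R) R)) : Integrable f μ := by
  have h1 : IntegrableOn f (Icc (-R) R) μ := hf.integrableOn_compact isCompact_Icc
  rwa [IntegrableOn, Measure.restrict_eq_self_of_ae_mem (by rw [ae_iff]; exact hR)] at h1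

lemma OP.of {μ : Measure ℝ} [IsProbabilityMeasure μ] {a b : ℕ → ℝ} (hab : IsJacobi μ a b)
    (hcs : ∃ R : ℝ, μ (Icc (-R) R)ᶜ = 0) : ∃ p R, OP μ a b p R := by
  obtain ⟨p, h1, h2⟩ := Rec.of_jacobi hab
  obtain ⟨R, hR⟩ := hcs
  have hR' : μ (Icc (-(max R 2)) (max R 2))ᶜ = 0 := by
    refine measure_mono_null (compl_subset_compl.2 ?_) hR
    intro x hx
    exact ⟨by linarith [hx.1, le_max_left R 2], by linarith [hx.2, le_max_left R 2]⟩
  exact ⟨p, max R 2, { h1 with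
    int := fun q => poly_int hR' _ q.continuous.continuousOn
    ho := h2
    supp := hR'
    R2 := le_max_right _ _ }⟩

lemma Gfun_nonneg {x : ℝ} (hx : 0 < x) : 0 ≤ Gfun x := by
  unfold Gfun; linarith [Real.log_le_sub_one_of_pos hx]

variable {a b : ℕ → ℝ} {p : ℕ → ℝ[X]} {μ : Measure ℝ} {R : ℝ}

lemma ofReal_Isum (h : Rec a b p) (m : ℕ) : ENNReal.ofReal (Rec.Isum a b m) =
    ∑ k ∈ Finset.range (m+1), (1/2 : ℝ≥0∞) * ENNReal.ofReal ((b (k+1))^2) +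
     ∑ k ∈ Finset.range m, ENNReal.ofReal (Gfun (a (k+1)^2)) := by
  have hG : ∀ k, 0 ≤ Gfun (a (k+1)^2) := fun k => Gfun_nonneg (pow_pos (h.a_pos k) 2)
  rw [Rec.Isum, ENNReal.ofReal_add (Finset.sum_nonneg fun _ _ => by positivity) (Finset.sum_nonneg fun _ _ => hG _),
    ENNReal.ofReal_sum_of_nonneg (fun _ _ => by positivity), ENNReal.ofReal_sum_of_nonneg (fun _ _ => hG _)]
  congr 1
  refine Finset.sum_congr rfl fun k _ => ?_
  rw [ENNReal.ofReal_div_of_pos two_pos, ENNReal.div_eq_inv_mul]; simp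

lemma Isum_tendsto (h : Rec a b p) : Tendsto (fun m => ENNReal.ofReal (Rec.Isum a b m)) atTop (𝓝 (IH a b)) := by
  simp_rw [ofReal_Isum h]
  unfold IH
  rw [← ENNReal.tsum_mul_left]
  exact ((ENNReal.tendsto_nat_tsum _).comp (tendsto_add_atTop_nat 1)).add (ENNReal.tendsto_nat_tsum _)

lemma Isum_le (h : Rec a b p) (m : ℕ) : ENNReal.ofReal (Rec.Isum a b m) ≤ IH a b := by
  rw [ofReal_Isum h]
  unfold IH
  rw [← ENNReal.tsum_mul_left]
  exact add_le_add (ENNReal.sum_le_tsum _) (ENNReal.sum_le_tsum _)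

lemma Isum_nonneg (h : Rec a b p) (m : ℕ) : 0 ≤ Rec.Isum a b m :=
  add_nonneg (Finset.sum_nonneg fun _ _ => by positivity)
    (Finset.sum_nonneg fun k _ => Gfun_nonneg (pow_pos (h.a_pos k) 2))

lemma Isum_le_toReal (h : Rec a b p) (hI : IH a b ≠ ⊤) (m : ℕ) : Rec.Isum a b m ≤ (IH a b).toReal := by
  rw [← ENNReal.ofReal_le_iff_le_toReal hI]; exact Isum_le h m

lemma coeff_bdd (h : Rec a b p) (hI : IH a b ≠ ⊤) : ∃ M : ℝ, 1 ≤ M ∧ ∀ k, |b (k+1)| ≤ M ∧ a (k+1) ≤ M := by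
  set I := (IH a b).toReal with hIdef
  have hI0 : 0 ≤ I := ENNReal.toReal_nonneg
  refine ⟨2*(I+1), by linarith, fun k => ?_⟩
  have h1 := Isum_le_toReal h hI (k+1)
  rw [← hIdef, Rec.Isum] at h1
  have hG : ∀ k, 0 ≤ Gfun (a (k+1)^2) := fun k => Gfun_nonneg (pow_pos (h.a_pos k) 2)
  have s1 := Finset.single_le_sum (f := fun k => b (k+1)^2/2) (s := Finset.range (k+1+1)) (fun i _ => by positivity) (Finset.mem_range.2 (show k < k+1+1 by omega))
  have s2 := Finset.single_le_sum (f := fun k => Gfun (a (k+1)^2)) (s := Finset.range (k+1)) (fun i _ => hG i) (Finset.mem_range.2 (show k < k+1 by omega))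
  have n1 : 0 ≤ ∑ k ∈ Finset.range (k+1+1), b (k+1)^2/2 := Finset.sum_nonneg fun _ _ => by positivity
  have n2 : 0 ≤ ∑ k ∈ Finset.range (k+1), Gfun (a (k+1)^2) := Finset.sum_nonneg fun _ _ => hG _
  beta_reduce at s1 s2
  constructor
  · apply abs_le_of_sq_le_sq _ (by linarith)
    nlinarith
  · have ha := h.a_pos k
    have h3 : Gfun (a (k+1)^2) ≤ I := by linarith
    unfold Gfun at h3
    have h4 := Real.log_le_sub_one_of_pos (show 0 < a (k+1)^2/2 by positivity)
    rw [Real.log_div (by positivity) (by norm_num)] at h4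
    have h5 : Real.log 2 ≤ 1 := by have := Real.log_two_lt_d9; linarith
    have h6 : a (k+1)^2 ≤ 2*(I+1) := by linarith
    nlinarith

lemma E_bdd (h : Rec a b p) {M : ℝ} (hM : 1 ≤ M) (hb : ∀ k, |b (k+1)| ≤ M ∧ a (k+1) ≤ M) (m : ℕ) {z : ℝ}
    (hz : z ∈ Rec.Zs a p m) : |z + z⁻¹| ≤ 3*M+1 := by
  by_contra hc
  push Not at hc
  obtain ⟨h0, h1, h2⟩ := (h.mem_Zs m z).1 hz
  set x := z + z⁻¹ with hx
  have key : ∀ m, 0 < |(p m).eval x| ∧ (M+1) * |(p m).eval x| ≤ |(Ap a p m).eval x| := by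
    intro m
    induction m with
    | zero =>
      rw [h.p0, h.Ap_zero]
      simp only [eval_one, abs_one, eval_sub, eval_X, eval_C, mul_one]
      refine ⟨one_pos, ?_⟩
      have := abs_sub_abs_le_abs_sub x (b 1)
      have := (hb 0).1
      rw [zero_add] at this
      linarith
    | succ m ih =>
      obtain ⟨i1, i2⟩ := ih
      have ha := h.a_pos m
      have e1 : |(Ap a p m).eval x| = a (m+1) * |(p (m+1)).eval x| := by
        rw [Ap, eval_mul, eval_C, abs_mul, abs_of_pos ha]
      rw [e1] at i2
      have pos : 0 < |(p (m+1)).eval x| := by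
        by_contra hn
        have : |(p (m+1)).eval x| = 0 := le_antisymm (not_lt.1 hn) (abs_nonneg _)
        rw [this] at i2; nlinarith
      refine ⟨pos, ?_⟩
      rw [h.Ap_succ]
      simp only [eval_sub, eval_mul, eval_X, eval_C]
      have t1 := abs_sub_abs_le_abs_sub ((x - b (m+2)) * (p (m+1)).eval x) (a (m+1) * (p m).eval x)
      rw [abs_mul, abs_mul, abs_of_pos ha] at t1
      have t2 := abs_sub_abs_le_abs_sub x (b (m+2))
      have t3 := (hb (m+1)).1
      have t4 := (hb m).2
      have t5 : (2*M+1) * |(p (m+1)).eval x| ≤ |x - b (m+2)| * |(p (m+1)).eval x| :=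
        mul_le_mul_of_nonneg_right (by have : b (m+1+1) = b (m+2) := rfl
                                       rw [this] at t3; linarith) pos.le
      have t6 : a (m+1) * |(p m).eval x| ≤ M * |(p (m+1)).eval x| := by
        have q1 : (M+1) * (a (m+1) * |(p m).eval x|) ≤ a (m+1)^2 * |(p (m+1)).eval x| := by nlinarith
        have q2 : a (m+1)^2 ≤ (M+1) * M := by nlinarith
        have q3 := mul_le_mul_of_nonneg_right q2 pos.le
        have : (M+1) * (a (m+1) * |(p m).eval x|) ≤ (M+1) * (M * |(p (m+1)).eval x|) := by linarith
        exact le_of_mul_le_mul_left this (by linarith)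
      linarith
  obtain ⟨k1, k2⟩ := key m
  rw [h2, abs_mul] at k2
  nlinarith

lemma near [IsProbabilityMeasure μ] (o : OP μ a b p R) {T : ℝ} (hT : R ≤ T)
    (hE : ∀ m, ∀ z ∈ Rec.Zs a p m, |z + z⁻¹| ≤ T) {s : ℝ} (hs : s ∈ suppSet μ) (hs2 : 2 < |s|)
    {N : Set ℝ} (hN : N ∈ 𝓝 s) : ∀ᶠ m in atTop, ∃ z ∈ Rec.Zs a p m, z + z⁻¹ ∈ N := by
  have hN' : N ∩ {x | 2 < |x|} ∈ 𝓝 s := inter_mem hN ((continuous_abs.isOpen_preimage _ isOpen_Ioi).mem_nhds hs2)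
  obtain ⟨δ, hδ, hball⟩ := Metric.mem_nhds_iff.1 hN'
  set φ : ℝ → ℝ := fun x => max 0 (1 - |x - s|/δ) with hφ
  have hφc : Continuous φ := by fun_prop
  have hφ0 : ∀ x, 0 ≤ φ x := fun x => le_max_left _ _
  have hφz : ∀ x, x ∉ Metric.ball s δ → φ x = 0 := by
    intro x hx
    simp only [Metric.mem_ball, Real.dist_eq, not_lt] at hx
    simp only [hφ]
    rw [max_eq_left]
    have := (one_le_div hδ).2 hx
    linarith
  have hTμ : μ (Icc (-T) T)ᶜ = 0 := by
    refine measure_mono_null (compl_subset_compl.2 ?_) o.supp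
    intro x hx; exact ⟨by linarith [hx.1], by linarith [hx.2]⟩
  have haeμ : ∀ᵐ x ∂μ, x ∈ Icc (-T) T := by rw [ae_iff]; exact hTμ
  have haeS : ∀ᵐ x ∂SCm, x ∈ Ioo (-2:ℝ) 2 := by rw [ae_iff]; exact SC_compl
  have hφi : Integrable φ μ := poly_int hTμ φ hφc.continuousOn
  have hc : 0 < ∫ x, φ x ∂μ := by
    rw [integral_pos_iff_support_of_nonneg hφ0 hφi]
    refine lt_of_lt_of_le (pos_iff_ne_zero.2 (hs _ (Metric.ball_mem_nhds s hδ))) (measure_mono ?_)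
    intro x hx
    simp only [Metric.mem_ball, Real.dist_eq] at hx
    have := (div_lt_one hδ).2 hx
    simp only [Function.mem_support, hφ]
    exact (lt_max_of_lt_right (by linarith)).ne'
  set c := ∫ x, φ x ∂μ with hcdef
  obtain ⟨q, hq⟩ := exists_polynomial_near_of_continuousOn (-T) T φ hφc.continuousOn (c/3) (by positivity)
  filter_upwards [eventually_ge_atTop q.natDegree] with m hm
  by_contra hcon
  push Not at hcon
  have hEz : ∀ z ∈ Rec.Zs a p m, q.eval (z+z⁻¹) ≤ c/3 := by
    intro z hz
    have h1 := abs_le.1 (hE m z hz)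
    have h2 := abs_lt.1 (hq _ ⟨h1.1, h1.2⟩)
    rw [hφz _ (fun hb => hcon z hz (hball hb).1)] at h2
    linarith
  obtain ⟨q1, q2⟩ := o.quad o.int o.ho m q (by omega)
  obtain ⟨u1, u2⟩ := o.quad o.int o.ho m 1 (by simp)
  have e1 : ∫ x, q.eval x / (Dp a p m).eval x ∂SCm ≤ c/3 * ∫ x, (1:ℝ[X]).eval x / (Dp a p m).eval x ∂SCm := by
    rw [← integral_const_mul]
    apply integral_mono_ae q1 (u1.const_mul _)
    filter_upwards [haeS] with x hx
    have hD := o.D_pos m hx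
    have h2 := abs_lt.1 (hq x ⟨by linarith [hx.1, o.R2], by linarith [hx.2, o.R2]⟩)
    rw [hφz x (fun hb => by
      have h3 := (hball hb).2
      change 2 < |x| at h3
      have := abs_lt.2 hx
      linarith)] at h2
    simp only [eval_one]
    rw [mul_one_div]
    gcongr; linarith
  have e2 : ∑ z ∈ Rec.Zs a p m, Rec.wz p m z * q.eval (z+z⁻¹) ≤ c/3 * ∑ z ∈ Rec.Zs a p m, Rec.wz p m z * (1:ℝ[X]).eval (z+z⁻¹) := by
    rw [Finset.mul_sum]
    refine Finset.sum_le_sum fun z hz => ?_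
    rw [eval_one, mul_one, mul_comm]
    exact mul_le_mul_of_nonneg_right (hEz z hz) (o.wz_nonneg m hz)
  have e3 : ∫ x, (1:ℝ[X]).eval x ∂μ = 1 := by simp
  have e4 : c - c/3 ≤ ∫ x, q.eval x ∂μ := by
    have : ∫ x, (φ x - c/3) ∂μ = c - c/3 := by
      rw [integral_sub hφi (integrable_const _)]; simp [hcdef]
    rw [← this]
    apply integral_mono_ae (hφi.sub (integrable_const _)) (o.int q)
    filter_upwards [haeμ] with x hx
    have h2 := abs_lt.1 (hq x hx)
    show φ x - c/3 ≤ q.eval x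
    linarith
  rw [e3] at u2
  nlinarith

lemma var_le [IsProbabilityMeasure μ] (o : OP μ a b p R) {T : ℝ} (hT : R ≤ T)
    (hE : ∀ m, ∀ z ∈ Rec.Zs a p m, |z + z⁻¹| ≤ T) (q : ℝ[X]) (hq : ∀ x ∈ Icc (-T) T, 0 < q.eval x)
    {m : ℕ} (hm : q.natDegree ≤ m) :
    ∫ x, Real.log (q.eval x) ∂SCm + 1 - ∫ x, q.eval x ∂μ ≤ ∫ x, Real.log ((Dp a p m).eval x) ∂SCm := by
  have haeS : ∀ᵐ x ∂SCm, x ∈ Ioo (-2:ℝ) 2 := by rw [ae_iff]; exact SC_compl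
  have hS : SCm (Icc (-T) T)ᶜ = 0 := by
    refine measure_mono_null (compl_subset_compl.2 ?_) SC_compl
    intro x hx; exact ⟨by linarith [hx.1, o.R2], by linarith [hx.2, o.R2]⟩
  have i1 : Integrable (fun x => Real.log (q.eval x)) SCm :=
    poly_int hS _ (q.continuous.continuousOn.log fun x hx => (hq x hx).ne')
  obtain ⟨i2, -⟩ := o.log_D m
  obtain ⟨q1, q2⟩ := o.quad o.int o.ho m q (by omega)
  have e1 : ∫ x, (Real.log (q.eval x) - Real.log ((Dp a p m).eval x)) ∂SCm
      ≤ ∫ x, (q.eval x / (Dp a p m).eval x - 1) ∂SCm := by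
    apply integral_mono_ae (i1.sub i2) (q1.sub (integrable_const 1))
    filter_upwards [haeS] with x hx
    have hD := o.D_pos m hx
    have hqx := hq x ⟨by linarith [hx.1, o.R2], by linarith [hx.2, o.R2]⟩
    show Real.log (q.eval x) - Real.log ((Dp a p m).eval x) ≤ q.eval x / (Dp a p m).eval x - 1
    rw [← Real.log_div hqx.ne' hD.ne']
    exact Real.log_le_sub_one_of_pos (div_pos hqx hD)
  rw [integral_sub i1 i2, integral_sub q1 (integrable_const 1)] at e1
  have e2 : 0 ≤ ∑ z ∈ Rec.Zs a p m, Rec.wz p m z * q.eval (z+z⁻¹) :=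
    Finset.sum_nonneg fun z hz => mul_nonneg (o.wz_nonneg m hz)
      (hq _ ⟨(abs_le.1 (hE m z hz)).1, (abs_le.1 (hE m z hz)).2⟩).le
  have e3 : ∫ _x : ℝ, (1:ℝ) ∂SCm = 1 := by simp
  rw [e3] at e1
  linarith

theorem partA [IsProbabilityMeasure μ] (o : OP μ a b p R) (hI : IH a b ≠ ⊤) (S : Finset ℝ)
    (hS : ∀ s ∈ S, s ∈ ES μ (-2) 2) : KLdiv SCm μ + ∑ s ∈ S, FSC s ≤ IH a b := by
  obtain ⟨M, hM, hb⟩ := coeff_bdd o.toRec hI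
  set T := max R (3*M+1) with hTdef
  have hE : ∀ m, ∀ z ∈ Rec.Zs a p m, |z + z⁻¹| ≤ T := fun m z hz => (E_bdd o.toRec hM hb m hz).trans (le_max_right _ _)
  have hRT : R ≤ T := le_max_left _ _
  have hTμ : μ (Icc (-T) T)ᶜ = 0 := by
    refine measure_mono_null (compl_subset_compl.2 ?_) o.supp
    intro x hx; exact ⟨by linarith [hx.1], by linarith [hx.2]⟩
  have hS2 : ∀ s ∈ S, 2 < |s| := by
    intro s hs
    have := (hS s hs).2
    by_contra hc
    exact this (abs_le.1 (not_lt.1 hc))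
  set I := (IH a b).toReal with hIdef
  -- main bound
  have main : ∀ q : ℝ[X], (∀ x ∈ Icc (-T) T, 0 < q.eval x) →
      ∫ x, Real.log (q.eval x) ∂SCm + 1 - ∫ x, q.eval x ∂μ ≤ I - ∑ s ∈ S, Fx s := by
    intro q hq
    apply le_of_forall_pos_le_add
    intro ε hε
    set η := ε / (S.card + 1) with hη
    have hη0 : 0 < η := by positivity
    obtain ⟨U, hU, hdisj⟩ := S.finite_toSet.t2_separation
    have hev : ∀ᶠ m in atTop, ∀ s ∈ S, ∃ z ∈ Rec.Zs a p m, z + z⁻¹ ∈ U s ∩ {x | Fx s - η < Fx x} := by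
      rw [Filter.eventually_all_finset]
      intro s hs
      apply near o hRT hE (hS s hs).1 (hS2 s hs)
      refine inter_mem ((hU s).2.mem_nhds (hU s).1) ?_
      have h0 : s ≠ 0 := by rintro rfl; have := hS2 0 hs; simp at this; linarith
      exact (Fx_cont h0).eventually (lt_mem_nhds (by linarith))
    obtain ⟨m, hm1, hm2⟩ := (hev.and (eventually_ge_atTop q.natDegree)).exists
    choose! ζ hζ1 hζ2 using hm1
    have hinj : Set.InjOn ζ S := by
      intro s hs t ht hst
      by_contra hne
      have h1 := (hζ2 s hs).1
      have h2 := (hζ2 t ht).1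
      rw [← hst] at h2
      exact Set.disjoint_left.1 (hdisj hs ht hne) h1 h2
    have hsum : ∑ s ∈ S, (Fx s - η) ≤ ∑ z ∈ Rec.Zs a p m, Fz z := by
      calc ∑ s ∈ S, (Fx s - η) ≤ ∑ s ∈ S, Fz (ζ s) := by
            refine Finset.sum_le_sum fun s hs => ?_
            obtain ⟨z0, z1, -⟩ := (o.mem_Zs m (ζ s)).1 (hζ1 s hs)
            rw [← Fx_z z0 z1]; exact (hζ2 s hs).2.le
        _ = ∑ z ∈ S.image ζ, Fz z := by rw [Finset.sum_image hinj]
        _ ≤ _ := by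
            apply Finset.sum_le_sum_of_subset_of_nonneg
            · intro z hz
              obtain ⟨s, hs, rfl⟩ := Finset.mem_image.1 hz
              exact hζ1 s hs
            · intro z hz _
              obtain ⟨z0, z1, -⟩ := (o.mem_Zs m z).1 hz
              exact Fz_nonneg z0 z1
    have hv := var_le o hRT hE q hq hm2
    rw [(o.log_D m).2] at hv
    rw [Finset.sum_sub_distrib, Finset.sum_const, nsmul_eq_mul] at hsum
    have h3 := Isum_le_toReal o.toRec hI m
    have h4 : (S.card:ℝ) * η ≤ ε := by
      rw [hη, mul_div_assoc', div_le_iff₀ (by positivity)]; nlinarith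
    linarith
  have hC := main 1 (by simp)
  simp at hC
  have hkl := kl_poly _ T (o.R2.trans hRT) hTμ main
  calc KLdiv SCm μ + ∑ s ∈ S, FSC s ≤ ENNReal.ofReal (I - ∑ s ∈ S, Fx s) + ∑ s ∈ S, FSC s := by gcongr
    _ = ENNReal.ofReal (I - ∑ s ∈ S, Fx s) + ENNReal.ofReal (∑ s ∈ S, Fx s) := by
        rw [ENNReal.ofReal_sum_of_nonneg (fun s hs => Fx_nonneg (hS2 s hs).le)]
        congr 1
        exact Finset.sum_congr rfl fun s hs => FSC_eq (hS2 s hs).le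
    _ = ENNReal.ofReal I := by
        rw [← ENNReal.ofReal_add (by linarith) (Finset.sum_nonneg fun s hs => Fx_nonneg (hS2 s hs).le)]
        congr 1; ring
    _ = IH a b := ENNReal.ofReal_toReal hI

end SumRules
end

section
namespace SumRules
variable {a b : ℕ → ℝ} {p : ℕ → ℝ[X]} {μ : Measure ℝ} {R : ℝ}

def ell (μ : Measure ℝ) (q : ℝ[X]) : ℝ := ∫ x, q.eval x ∂μ

lemma OP.ell_add (o : OP μ a b p R) (q r : ℝ[X]) : ell μ (q + r) = ell μ q + ell μ r := by
  unfold ell; simp only [eval_add]; exact integral_add (o.int q) (o.int r)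

lemma OP.ell_sub (o : OP μ a b p R) (q r : ℝ[X]) : ell μ (q - r) = ell μ q - ell μ r := by
  unfold ell; simp only [eval_sub]; exact integral_sub (o.int q) (o.int r)

lemma ell_C (c : ℝ) (q : ℝ[X]) : ell μ (C c * q) = c * ell μ q := by
  unfold ell; simp only [eval_mul, eval_C]; exact integral_const_mul _ _

lemma OP.ell_pp (o : OP μ a b p R) (j k : ℕ) : ell μ (p j * p k) = if j = k then 1 else 0 := by
  rw [← o.ho j k]; simp [ell]

lemma OP.ell_b (o : OP μ a b p R) (k : ℕ) : ell μ (X * p k * p k) = b (k+1) := by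
  have e : ell μ (Ap a p k * p k) = 0 := by
    rw [Ap, mul_assoc, ell_C, o.ell_pp, if_neg (by omega), mul_zero]
  cases k with
  | zero =>
    rw [o.Ap_zero] at e
    rw [show (X - C (b 1)) * p 0 = X * p 0 * p 0 - C (b 1) * (p 0 * p 0) by rw [o.p0]; ring, o.ell_sub, ell_C, o.ell_pp] at e
    simp at e ⊢; linarith
  | succ k =>
    rw [o.Ap_succ, show ((X - C (b (k+2))) * p (k+1) - C (a (k+1)) * p k) * p (k+1) =
      X * p (k+1) * p (k+1) - C (b (k+2)) * (p (k+1) * p (k+1)) - C (a (k+1)) * (p k * p (k+1)) by ring, o.ell_sub, o.ell_sub, ell_C, ell_C,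
      o.ell_pp, o.ell_pp] at e
    simp at e; linarith

lemma OP.ell_a (o : OP μ a b p R) (k : ℕ) : ell μ (X * p (k+1) * p k) = a (k+1) := by
  have e : ell μ (Ap a p k * p (k+1)) = a (k+1) := by
    rw [Ap, mul_assoc, ell_C, o.ell_pp, if_pos rfl, mul_one]
  cases k with
  | zero =>
    rw [o.Ap_zero] at e
    rw [show (X - C (b 1)) * p (0+1) = X * p (0+1) * p 0 - C (b 1) * (p 0 * p (0+1)) by rw [o.p0]; ring, o.ell_sub, ell_C, o.ell_pp] at e
    simp at e ⊢; linarith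
  | succ k =>
    rw [o.Ap_succ, show ((X - C (b (k+2))) * p (k+1) - C (a (k+1)) * p k) * p (k+1+1) =
      X * p (k+1+1) * p (k+1) - C (b (k+2)) * (p (k+1) * p (k+1+1)) - C (a (k+1)) * (p k * p (k+1+1)) by ring, o.ell_sub, o.ell_sub, ell_C, ell_C,
      o.ell_pp, o.ell_pp] at e
    rw [if_neg (by omega), if_neg (by omega)] at e
    linarith

lemma OP.ae_R (o : OP μ a b p R) : ∀ᵐ x ∂μ, |x| ≤ R := by
  have : ∀ᵐ x ∂μ, x ∈ Icc (-R) R := by rw [ae_iff]; exact o.supp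
  filter_upwards [this] with x hx using abs_le.2 hx

lemma OP.ell_le (o : OP μ a b p R) (j k : ℕ) : |ell μ (X * p j * p k)| ≤ R := by
  have e : ∫ x, R * ((p j).eval x^2 + (p k).eval x^2)/2 ∂μ = R := by
    have := o.ell_add (p j * p j) (p k * p k)
    rw [o.ell_pp, o.ell_pp, if_pos rfl, if_pos rfl, ell] at this
    have h2 : ∀ x, R * ((p j).eval x^2 + (p k).eval x^2)/2 = (R/2) * (p j * p j + p k * p k).eval x := by
      intro x; simp only [eval_add, eval_mul]; ring
    simp_rw [h2]
    rw [integral_const_mul, this]; ring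
  rw [← e]
  refine (abs_integral_le_integral_abs).trans ?_
  apply integral_mono_ae (o.int _).abs
  · have := ((o.int (p j * p j)).add (o.int (p k * p k))).const_mul (R/2)
    refine this.congr (ae_of_all _ fun x => ?_)
    simp only [Pi.add_apply, eval_mul]; ring
  · filter_upwards [o.ae_R] with x hx
    simp only [eval_mul, eval_X, abs_mul]
    have h1 : |(p j).eval x| * |(p k).eval x| ≤ ((p j).eval x^2 + (p k).eval x^2)/2 := by
      rw [← sq_abs ((p j).eval x), ← sq_abs ((p k).eval x)]
      nlinarith [sq_nonneg (|(p j).eval x| - |(p k).eval x|)]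
    have := mul_le_mul hx h1 (by positivity) ((abs_nonneg _).trans hx)
    rw [mul_assoc]; linarith

lemma OP.coef (o : OP μ a b p R) (k : ℕ) : |b (k+1)| ≤ R ∧ a (k+1) ≤ R :=
  ⟨by rw [← o.ell_b]; exact o.ell_le _ _, by
    rw [← o.ell_a]; exact (le_abs_self _).trans (o.ell_le _ _)⟩

lemma OP.ell_AB (o : OP μ a b p R) (m : ℕ) : ell μ (Ap a p m ^ 2 + p m ^ 2) = a (m+1)^2 + 1 := by
  rw [o.ell_add, Ap, show (C (a (m+1)) * p (m+1))^2 = C (a (m+1)) * (C (a (m+1)) * (p (m+1) * p (m+1))) by ring, ell_C, ell_C, sq (p m), o.ell_pp, o.ell_pp]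
  simp; ring

lemma OP.ell_D (o : OP μ a b p R) (m : ℕ) : ell μ (Dp a p m) = 1 := by
  rw [Dp, o.ell_sub, o.ell_AB, Ap, show X * (C (a (m+1)) * p (m+1)) * p m = C (a (m+1)) * (X * p (m+1) * p m) by ring, ell_C, o.ell_a]
  ring

lemma kl_le [IsProbabilityMeasure μ] (o : OP μ a b p R) (hK : KLdiv SCm μ ≠ ⊤) (m : ℕ) :
    ∫ x, Real.log ((Dp a p m).eval x) ∂SCm ≤ (KLdiv SCm μ).toReal + ∫ x in Icc (-2) 2, (Dp a p m).eval x ∂μ - 1 := by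
  have hc : SCm ≪ μ ∧ Integrable (llr SCm μ) SCm := by
    by_contra h; exact hK (by rw [KLdiv, if_neg h])
  have hKv : ∫ x, llr SCm μ x ∂SCm ≤ (KLdiv SCm μ).toReal := by
    rw [KLdiv, if_pos hc]
    exact ENNReal.ofReal_le_iff_le_toReal (ENNReal.ofReal_ne_top) |>.1 le_rfl
  obtain ⟨hac, hint⟩ := hc
  set D := fun x => (Dp a p m).eval x with hD
  set ρ := fun x => (SCm.rnDeriv μ x).toReal with hρ
  set I := Icc (-2:ℝ) 2 with hI
  have hD0 : ∀ x ∈ I, 0 ≤ D x := by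
    intro x hx
    simp only [hD, Dp, eval_sub, eval_add, eval_mul, eval_pow, eval_X]
    set A := (Ap a p m).eval x
    set B := (p m).eval x
    nlinarith [mul_nonneg (show 0 ≤ 2 - x by linarith [hx.2]) (sq_nonneg (A+B)), mul_nonneg (show 0 ≤ 2 + x by linarith [hx.1]) (sq_nonneg (A-B))]
  set f := fun x => I.indicator D x / ρ x with hf
  have hind0 : ∀ x, 0 ≤ I.indicator D x := fun x => indicator_nonneg hD0 x
  have hρ0 : ∀ x, 0 ≤ ρ x := fun x => ENNReal.toReal_nonneg
  have hle : ∀ x, ρ x • f x ≤ I.indicator D x := by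
    intro x
    simp only [hf, smul_eq_mul]
    rcases eq_or_ne (ρ x) 0 with h | h
    · rw [h, zero_mul]; exact hind0 x
    · rw [mul_div_cancel₀ _ h]
  have h0 : ∀ x, 0 ≤ ρ x • f x := fun x => mul_nonneg (hρ0 x) (div_nonneg (hind0 x) (hρ0 x))
  have hDi : Integrable (I.indicator D) μ := (o.int _).indicator measurableSet_Icc
  have hρm : Measurable ρ := (Measure.measurable_rnDeriv _ _).ennreal_toReal
  have hfm : Measurable f := (((Dp a p m).continuous.measurable).indicator measurableSet_Icc).div hρm
  have hfi : Integrable (fun x => ρ x • f x) μ := by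
    refine hDi.mono' (hρm.smul hfm).aestronglyMeasurable (ae_of_all _ fun x => ?_)
    rw [Real.norm_of_nonneg (h0 x)]; exact hle x
  have hfS : Integrable f SCm := (integrable_rnDeriv_smul_iff hac).1 hfi
  have e1 : ∫ x, f x ∂SCm ≤ ∫ x in I, D x ∂μ := by
    rw [← integral_rnDeriv_smul hac, ← integral_indicator measurableSet_Icc]
    exact integral_mono hfi hDi hle
  have haeS : ∀ᵐ x ∂SCm, x ∈ Ioo (-2:ℝ) 2 := by rw [ae_iff]; exact SC_compl
  obtain ⟨i2, -⟩ := o.log_D m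
  have e2 : ∫ x, (Real.log (D x) - llr SCm μ x) ∂SCm ≤ ∫ x, (f x - 1) ∂SCm := by
    apply integral_mono_ae (i2.sub hint) (hfS.sub (integrable_const 1))
    filter_upwards [haeS, Measure.rnDeriv_pos hac, hac.ae_le (Measure.rnDeriv_ne_top SCm μ)] with x hx h1 h2
    have hDp : 0 < D x := o.D_pos m hx
    have hρp : 0 < ρ x := ENNReal.toReal_pos h1.ne' h2
    show Real.log (D x) - Real.log (ρ x) ≤ f x - 1
    rw [← Real.log_div hDp.ne' hρp.ne']
    have : f x = D x / ρ x := by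
      simp only [hf]; rw [indicator_of_mem (Ioo_subset_Icc_self hx)]
    rw [this]
    exact Real.log_le_sub_one_of_pos (div_pos hDp hρp)
  rw [integral_sub i2 hint, integral_sub hfS (integrable_const 1)] at e2
  have e3 : ∫ _x : ℝ, (1:ℝ) ∂SCm = 1 := by simp
  rw [e3] at e2
  linarith

def hout (x : ℝ) : ℝ := max (|x|/2 - 1) 0

lemma hout_int [IsProbabilityMeasure μ] (o : OP μ a b p R) (q : ℝ[X]) : Integrable (fun x => hout x * q.eval x) μ :=
  poly_int o.supp _ (by unfold hout; fun_prop)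

lemma kl_le2 [IsProbabilityMeasure μ] (o : OP μ a b p R) (hK : KLdiv SCm μ ≠ ⊤) (m : ℕ) :
    ∫ x, Real.log ((Dp a p m).eval x) ∂SCm ≤ (KLdiv SCm μ).toReal + ∫ x, hout x * (Ap a p m ^ 2 + p m ^ 2).eval x ∂μ := by
  refine (kl_le o hK m).trans ?_
  have h1 : ∫ x in Icc (-2) 2, (Dp a p m).eval x ∂μ - 1 = - ∫ x in (Icc (-2) 2)ᶜ, (Dp a p m).eval x ∂μ := by
    have := integral_add_compl (measurableSet_Icc (a := (-2:ℝ)) (b := 2)) (o.int (Dp a p m))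
    have h2 := o.ell_D m
    rw [ell] at h2
    linarith
  have h2 : - ∫ x in (Icc (-2) 2)ᶜ, (Dp a p m).eval x ∂μ ≤ ∫ x, hout x * (Ap a p m ^ 2 + p m ^ 2).eval x ∂μ := by
    rw [← integral_neg, ← integral_indicator measurableSet_Icc.compl]
    apply integral_mono ((o.int _).neg.indicator measurableSet_Icc.compl) (hout_int o _)
    intro x
    have hq : 0 ≤ (Ap a p m ^ 2 + p m ^ 2).eval x := by simp only [eval_add, eval_pow]; positivity
    by_cases hx : x ∈ (Icc (-2:ℝ) 2)ᶜ
    · rw [indicator_of_mem hx]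
      refine le_trans ?_ (mul_le_mul_of_nonneg_right (le_max_left _ _) hq)
      simp only [Pi.neg_apply, Dp, eval_sub, eval_add, eval_mul, eval_pow, eval_X]
      set A := (Ap a p m).eval x
      set B := (p m).eval x
      have k1 : x * A * B ≤ |x| * ((A^2+B^2)/2) := by
        calc x * A * B ≤ |x * (A * B)| := by rw [mul_assoc]; exact le_abs_self _
          _ = |x| * |A * B| := abs_mul _ _
          _ ≤ _ := by
            gcongr
            rw [abs_le]; constructor <;> nlinarith [sq_nonneg (A+B), sq_nonneg (A-B)]
      linarith
    · rw [indicator_of_notMem hx]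
      exact mul_nonneg (le_max_right _ _) hq
  linarith

lemma int_crude [IsProbabilityMeasure μ] (o : OP μ a b p R) (hK : KLdiv SCm μ ≠ ⊤) (m : ℕ) :
    ∫ x, Real.log ((Dp a p m).eval x) ∂SCm ≤ (KLdiv SCm μ).toReal + R * (R^2+1) := by
  refine (kl_le2 o hK m).trans ?_
  gcongr
  have h1 : ∫ x, hout x * (Ap a p m ^ 2 + p m ^ 2).eval x ∂μ ≤ ∫ x, R * (Ap a p m ^ 2 + p m ^ 2).eval x ∂μ := by
    apply integral_mono_ae (hout_int o _) ((o.int _).const_mul R)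
    filter_upwards [o.ae_R] with x hx
    have hq : 0 ≤ (Ap a p m ^ 2 + p m ^ 2).eval x := by simp only [eval_add, eval_pow]; positivity
    apply mul_le_mul_of_nonneg_right _ hq
    exact max_le (by linarith [abs_nonneg x]) (by linarith [o.R2])
  rw [integral_const_mul] at h1
  have h2 := o.ell_AB m
  rw [ell] at h2
  rw [h2] at h1
  refine h1.trans ?_
  have := (o.coef m).2
  have ha := o.a_pos m
  have := o.R2
  gcongr

lemma bessel [IsProbabilityMeasure μ] (o : OP μ a b p R) (e : ℝ) :
    Tendsto (fun m => μ.real {e} * (p m).eval e^2) atTop (𝓝 0) := by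
  rcases eq_or_ne (μ.real {e}) 0 with h0 | h0
  · simp [h0]
  have hpos : 0 < μ.real {e} := lt_of_le_of_ne measureReal_nonneg (Ne.symm h0)
  have hb : ∀ n, ∑ k ∈ Finset.range n, (p k).eval e^2 ≤ (μ.real {e})⁻¹ := by
    intro n
    set K := ∑ k ∈ Finset.range n, (p k).eval e^2 with hKdef
    set q : ℝ[X] := ∑ k ∈ Finset.range n, C ((p k).eval e) * p k with hq
    have hqe : q.eval e = K := by
      rw [hq, eval_finsetSum]; exact Finset.sum_congr rfl fun k _ => by simp [sq]
    have hl : ∀ s : Finset ℕ, ∀ g : ℕ → ℝ[X], ell μ (∑ k ∈ s, g k) = ∑ k ∈ s, ell μ (g k) := by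
      intro s g
      unfold ell
      simp only [eval_finsetSum]
      exact integral_finsetSum _ fun k _ => o.int _
    have e1 : ell μ (q * q) = K := by
      rw [hq, Finset.sum_mul_sum, hl]
      refine Finset.sum_congr rfl fun i hi => ?_
      rw [hl]
      have : ∀ j, ell μ (C ((p i).eval e) * p i * (C ((p j).eval e) * p j)) = if i = j then (p i).eval e^2 else 0 := by
        intro j
        rw [show C ((p i).eval e) * p i * (C ((p j).eval e) * p j) = C ((p i).eval e) * (C ((p j).eval e) * (p i * p j)) by ring, ell_C, ell_C, o.ell_pp]
        split_ifs with hij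
        · rw [hij]; ring
        · ring
      simp_rw [this]
      rw [Finset.sum_ite_eq, if_pos hi]
    have e2 : μ.real {e} * K^2 ≤ ell μ (q*q) := by
      have := setIntegral_le_integral (s := {e}) (o.int (q*q)) (ae_of_all _ fun x => by simp only [eval_mul]; exact mul_self_nonneg _)
      rw [integral_singleton, eval_mul, hqe, smul_eq_mul, ← sq] at this
      exact this
    rw [e1] at e2
    have hK0 : 0 ≤ K := Finset.sum_nonneg fun _ _ => sq_nonneg _
    rw [← one_div, le_div_iff₀ hpos]
    rcases hK0.eq_or_lt with hK0 | hK0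
    · rw [← hK0]; simp
    · nlinarith
  have hs : Summable fun k => (p k).eval e^2 := summable_of_sum_range_le (fun _ => sq_nonneg _) hb
  simpa using hs.tendsto_atTop_zero.const_mul (μ.real {e})

lemma int_ref [IsProbabilityMeasure μ] (o : OP μ a b p R) (hK : KLdiv SCm μ ≠ ⊤)
    (hfin : ∀ ε > 0, {x | x ∈ suppSet μ ∧ 2 + ε < |x|}.Finite) {η : ℝ} (hη : 0 < η) :
    ∀ᶠ m in atTop, ∫ x, Real.log ((Dp a p m).eval x) ∂SCm ≤ (KLdiv SCm μ).toReal + η := by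
  have hR := o.R2
  set ε := η / (R^2+1) with hε
  have hε0 : 0 < ε := by positivity
  set V := (hfin ε hε0).toFinset with hV
  have hsupp : ∀ᵐ x ∂μ, x ∈ suppSet μ := by
    rw [ae_iff]
    by_contra hne
    obtain ⟨x, hx, hx2⟩ := exists_mem_forall_mem_nhdsWithin_pos_measure hne
    exact hx fun U hU => (hx2 U (mem_nhdsWithin_of_mem_nhds hU)).ne'
  have hlim : Tendsto (fun m => R * ∑ e ∈ V, (R^2 * (μ.real {e} * (p (m+1)).eval e^2) + μ.real {e} * (p m).eval e^2)) atTop (𝓝 0) := by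
    have : Tendsto (fun m => R * ∑ e ∈ V, (R^2 * (μ.real {e} * (p (m+1)).eval e^2) + μ.real {e} * (p m).eval e^2)) atTop
        (𝓝 (R * ∑ e ∈ V, (R^2 * 0 + 0))) := by
      apply Tendsto.const_mul
      apply tendsto_finsetSum
      intro e _
      exact (((bessel o e).comp (tendsto_add_atTop_nat 1)).const_mul _).add (bessel o e)
    simpa using this
  filter_upwards [hlim.eventually_lt_const (show (0:ℝ) < η/2 by positivity)] with m hm
  refine (kl_le2 o hK m).trans ?_
  gcongr
  set q := Ap a p m ^ 2 + p m ^ 2 with hq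
  have hq0 : ∀ x, 0 ≤ q.eval x := fun x => by simp only [hq, eval_add, eval_pow]; positivity
  have hVm : MeasurableSet (V : Set ℝ) := V.measurableSet
  have h1 : ∫ x, hout x * q.eval x ∂μ ≤ ∫ x, (ε/2 * q.eval x + R * (V:Set ℝ).indicator (fun x => q.eval x) x) ∂μ := by
    apply integral_mono_ae (hout_int o _) (((o.int _).const_mul _).add (((o.int _).indicator hVm).const_mul _))
    filter_upwards [o.ae_R, hsupp] with x hx hxs
    show hout x * q.eval x ≤ ε/2 * q.eval x + R * (V:Set ℝ).indicator (fun x => q.eval x) x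
    by_cases hv : 2 + ε < |x|
    · have : x ∈ (V:Set ℝ) := by simp [hV]; exact ⟨hxs, hv⟩
      rw [indicator_of_mem this]
      have : hout x ≤ R := max_le (by linarith [abs_nonneg x]) (by linarith [o.R2])
      nlinarith [mul_le_mul_of_nonneg_right this (hq0 x), mul_nonneg hε0.le (hq0 x)]
    · have h3 : hout x ≤ ε/2 := max_le (by linarith) (by positivity)
      have h4 : 0 ≤ (V:Set ℝ).indicator (fun x => q.eval x) x := indicator_nonneg (fun x _ => hq0 x) x
      nlinarith [mul_le_mul_of_nonneg_right h3 (hq0 x), mul_nonneg (show 0 ≤ R by linarith) h4]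
  rw [integral_add ((o.int _).const_mul _) (((o.int _).indicator hVm).const_mul _), integral_const_mul, integral_const_mul,
    integral_indicator hVm, setIntegral_finset _ (o.int q).integrableOn] at h1
  have h2 := o.ell_AB m
  rw [ell] at h2
  rw [h2] at h1
  have ha : a (m+1)^2 ≤ R^2 := by have := (o.coef m).2; have := o.a_pos m; gcongr
  have h5 : ∑ e ∈ V, μ.real {e} • q.eval e ≤ ∑ e ∈ V, (R^2 * (μ.real {e} * (p (m+1)).eval e^2) + μ.real {e} * (p m).eval e^2) := by
    refine Finset.sum_le_sum fun e _ => ?_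
    simp only [hq, Ap, smul_eq_mul, eval_add, eval_pow, eval_mul, eval_C]
    have : 0 ≤ μ.real {e} * (p (m+1)).eval e^2 := by positivity
    nlinarith [mul_le_mul_of_nonneg_right ha this]
  have h6 := mul_le_mul_of_nonneg_left h5 (show 0 ≤ R by linarith)
  have h7 : ε/2 * (a (m+1)^2+1) ≤ η/2 := by
    calc ε/2 * (a (m+1)^2+1) ≤ ε/2 * (R^2+1) := by gcongr
      _ = η/2 := by rw [hε]; field_simp
  linarith

end SumRules
end

section
namespace SumRules
variable {a b : ℕ → ℝ} {p : ℕ → ℝ[X]} {μ : Measure ℝ} {R : ℝ}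

lemma supp_mem {J : Set ℝ} (hJ : IsOpen J) (h : μ J ≠ 0) : ∃ s ∈ J, s ∈ suppSet μ := by
  obtain ⟨x, hx, hx2⟩ := exists_mem_forall_mem_nhdsWithin_pos_measure h
  exact ⟨x, hx, fun U hU => (hx2 U (mem_nhdsWithin_of_mem_nhds hU)).ne'⟩

lemma no_sign (o : OP μ a b p R) (n : ℕ) (w r : ℝ[X]) (hp : p n = w * r) (hr : r.degree < n)
    (hw : ∀ᵐ x ∂μ, 0 ≤ w.eval x) : False := by
  have h1 := o.orth o.int o.ho n n le_rfl r hr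
  have e1 : ∀ x, r.eval x * (p n).eval x = (w * r * r).eval x := by
    intro x; rw [hp]; simp only [eval_mul]; ring
  simp_rw [e1] at h1
  have h0 : 0 ≤ᵐ[μ] fun x => (w * r * r).eval x := by
    filter_upwards [hw] with x hx
    simp only [eval_mul, mul_assoc]
    exact mul_nonneg hx (mul_self_nonneg _)
  rw [integral_eq_zero_iff_of_nonneg_ae h0 (o.int _)] at h1
  have h2 := o.ho n n
  rw [if_pos rfl] at h2
  have h3 : (fun x => (p n).eval x * (p n).eval x) =ᵐ[μ] 0 := by
    filter_upwards [h1] with x hx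
    have hx' : (w * r * r).eval x = 0 := hx
    show (p n).eval x * (p n).eval x = 0
    rw [hp]; simp only [eval_mul] at hx' ⊢
    linear_combination w.eval x * hx'
  rw [integral_congr_ae h3] at h2
  simp at h2

lemma ae_of_null {J : Set ℝ} (h : μ J = 0) : ∀ᵐ x ∂μ, x ∉ J := by
  rw [ae_iff]; simpa using h

lemma supp_gap (o : OP μ a b p R) (m : ℕ) {y : ℝ} (hy : (Ap a p m).eval y = 0) :
    ∃ s ∈ suppSet μ, y < s ∧ ∀ y', (Ap a p m).eval y' = 0 → y < y' → s < y' := by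
  have ha := o.a_pos m
  have hz : ∀ x, (Ap a p m).eval x = 0 ↔ (p (m+1)).eval x = 0 := by
    intro x; rw [Ap, eval_mul, eval_C]; simp [ha.ne']
  simp_rw [hz] at hy ⊢
  have hne := o.p_ne (m+1)
  obtain ⟨r, hr⟩ := dvd_iff_isRoot.2 hy
  have hr0 : r ≠ 0 := by rintro rfl; exact hne (by rw [hr, mul_zero])
  have hrd : r.natDegree = m := by
    have := o.deg (m+1)
    rw [hr, natDegree_mul (X_sub_C_ne_zero _) hr0, natDegree_X_sub_C] at this
    omega
  set Z := (p (m+1)).roots.toFinset.filter (fun x => y < x) with hZ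
  have hmem : ∀ x, x ∈ Z ↔ (p (m+1)).eval x = 0 ∧ y < x := by
    intro x; simp [hZ, hne]
  rcases Z.eq_empty_or_nonempty with hE | hE
  · have : μ (Ioi y) ≠ 0 := by
      intro h0
      refine no_sign o (m+1) (-(X - C y)) (-r) (by rw [hr]; ring) ?_ ?_
      · rw [degree_neg]
        exact (degree_le_natDegree).trans_lt (by rw [hrd]; exact_mod_cast Nat.lt_succ_self m)
      · filter_upwards [ae_of_null h0] with x hx
        simp only [mem_Ioi, not_lt] at hx
        simp only [eval_neg, eval_sub, eval_X, eval_C]; linarith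
    obtain ⟨s, h1, h2⟩ := supp_mem isOpen_Ioi this
    refine ⟨s, h2, h1, fun y' h3 h4 => ?_⟩
    have := (hmem y').2 ⟨h3, h4⟩
    rw [hE] at this; simp at this
  · set y2 := Z.min' hE with hy2
    obtain ⟨h3, h4⟩ := (hmem y2).1 (Z.min'_mem hE)
    have h5 : r.eval y2 = 0 := by
      rw [hr, eval_mul, eval_sub, eval_X, eval_C] at h3
      exact (mul_eq_zero.1 h3).resolve_left (by linarith)
    obtain ⟨r2, hr2⟩ := dvd_iff_isRoot.2 h5
    have hr20 : r2 ≠ 0 := by rintro rfl; exact hr0 (by rw [hr2, mul_zero])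
    have hrd2 : r2.natDegree + 1 = m := by
      rw [hr2, natDegree_mul (X_sub_C_ne_zero _) hr20, natDegree_X_sub_C] at hrd
      omega
    have : μ (Ioo y y2) ≠ 0 := by
      intro h0
      refine no_sign o (m+1) ((X - C y) * (X - C y2)) r2 (by rw [hr, hr2]; ring) ?_ ?_
      · exact (degree_le_natDegree).trans_lt (by exact_mod_cast (by omega : r2.natDegree < m + 1))
      · filter_upwards [ae_of_null h0] with x hx
        simp only [eval_mul, eval_sub, eval_X, eval_C]
        by_cases hxy : y < x
        · have : y2 ≤ x := by by_contra hc; exact hx ⟨hxy, not_le.1 hc⟩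
          exact mul_nonneg (by linarith) (by linarith)
        · exact mul_nonneg_of_nonpos_of_nonpos (by linarith) (by linarith)
    obtain ⟨s, h1, h2⟩ := supp_mem isOpen_Ioo this
    refine ⟨s, h2, h1.1, fun y' h3 h4 => ?_⟩
    exact h1.2.trans_le (Z.min'_le _ ((hmem y').2 ⟨h3, h4⟩))

lemma ratio_deriv (h : Rec a b p) (m : ℕ) {x : ℝ} (hx : (Ap a p m).eval x ≠ 0) :
    HasDerivAt (fun x => (p m).eval x / (Ap a p m).eval x) (-((Rec.Kp p m).eval x / (Ap a p m).eval x^2)) x := by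
  have := ((p m).hasDerivAt x).div ((Ap a p m).hasDerivAt x) hx
  refine this.congr_deriv ?_
  have h2 := congrArg (eval x) (h.cd_deriv m)
  rw [← Rec.Kp] at h2
  rw [← h2]; simp only [eval_sub, eval_mul]; ring

lemma ratio_deriv2 (h : Rec a b p) (m : ℕ) {x : ℝ} (hx : (p m).eval x ≠ 0) :
    HasDerivAt (fun x => (Ap a p m).eval x / (p m).eval x) ((Rec.Kp p m).eval x / (p m).eval x^2) x := by
  have := ((Ap a p m).hasDerivAt x).div ((p m).hasDerivAt x) hx
  refine this.congr_deriv ?_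
  have h2 := congrArg (eval x) (h.cd_deriv m)
  rw [← Rec.Kp] at h2
  rw [← h2]; simp only [eval_sub, eval_mul]

lemma ratio_anti (h : Rec a b p) (m : ℕ) {u v : ℝ} (hA : ∀ x ∈ Icc u v, (Ap a p m).eval x ≠ 0) :
    StrictAntiOn (fun x => (p m).eval x / (Ap a p m).eval x) (Icc u v) := by
  apply strictAntiOn_of_deriv_neg (convex_Icc u v)
  · intro x hx
    exact (ratio_deriv h m (hA x hx)).continuousAt.continuousWithinAt
  · intro x hx
    rw [interior_Icc] at hx
    have hx' := hA x (Ioo_subset_Icc_self hx)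
    rw [(ratio_deriv h m hx').deriv]
    have := h.Kp_ge m x
    have : 0 < (Ap a p m).eval x ^2 := by positivity
    rw [neg_lt_zero]; positivity

/-- the set of outliers above `2` -/
def Tp (a : ℕ → ℝ) (p : ℕ → ℝ[X]) (m : ℕ) : Finset ℝ :=
  ((Rec.Zs a p m).filter (fun z => 0 < z)).image (fun z => z + z⁻¹)

lemma E_lt {z z' : ℝ} (h0 : 0 < z) (h : z < z') (h1 : z' ≤ 1) : z' + z'⁻¹ < z + z⁻¹ := by
  have h2 : 0 < z' := h0.trans h
  have : z + z⁻¹ - (z' + z'⁻¹) = (z' - z) * (1 - z*z') / (z*z') := by field_simp; ring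
  have h3 : z * z' < 1 := by nlinarith
  have : 0 < (z' - z) * (1 - z*z') / (z*z') := by
    apply div_pos (mul_pos (by linarith) (by linarith)); positivity
  linarith

lemma E_inj : Set.InjOn (fun z : ℝ => z + z⁻¹) {z | 0 < z ∧ z ≤ 1} := by
  intro z hz z' hz' he
  rcases lt_trichotomy z z' with h | h | h
  · have := E_lt hz.1 h hz'.2; simp only at he; linarith
  · exact h
  · have := E_lt hz'.1 h hz.2; simp only at he; linarith

lemma mem_Tp (h : Rec a b p) (m : ℕ) {E : ℝ} (hE : E ∈ Tp a p m) : ∃ z, z ∈ Rec.Zs a p m ∧ 0 < z ∧ z ≤ 1 ∧ E = z + z⁻¹ ∧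
    (Ap a p m).eval E = z * (p m).eval E ∧ (p m).eval E ≠ 0 ∧ 2 ≤ E := by
  simp only [Tp, Finset.mem_image, Finset.mem_filter] at hE
  obtain ⟨z, ⟨hz, h0⟩, rfl⟩ := hE
  obtain ⟨h1, h2, h3⟩ := (h.mem_Zs m z).1 hz
  refine ⟨z, hz, h0, (le_abs_self z).trans h2, rfl, h3, h.B_ne m hz, ?_⟩
  have := abs_E h1
  rwa [abs_of_pos (by positivity)] at this

lemma sum_Tp (h : Rec a b p) (m : ℕ) : ∑ z ∈ (Rec.Zs a p m).filter (fun z => 0 < z), Fz z = ∑ E ∈ Tp a p m, Fx E := by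
  rw [Tp, Finset.sum_image]
  · refine Finset.sum_congr rfl fun z hz => ?_
    obtain ⟨h1, h2, h3⟩ := (h.mem_Zs m z).1 (Finset.mem_filter.1 hz).1
    exact (Fx_z h1 h2).symm
  · intro z hz z' hz' he
    have k : ∀ z ∈ (Rec.Zs a p m).filter (fun z => 0 < z), 0 < z ∧ z ≤ 1 := fun z hz =>
      ⟨(Finset.mem_filter.1 hz).2, (le_abs_self z).trans ((h.mem_Zs m z).1 (Finset.mem_filter.1 hz).1).2.1⟩
    exact E_inj (k z hz) (k z' hz') he

lemma zero_between (h : Rec a b p) (m : ℕ) {E E' : ℝ} (hE : E ∈ Tp a p m) (hE' : E' ∈ Tp a p m) (hlt : E' < E) :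
    ∃ y, E' ≤ y ∧ y < E ∧ (Ap a p m).eval y = 0 := by
  obtain ⟨z, -, z0, z1, rfl, hA, hB, -⟩ := mem_Tp h m hE
  obtain ⟨z', -, z0', z1', rfl, hA', hB', -⟩ := mem_Tp h m hE'
  by_contra hcon
  push Not at hcon
  have hA0 : (Ap a p m).eval (z + z⁻¹) ≠ 0 := by rw [hA]; exact mul_ne_zero z0.ne' hB
  have := ratio_anti h m (u := z' + z'⁻¹) (v := z + z⁻¹) (fun x hx => by
    rcases hx.2.eq_or_lt with h1 | h1
    · rw [h1]; exact hA0
    · exact hcon x hx.1 h1) (left_mem_Icc.2 hlt.le) (right_mem_Icc.2 hlt.le) hlt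
  simp only [hA, hA'] at this
  rw [mul_comm z, mul_comm z', div_mul_cancel_left₀ hB, div_mul_cancel_left₀ hB'] at this
  have h2 := (inv_lt_inv₀ z0 z0').1 this
  exact absurd (E_lt z0' h2 z1) (by linarith)

lemma zero_near (h : Rec a b p) (m : ℕ) {E δ : ℝ} (hE : E ∈ Tp a p m) (hδ : 0 < δ)
    (hK : ∀ x, E - δ ≤ x → |(Ap a p m).eval x| ≤ |(p m).eval x| → (p m).eval x^2 ≤ δ * (Rec.Kp p m).eval x) :
    ∃ y, E - δ ≤ y ∧ y < E ∧ (Ap a p m).eval y = 0 := by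
  obtain ⟨z, -, z0, z1, hz, hA, hB, -⟩ := mem_Tp h m hE
  by_contra hcon
  push Not at hcon
  have hA0 : (Ap a p m).eval E ≠ 0 := by rw [hA]; exact mul_ne_zero z0.ne' hB
  have hne : ∀ x ∈ Icc (E - δ) E, (Ap a p m).eval x ≠ 0 := fun x hx => by
    rcases hx.2.eq_or_lt with h1 | h1
    · rw [h1]; exact hA0
    · exact hcon x hx.1 h1
  have hanti := ratio_anti h m hne
  have hge : ∀ x ∈ Icc (E - δ) E, 1 ≤ (p m).eval x / (Ap a p m).eval x := by
    intro x hx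
    have := hanti.antitoneOn hx (right_mem_Icc.2 (by linarith)) hx.2
    simp only [hA] at this
    rw [mul_comm z, div_mul_cancel_left₀ hB] at this
    exact ((one_le_inv₀ z0).2 z1).trans this
  have hBne : ∀ x ∈ Icc (E - δ) E, (p m).eval x ≠ 0 := by
    intro x hx h0
    have := hge x hx
    rw [h0, zero_div] at this; linarith
  have hle : ∀ x ∈ Icc (E - δ) E, |(Ap a p m).eval x| ≤ |(p m).eval x| := by
    intro x hx
    have h1 : 1 ≤ |(p m).eval x / (Ap a p m).eval x| := (hge x hx).trans (le_abs_self _)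
    rwa [abs_div, one_le_div (abs_pos.2 (hne x hx))] at h1
  obtain ⟨c, hc, hc2⟩ := exists_hasDerivAt_eq_slope (fun x => (Ap a p m).eval x / (p m).eval x)
    (fun x => (Rec.Kp p m).eval x / (p m).eval x^2) (show E - δ < E by linarith)
    (fun x hx => (ratio_deriv2 h m (hBne x hx)).continuousAt.continuousWithinAt)
    (fun x hx => ratio_deriv2 h m (hBne x (Ioo_subset_Icc_self hx)))
  have hc' := Ioo_subset_Icc_self hc
  have e1 : 1 ≤ δ * ((Rec.Kp p m).eval c / (p m).eval c^2) := by
    rw [← mul_div_assoc, one_le_div (by have := hBne c hc'; positivity)]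
    exact hK c hc'.1 (hle c hc')
  have e2 : 0 < (Ap a p m).eval (E-δ) / (p m).eval (E-δ) := by
    have := hge (E-δ) (left_mem_Icc.2 (by linarith))
    rw [← inv_div]; exact inv_pos.2 (by linarith)
  have e3 : (Ap a p m).eval E / (p m).eval E = z := by rw [hA, mul_div_cancel_right₀ _ hB]
  simp only [e3] at hc2
  rw [hc2, show E - (E - δ) = δ by ring, mul_div_cancel₀ _ hδ.ne'] at e1
  linarith

lemma pos_data (o : OP μ a b p R) (m : ℕ) : ∃ f : ℝ → ℝ, (∀ E ∈ Tp a p m,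
    (2 < f E → f E ∈ suppSet μ) ∧
    (∀ E' ∈ Tp a p m, E' < E → E' ≤ f E ∧ f E' < f E) ∧
    (∀ δ > 0, (∀ x, E - δ ≤ x → |(Ap a p m).eval x| ≤ |(p m).eval x| → (p m).eval x^2 ≤ δ * (Rec.Kp p m).eval x) →
      E - δ ≤ f E)) := by
  have hAne := o.Ap_ne m
  have key : ∀ E : ℝ, ∃ v : ℝ, (∃ y, (Ap a p m).eval y = 0 ∧ y < E ∧ (∀ y', (Ap a p m).eval y' = 0 → y' < E → y' ≤ y) ∧
      v ∈ suppSet μ ∧ y < v ∧ (∀ y', (Ap a p m).eval y' = 0 → y < y' → v < y')) ∨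
      ((∀ y', (Ap a p m).eval y' = 0 → ¬ y' < E) ∧ v = 0) := by
    intro E
    set Z := (Ap a p m).roots.toFinset.filter (fun x => x < E) with hZ
    have hmem : ∀ x, x ∈ Z ↔ (Ap a p m).eval x = 0 ∧ x < E := by
      intro x; simp [hZ, hAne]
    rcases Z.eq_empty_or_nonempty with hE | hE
    · refine ⟨0, Or.inr ⟨fun y' h1 h2 => ?_, rfl⟩⟩
      have := (hmem y').2 ⟨h1, h2⟩
      rw [hE] at this; simp at this
    · obtain ⟨h1, h2⟩ := (hmem _).1 (Z.max'_mem hE)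
      obtain ⟨s, s1, s2, s3⟩ := supp_gap o m h1
      exact ⟨s, Or.inl ⟨Z.max' hE, h1, h2, fun y' h3 h4 => Z.le_max' _ ((hmem y').2 ⟨h3, h4⟩), s1, s2, s3⟩⟩
  choose f hf using key
  refine ⟨f, fun E hE => ⟨?_, ?_, ?_⟩⟩
  · intro h2
    rcases hf E with ⟨y, h⟩ | ⟨-, h⟩
    · exact h.2.2.2.1
    · rw [h] at h2; linarith
  · intro E' hE' hlt
    obtain ⟨y0, k1, k2, k3⟩ := zero_between o.toRec m hE hE' hlt
    rcases hf E with ⟨y, h1, h2, h3, h4, h5, h6⟩ | ⟨h, -⟩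
    · have h7 := h3 y0 k3 k2
      refine ⟨by linarith, ?_⟩
      rcases hf E' with ⟨y', g1, g2, g3, g4, g5, g6⟩ | ⟨-, h⟩
      · have := g6 y0 k3 (by linarith); linarith
      · obtain ⟨-, -, -, -, -, -, -, hh⟩ := mem_Tp o.toRec m hE'
        rw [h]; linarith
    · exact absurd k2 (h y0 k3)
  · intro δ hδ hK
    obtain ⟨y0, k1, k2, k3⟩ := zero_near o.toRec m hE hδ hK
    rcases hf E with ⟨y, h1, h2, h3, h4, h5, h6⟩ | ⟨h, -⟩
    · have h7 := h3 y0 k3 k2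
      linarith
    · exact absurd k2 (h y0 k3)

lemma tele (G f : ℝ → ℝ) (hG : Monotone G) (hG0 : ∀ x, 0 ≤ G x) (T : Finset ℝ) :
    (∀ E ∈ T, ∀ E' ∈ T, E' < E → E' ≤ f E) → ∀ t, (∀ E ∈ T, E ≤ t) → ∑ E ∈ T, G E ≤ G t + ∑ E ∈ T, G (f E) := by
  induction T using Finset.induction_on_max with
  | empty => intro _ t _; simpa using hG0 t
  | insert M T hM ih =>
    intro hf t ht
    have hn : M ∉ T := fun h => lt_irrefl _ (hM M h)
    rw [Finset.sum_insert hn, Finset.sum_insert hn]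
    have h1 := ih (fun E hE E' hE' => hf E (Finset.mem_insert_of_mem hE) E' (Finset.mem_insert_of_mem hE')) (f M)
      (fun E hE => hf M (Finset.mem_insert_self _ _) E (Finset.mem_insert_of_mem hE) (hM E hE))
    have h2 := hG (ht M (Finset.mem_insert_self _ _))
    linarith

end SumRules
end

section
namespace SumRules
variable {a b : ℕ → ℝ} {p : ℕ → ℝ[X]} {μ : Measure ℝ} {R : ℝ}

lemma Fx_lip {T x y : ℝ} (hx : 2 ≤ x) (hxy : x ≤ y) (hy : y ≤ T) : Fx y - Fx x ≤ T * (y - x) := by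
  apply (convex_Icc x y).image_sub_le_mul_sub_of_deriv_le (f := Fx) (C := T) _ _ _ x (left_mem_Icc.2 hxy) y (right_mem_Icc.2 hxy) hxy
  · intro u hu
    exact (Fx_cont (by have := hu.1; intro h; linarith)).continuousWithinAt
  · intro u hu
    rw [interior_Icc] at hu
    exact (Fx_deriv (by linarith [hu.1])).differentiableAt.differentiableWithinAt
  · intro u hu
    rw [interior_Icc] at hu
    rw [(Fx_deriv (by linarith [hu.1])).deriv]
    have : √(u^2-4) ≤ u := by
      rw [Real.sqrt_le_left (by linarith [hu.1])]; linarith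
    linarith [hu.2]

lemma Fx_pos {x : ℝ} (hx : 2 < x) : 0 < Fx x := by
  have h : StrictMonoOn Fx (Ici 2) := by
    apply strictMonoOn_of_deriv_pos (convex_Ici 2)
    · intro x hx
      exact (Fx_cont (by simp at hx; linarith)).continuousWithinAt
    · intro x hx
      rw [interior_Ici] at hx
      rw [(Fx_deriv hx).deriv]
      have : 2 < x := hx
      apply Real.sqrt_pos.2; nlinarith
  have := h (mem_Ici.2 (le_refl (2:ℝ))) (mem_Ici.2 hx.le) hx
  rwa [Fx_two] at this

def Fp (x : ℝ) : ℝ := Fx (max x 2)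

lemma Fp_mono : Monotone Fp := fun _ _ h => Fx_mono (mem_Ici.2 (le_max_right _ _)) (mem_Ici.2 (le_max_right _ _)) (max_le_max_right 2 h)

lemma Fp_nonneg (x : ℝ) : 0 ≤ Fp x := Fx_nonneg ((le_max_right _ _).trans (le_abs_self _))

lemma Fp_zero {x : ℝ} (h : x ≤ 2) : Fp x = 0 := by rw [Fp, max_eq_right h, Fx_two]

lemma Fp_eq {x : ℝ} (h : 2 ≤ x) : Fp x = Fx x := by rw [Fp, max_eq_left h]

lemma Fp_lip {T x y : ℝ} (hx : 2 ≤ x) (hxy : x ≤ y) (hy : y ≤ T) : Fp y ≤ Fp x + T * (y - x) := by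
  rw [Fp_eq hx, Fp_eq (hx.trans hxy)]; linarith [Fx_lip hx hxy hy]

def Sf (T : Finset ℝ) (f : ℝ → ℝ) : Finset ℝ := (T.filter (fun E => 2 < f E)).image f

lemma sum_Sf (T : Finset ℝ) (f H : ℝ → ℝ) (hf : ∀ E ∈ T, ∀ E' ∈ T, E' < E → f E' < f E) (hH : ∀ x ≤ 2, H x = 0) :
    ∑ E ∈ T, H (f E) = ∑ s ∈ Sf T f, H s := by
  rw [Sf, Finset.sum_image, Finset.sum_filter]
  · refine Finset.sum_congr rfl fun E _ => ?_
    split_ifs with h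
    · rfl
    · exact hH _ (not_lt.1 h)
  · intro E hE E' hE' he
    have h1 := (Finset.mem_filter.1 hE).1
    have h2 := (Finset.mem_filter.1 hE').1
    rcases lt_trichotomy E E' with h | h | h
    · exact absurd he (hf E' h2 E h1 h).ne
    · exact h
    · exact absurd he.symm (hf E h1 E' h2 h).ne

lemma Tp_le (o : OP μ a b p R) (m : ℕ) {E : ℝ} (hE : E ∈ Tp a p m) : E ≤ 3*R+1 := by
  obtain ⟨z, hz, -, -, rfl, -⟩ := mem_Tp o.toRec m hE
  exact (le_abs_self _).trans (E_bdd o.toRec (by linarith [o.R2]) o.coef m hz)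

lemma sum_Fp (h : Rec a b p) (m : ℕ) : ∑ z ∈ (Rec.Zs a p m).filter (fun z => 0 < z), Fz z = ∑ E ∈ Tp a p m, Fp E := by
  rw [sum_Tp h]
  refine Finset.sum_congr rfl fun E hE => ?_
  obtain ⟨-, -, -, -, -, -, -, hh⟩ := mem_Tp h m hE
  rw [Fp_eq hh]

lemma pos_crude (o : OP μ a b p R) (m : ℕ) : ∃ S : Finset ℝ, (∀ s ∈ S, s ∈ suppSet μ ∧ 2 < s) ∧
    ∑ z ∈ (Rec.Zs a p m).filter (fun z => 0 < z), Fz z ≤ Fx (3*R+1) + ∑ s ∈ S, Fx s := by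
  obtain ⟨f, hf⟩ := pos_data o m
  have hS : ∀ s ∈ Sf (Tp a p m) f, s ∈ suppSet μ ∧ 2 < s := by
    intro s hs
    simp only [Sf, Finset.mem_image, Finset.mem_filter] at hs
    obtain ⟨E, ⟨h1, h2⟩, rfl⟩ := hs
    exact ⟨(hf E h1).1 h2, h2⟩
  refine ⟨Sf (Tp a p m) f, hS, ?_⟩
  have h1 := tele Fp f Fp_mono Fp_nonneg (Tp a p m) (fun E hE E' hE' h => ((hf E hE).2.1 E' hE' h).1) (3*R+1) (fun E hE => Tp_le o m hE)
  rw [sum_Sf _ f Fp (fun E hE E' hE' h => ((hf E hE).2.1 E' hE' h).2) (fun x hx => Fp_zero hx), Fp_eq (by linarith [o.R2])] at h1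
  rw [sum_Fp o.toRec]
  refine h1.trans_eq ?_
  congr 1
  exact Finset.sum_congr rfl fun s hs => Fp_eq (hS s hs).2.le

lemma G_mono {s t : ℝ} (hs : 1 ≤ s) (hst : s ≤ t) : Gfun s ≤ Gfun t := by
  unfold Gfun
  have hs0 : 0 < s := by linarith
  have ht0 : 0 < t := by linarith
  have := Real.log_le_sub_one_of_pos (div_pos ht0 hs0)
  rw [Real.log_div ht0.ne' hs0.ne'] at this
  have h2 : t / s - 1 ≤ t - s := by
    rw [show t/s - 1 = (t-s)/s by field_simp]
    exact div_le_self (by linarith) hs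
  linarith

lemma coef_lim (h : Rec a b p) (hI : IH a b ≠ ⊤) {ε : ℝ} (hε : 0 < ε) :
    ∃ k0, ∀ k ≥ k0, |b (k+1)| ≤ ε ∧ a (k+1)^2 ≤ 1 + ε := by
  unfold IH at hI
  rw [ENNReal.add_ne_top] at hI
  obtain ⟨h1, h2⟩ := hI
  have h1' : ∑' k, ENNReal.ofReal ((b (k+1))^2) ≠ ⊤ := by
    intro h; rw [h] at h1; simp at h1
  have t1 := ENNReal.tendsto_atTop_zero_of_tsum_ne_top h1'
  have t2 := ENNReal.tendsto_atTop_zero_of_tsum_ne_top h2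
  have g0 : 0 < Gfun (1+ε) := by
    unfold Gfun
    have := Real.log_lt_sub_one_of_pos (show 0 < 1+ε by linarith) (by linarith)
    linarith
  have e1 := t1.eventually_lt_const (show (0:ℝ≥0∞) < ENNReal.ofReal (ε^2) by positivity)
  have e2 := t2.eventually_lt_const (show (0:ℝ≥0∞) < ENNReal.ofReal (Gfun (1+ε)) from ENNReal.ofReal_pos.2 g0)
  obtain ⟨k0, hk⟩ := eventually_atTop.1 (e1.and e2)
  refine ⟨k0, fun k hk' => ?_⟩
  obtain ⟨i1, i2⟩ := hk k hk'
  constructor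
  · rw [ENNReal.ofReal_lt_ofReal_iff (by positivity)] at i1
    exact abs_le_of_sq_le_sq i1.le hε.le
  · rw [ENNReal.ofReal_lt_ofReal_iff g0] at i2
    by_contra hc
    push Not at hc
    exact absurd (G_mono (by linarith) hc.le) (by linarith)

lemma growth (h : Rec a b p) (hI : IH a b ≠ ⊤) {ε : ℝ} (hε : 0 < ε) (N : ℝ) :
    ∀ᶠ m in atTop, ∀ x, 2 + ε ≤ x → |(Ap a p m).eval x| ≤ |(p m).eval x| → N * (p m).eval x^2 ≤ (Rec.Kp p m).eval x := by
  obtain ⟨k0, hk0⟩ := coef_lim h hI (show 0 < ε/2 by positivity)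
  obtain ⟨n0, hn0⟩ := exists_nat_gt N
  filter_upwards [eventually_ge_atTop (k0 + n0)] with m hm x hx hA
  have step : ∀ k ≥ k0, |(Ap a p (k+1)).eval x| ≤ |(p (k+1)).eval x| →
      |(Ap a p k).eval x| ≤ |(p k).eval x| ∧ |(p (k+1)).eval x| ≤ |(p k).eval x| := by
    intro k hk h1
    have ha := h.a_pos k
    rw [h.Ap_succ] at h1
    simp only [eval_sub, eval_mul, eval_X, eval_C] at h1
    have e1 : |(Ap a p k).eval x| = a (k+1) * |(p (k+1)).eval x| := by
      rw [Ap, eval_mul, eval_C, abs_mul, abs_of_pos ha]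
    rw [e1]
    have hb := (abs_le.1 (hk0 (k+1) (by omega)).1).2
    have ha2 := (hk0 k hk).2
    change b (k+2) ≤ ε/2 at hb
    set P := |(p (k+1)).eval x| with hP
    have hP0 : 0 ≤ P := abs_nonneg _
    have t1 := abs_sub_abs_le_abs_sub ((x - b (k+2)) * (p (k+1)).eval x) (a (k+1) * (p k).eval x)
    rw [abs_mul, abs_mul, abs_of_pos ha, abs_of_pos (show 0 < x - b (k+2) by linarith), ← hP] at t1
    have t2 : (2 + ε/2) * P ≤ (x - b (k+2)) * P := mul_le_mul_of_nonneg_right (by linarith) hP0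
    have t3 : (1 + ε/2) * P ≤ a (k+1) * |(p k).eval x| := by linarith
    have t4 : a (k+1)^2 * P ≤ (1+ε/2) * P := mul_le_mul_of_nonneg_right ha2 hP0
    have t5 : a (k+1) * P ≤ |(p k).eval x| := by
      have : a (k+1) * (a (k+1) * P) ≤ a (k+1) * |(p k).eval x| := by nlinarith
      exact le_of_mul_le_mul_left this ha
    refine ⟨t5, ?_⟩
    have t6 : a (k+1) ≤ 1 + ε/2 := by nlinarith
    have : (1 + ε/2) * P ≤ (1+ε/2) * |(p k).eval x| :=
      t3.trans (mul_le_mul_of_nonneg_right t6 (abs_nonneg _))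
    exact le_of_mul_le_mul_left this (by linarith)
  have desc : ∀ d k, k0 ≤ k → |(Ap a p (k+d)).eval x| ≤ |(p (k+d)).eval x| →
      |(Ap a p k).eval x| ≤ |(p k).eval x| ∧ |(p (k+d)).eval x| ≤ |(p k).eval x| := by
    intro d
    induction d with
    | zero => intro k _ h1; exact ⟨h1, le_rfl⟩
    | succ d ih =>
      intro k hk h1
      obtain ⟨i1, i2⟩ := ih (k+1) (by omega) (by rwa [show k+1+d = k+(d+1) by ring])
      obtain ⟨j1, j2⟩ := step k hk i1
      rw [show k+1+d = k+(d+1) by ring] at i2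
      exact ⟨j1, i2.trans j2⟩
  have hsub : Finset.Ico k0 (m+1) ⊆ Finset.range (m+1) := by
    intro k hk; simp at hk ⊢; omega
  have e1 : ∑ k ∈ Finset.Ico k0 (m+1), (p m).eval x^2 ≤ (Rec.Kp p m).eval x := by
    rw [Rec.Kp, eval_finsetSum]
    refine le_trans (Finset.sum_le_sum fun k hk => ?_) (Finset.sum_le_sum_of_subset_of_nonneg hsub fun k _ _ => by rw [eval_pow]; positivity)
    simp only [Finset.mem_Ico] at hk
    obtain ⟨d, rfl⟩ := Nat.exists_eq_add_of_le (show k ≤ m by omega)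
    rw [eval_pow]
    exact sq_le_sq.2 (desc d k hk.1 hA).2
  rw [Finset.sum_const, Nat.card_Ico, nsmul_eq_mul] at e1
  refine le_trans (mul_le_mul_of_nonneg_right ?_ (sq_nonneg _)) e1
  refine hn0.le.trans ?_
  exact_mod_cast (by omega : n0 ≤ m + 1 - k0)

lemma pos_ref (o : OP μ a b p R) (hI : IH a b ≠ ⊤)
    (hfin : ∀ ε > 0, {x | x ∈ suppSet μ ∧ 2 + ε < |x|}.Finite) {η : ℝ} (hη : 0 < η) :
    ∀ᶠ m in atTop, ∃ S : Finset ℝ, (∀ s ∈ S, s ∈ suppSet μ ∧ 2 < s) ∧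
    ∑ z ∈ (Rec.Zs a p m).filter (fun z => 0 < z), Fz z ≤ ∑ s ∈ S, Fx s + η := by
  obtain ⟨ε, hε, hFε⟩ : ∃ ε > 0, Fx (2+ε) ≤ η/2 := by
    have h1 : ∀ᶠ x in 𝓝 (2:ℝ), Fx x < η/2 := (Fx_cont two_ne_zero).eventually_lt_const (by rw [Fx_two]; positivity)
    obtain ⟨δ, hδ, hb⟩ := Metric.eventually_nhds_iff.1 h1
    refine ⟨δ/2, by positivity, (hb ?_).le⟩
    rw [Real.dist_eq, add_sub_cancel_left, abs_of_pos (by positivity)]; linarith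
  set V := (hfin ε hε).toFinset with hV
  set L := 3*R+1 with hL
  have hL0 : 0 < L := by have := o.R2; linarith
  set r : ℝ := (V.card : ℝ) with hr
  have hr0 : 0 ≤ r := Nat.cast_nonneg _
  set δ := η / (2 * L * (1 + r)) with hδ
  have hδ0 : 0 < δ := by positivity
  have hδ1 : L * δ * (1 + r) = η/2 := by rw [hδ]; field_simp
  filter_upwards [growth o.toRec hI hε δ⁻¹] with m hm
  have hm' : ∀ x, 2 + ε ≤ x → |(Ap a p m).eval x| ≤ |(p m).eval x| → (p m).eval x^2 ≤ δ * (Rec.Kp p m).eval x := by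
    intro x h1 h2
    have := hm x h1 h2
    rwa [inv_mul_le_iff₀ hδ0] at this
  obtain ⟨f, hf⟩ := pos_data o m
  set T := Tp a p m with hT
  have hT2 : ∀ E ∈ T, 2 ≤ E := fun E hE => by
    obtain ⟨-, -, -, -, -, -, -, hh⟩ := mem_Tp o.toRec m hE
    exact hh
  have hS : ∀ s ∈ Sf T f, s ∈ suppSet μ ∧ 2 < s := by
    intro s hs
    simp only [Sf, Finset.mem_image, Finset.mem_filter] at hs
    obtain ⟨E, ⟨h1, h2⟩, rfl⟩ := hs
    exact ⟨(hf E h1).1 h2, h2⟩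
  have hmono : ∀ E ∈ T, ∀ E' ∈ T, E' < E → f E' < f E := fun E hE E' hE' h => ((hf E hE).2.1 E' hE' h).2
  have hpre : ∀ E ∈ T, ∀ E' ∈ T, E' < E → E' ≤ f E := fun E hE E' hE' h => ((hf E hE).2.1 E' hE' h).1
  have hTL : ∀ E ∈ T, E ≤ L := fun E hE => Tp_le o m hE
  refine ⟨Sf T f, hS, ?_⟩
  -- three test functions
  set G1 : ℝ → ℝ := fun x => Fp (min x (2+ε)) with hG1
  set G2 : ℝ → ℝ := fun x => Fp (max x (2+ε)) - Fp (2+ε) with hG2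
  set H : ℝ → ℝ := fun x => if 2 + ε < x then 1 else 0 with hH
  have hsplit : ∀ x, Fp x = G1 x + G2 x := by
    intro x
    simp only [hG1, hG2]
    rcases le_total x (2+ε) with h | h
    · rw [min_eq_left h, max_eq_right h]; ring
    · rw [min_eq_right h, max_eq_left h]; ring
  have hG2m : Monotone G2 := fun x y h => by
    simp only [hG2]; linarith [Fp_mono (max_le_max_right (2+ε) h)]
  have b1 := tele G1 f (fun x y h => Fp_mono (min_le_min_right _ h)) (fun x => Fp_nonneg _) T hpre L hTL
  have b1' : G1 L ≤ η/2 := by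
    simp only [hG1]
    exact (Fp_mono (min_le_right _ _)).trans (by rw [Fp_eq (by linarith)]; exact hFε)
  have b3 := tele H f (fun x y h => by
      simp only [hH]
      split_ifs with h1 h2
      · exact le_rfl
      · exact absurd (h1.trans_le h) h2
      · exact zero_le_one
      · exact le_rfl) (fun x => by simp only [hH]; split_ifs <;> norm_num) T hpre L hTL
  rw [sum_Sf T f H hmono (fun x hx => if_neg (by linarith))] at b3
  have b3' : H L ≤ 1 := by simp only [hH]; split_ifs <;> norm_num
  have b3'' : ∑ s ∈ Sf T f, H s ≤ r := by
    simp only [hH]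
    rw [← Finset.sum_filter, Finset.sum_const, nsmul_eq_mul, mul_one, hr]
    exact_mod_cast Finset.card_le_card (fun s hs => by
      obtain ⟨h1, h2⟩ := Finset.mem_filter.1 hs
      simp only [hV, Set.Finite.mem_toFinset]
      exact ⟨(hS s h1).1, h2.trans_le (le_abs_self _)⟩)
  have b2 : ∑ E ∈ T, G2 E ≤ ∑ E ∈ T, (G2 (f E) + L * δ * H E) := by
    refine Finset.sum_le_sum fun E hE => ?_
    have hn : 0 ≤ G2 (f E) := by
      simp only [hG2]; linarith [Fp_mono (le_max_right (f E) (2+ε))]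
    by_cases hc : 2 + ε < E
    · have : H E = 1 := if_pos hc
      rw [this, mul_one]
      by_cases hc2 : 2 + ε ≤ E - δ
      · have h1 := (hf E hE).2.2 δ hδ0 (fun x hx => hm' x (hc2.trans hx))
        have h2 := hG2m h1
        have h3 : G2 E ≤ G2 (E-δ) + L * δ := by
          simp only [hG2]
          rw [max_eq_left hc.le, max_eq_left hc2]
          have := Fp_lip (T := L) (show 2 ≤ E - δ by linarith) (show E - δ ≤ E by linarith) (hTL E hE)
          rw [show E - (E - δ) = δ by ring] at this
          linarith
        linarith
      · have h3 : G2 E ≤ L * δ := by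
          simp only [hG2]
          rw [max_eq_left hc.le]
          have := Fp_lip (T := L) (show 2 ≤ 2 + ε by linarith) hc.le (hTL E hE)
          have : L * (E - (2+ε)) ≤ L * δ := mul_le_mul_of_nonneg_left (by linarith) hL0.le
          linarith
        linarith
    · have h1 : H E = 0 := if_neg hc
      have h2 : G2 E = 0 := by simp only [hG2]; rw [max_eq_right (not_lt.1 hc)]; ring
      rw [h1, h2]; simpa using hn
  rw [Finset.sum_add_distrib, ← Finset.mul_sum] at b2
  have hfin2 : ∑ E ∈ T, G1 (f E) + ∑ E ∈ T, G2 (f E) = ∑ s ∈ Sf T f, Fx s := by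
    rw [← Finset.sum_add_distrib]
    simp_rw [← hsplit]
    rw [sum_Sf T f Fp hmono (fun x hx => Fp_zero hx)]
    exact Finset.sum_congr rfl fun s hs => Fp_eq (hS s hs).2.le
  rw [sum_Fp o.toRec]
  simp_rw [hsplit]
  rw [Finset.sum_add_distrib]
  have b4 : L * δ * ∑ E ∈ T, H E ≤ L * δ * (1 + r) := mul_le_mul_of_nonneg_left (by linarith) (mul_pos hL0 hδ0).le
  linarith

end SumRules
end

section
namespace SumRules
variable {a b : ℕ → ℝ} {p : ℕ → ℝ[X]} {μ : Measure ℝ} {R : ℝ}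

def pr (p : ℕ → ℝ[X]) (k : ℕ) : ℝ[X] := C ((-1)^k) * (p k).comp (-X)

lemma pr_eval (k : ℕ) (x : ℝ) : (pr p k).eval x = (-1)^k * (p k).eval (-x) := by
  simp [pr]

lemma map_neg_int (f : ℝ → ℝ) : ∫ x, f x ∂(μ.map Neg.neg) = ∫ x, f (-x) ∂μ :=
  (MeasurableEquiv.neg ℝ).measurableEmbedding.integral_map f

lemma OP.refl (o : OP μ a b p R) : OP (μ.map Neg.neg) a (fun k => - b k) (pr p) R where
  a_pos := o.a_pos
  deg k := by
    rw [pr, natDegree_C_mul (by simp), natDegree_comp, o.deg]; simp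
  lead k := by
    have : (pr p k).leadingCoeff = (p k).leadingCoeff := by
      rw [pr, leadingCoeff_mul, leadingCoeff_C, leadingCoeff_comp (by simp), o.deg, leadingCoeff_neg, leadingCoeff_X,
        mul_comm, mul_assoc, ← mul_pow]
      simp
    rw [this]; exact o.lead k
  p0 := by simp [pr, o.p0]
  step0 := by
    apply Polynomial.funext
    intro x
    have := congrArg (eval (-x)) o.step0
    simp only [eval_mul, eval_sub, eval_C, eval_X, pr_eval] at this ⊢
    linear_combination -this
  step k := by
    apply Polynomial.funext
    intro x
    have := congrArg (eval (-x)) (o.step k)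
    simp only [eval_mul, eval_sub, eval_C, eval_X, pr_eval] at this ⊢
    rw [pow_add, pow_add]
    linear_combination (-1)^k * this
  int q := by
    have := (MeasurableEquiv.neg ℝ).measurableEmbedding.integrable_map_iff (μ := μ) (g := fun x => q.eval x)
    refine this.2 ?_
    refine (o.int (q.comp (-X))).congr (ae_of_all _ fun x => ?_)
    simp
  ho j k := by
    rw [map_neg_int]
    simp only [pr_eval, neg_neg]
    have : ∀ x, (-1)^j * (p j).eval x * ((-1)^k * (p k).eval x) = (-1)^(j+k) * ((p j).eval x * (p k).eval x) := by
      intro x; ring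
    simp_rw [this]
    rw [integral_const_mul, o.ho]
    split_ifs with h
    · rw [h, ← two_mul, pow_mul]; simp
    · simp
  supp := by
    rw [Measure.map_apply measurable_neg measurableSet_Icc.compl]
    convert o.supp using 2
    ext x
    simp only [mem_preimage, mem_compl_iff, mem_Icc]
    constructor <;> intro h h2 <;> exact h ⟨by linarith [h2.2], by linarith [h2.1]⟩
  R2 := o.R2

lemma suppSet_neg {x : ℝ} : x ∈ suppSet (μ.map Neg.neg) ↔ -x ∈ suppSet μ := by
  have hm : ∀ U : Set ℝ, (μ.map Neg.neg) U = μ (Neg.neg ⁻¹' U) := fun U => (MeasurableEquiv.neg ℝ).map_apply U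
  constructor
  · intro h U hU
    have := h (Neg.neg ⁻¹' U) (continuous_neg.continuousAt.preimage_mem_nhds hU)
    rw [hm, ← preimage_comp] at this
    simpa using this
  · intro h U hU
    rw [hm]
    apply h
    apply continuous_neg.continuousAt.preimage_mem_nhds
    simpa using hU

lemma Zs_refl (o : OP μ a b p R) (m : ℕ) (z : ℝ) : z ∈ Rec.Zs a (pr p) m ↔ -z ∈ Rec.Zs a p m := by
  rw [o.refl.mem_Zs, o.mem_Zs]
  have e : -(z + z⁻¹) = -z + (-z)⁻¹ := by rw [inv_neg]; ring
  simp only [Ap, eval_mul, eval_C, pr_eval, e, abs_neg, neg_ne_zero]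
  refine and_congr_right fun _ => and_congr_right fun _ => ?_
  rw [pow_succ]
  have h1 : ((-1:ℝ)^m) ≠ 0 := pow_ne_zero _ (by norm_num)
  constructor
  · intro h
    apply mul_left_cancel₀ h1
    linear_combination -h
  · intro h
    linear_combination -(-1)^m * h

lemma Fz_neg (z : ℝ) : Fz (-z) = Fz z := by simp [Fz]

lemma sum_neg (o : OP μ a b p R) (m : ℕ) : ∑ z ∈ Rec.Zs a p m, Fz z =
    ∑ z ∈ (Rec.Zs a p m).filter (fun z => 0 < z), Fz z + ∑ z ∈ (Rec.Zs a (pr p) m).filter (fun z => 0 < z), Fz z := by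
  rw [← Finset.sum_filter_add_sum_filter_not (Rec.Zs a p m) (fun z => 0 < z)]
  congr 1
  refine Finset.sum_bij (fun z _ => -z) ?_ ?_ ?_ ?_
  · intro z hz
    obtain ⟨h1, h2⟩ := Finset.mem_filter.1 hz
    refine Finset.mem_filter.2 ⟨by rw [Zs_refl o, neg_neg]; exact h1, ?_⟩
    have := ((o.mem_Zs m z).1 h1).1
    have := lt_of_le_of_ne (not_lt.1 h2) this
    linarith
  · intro z _ z' _ h; exact neg_injective h
  · intro z hz
    obtain ⟨h1, h2⟩ := Finset.mem_filter.1 hz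
    exact ⟨-z, Finset.mem_filter.2 ⟨(Zs_refl o m z).1 h1, by linarith⟩, by simp⟩
  · intro z _; exact (Fz_neg z).symm

/-- combine the two sides -/
lemma both (S S' : Finset ℝ) (hS : ∀ s ∈ S, s ∈ suppSet μ ∧ 2 < s) (hS' : ∀ s ∈ S', s ∈ suppSet (μ.map Neg.neg) ∧ 2 < s)
    (hL : ∑' x : (ES μ (-2) 2), FSC (x:ℝ) ≠ ⊤) :
    ∑ s ∈ S, Fx s + ∑ s ∈ S', Fx s ≤ (∑' x : (ES μ (-2) 2), FSC (x:ℝ)).toReal := by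
  classical
  have hd : Disjoint S (S'.image Neg.neg) := by
    rw [Finset.disjoint_left]
    intro s h1 h2
    obtain ⟨t, ht, rfl⟩ := Finset.mem_image.1 h2
    linarith [(hS _ h1).2, (hS' t ht).2]
  have e1 : ∑ s ∈ S', Fx s = ∑ s ∈ S'.image Neg.neg, Fx s := by
    rw [Finset.sum_image (fun _ _ _ _ h => neg_injective h)]
    simp [Fx_neg]
  rw [e1, ← Finset.sum_union hd]
  set W := S ∪ S'.image Neg.neg with hW
  have hWE : ∀ s ∈ W, s ∈ ES μ (-2) 2 ∧ 2 ≤ |s| := by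
    intro s hs
    rcases Finset.mem_union.1 hs with h | h
    · obtain ⟨h1, h2⟩ := hS s h
      exact ⟨⟨h1, fun h3 => by linarith [h3.2]⟩, h2.le.trans (le_abs_self _)⟩
    · obtain ⟨t, ht, rfl⟩ := Finset.mem_image.1 h
      obtain ⟨h1, h2⟩ := hS' t ht
      exact ⟨⟨suppSet_neg.1 h1, fun h3 => by linarith [h3.1]⟩, by rw [abs_neg]; exact h2.le.trans (le_abs_self _)⟩
  rw [← ENNReal.ofReal_le_iff_le_toReal hL, ENNReal.ofReal_sum_of_nonneg (fun s hs => Fx_nonneg (hWE s hs).2)]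
  calc ∑ s ∈ W, ENNReal.ofReal (Fx s) = ∑ s ∈ W.attach, FSC s.1 := by
        rw [← Finset.sum_attach]
        exact Finset.sum_congr rfl fun s _ => (FSC_eq (hWE s.1 s.2).2).symm
    _ = ∑ s ∈ W.attach.image (fun s => (⟨s.1, (hWE s.1 s.2).1⟩ : ES μ (-2) 2)), FSC (s:ℝ) := by
        rw [Finset.sum_image]
        intro s _ t _ h
        exact Subtype.ext (by simpa using h)
    _ ≤ _ := ENNReal.sum_le_tsum _

theorem partB [IsProbabilityMeasure μ] (o : OP μ a b p R) :
    IH a b ≤ KLdiv SCm μ + ∑' x : (ES μ (-2) 2), FSC (x:ℝ) := by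
  by_cases htop : KLdiv SCm μ + ∑' x : (ES μ (-2) 2), FSC (x:ℝ) = ⊤
  · rw [htop]; exact le_top
  obtain ⟨hK, hL⟩ := ENNReal.add_ne_top.1 htop
  set K := (KLdiv SCm μ).toReal with hKdef
  set Λ := (∑' x : (ES μ (-2) 2), FSC (x:ℝ)).toReal with hΛ
  have hsum : KLdiv SCm μ + ∑' x : (ES μ (-2) 2), FSC (x:ℝ) = ENNReal.ofReal (K + Λ) := by
    rw [ENNReal.ofReal_add ENNReal.toReal_nonneg ENNReal.toReal_nonneg, ENNReal.ofReal_toReal hK, ENNReal.ofReal_toReal hL]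
  have hIs : ∀ m, Rec.Isum a b m = ∫ x, Real.log ((Dp a p m).eval x) ∂SCm +
      (∑ z ∈ (Rec.Zs a p m).filter (fun z => 0 < z), Fz z + ∑ z ∈ (Rec.Zs a (pr p) m).filter (fun z => 0 < z), Fz z) := by
    intro m
    rw [← sum_neg o, (o.log_D m).2]; ring
  have hfin : ∀ ε > 0, {x | x ∈ suppSet μ ∧ 2 + ε < |x|}.Finite := by
    intro ε hε
    have h1 := ENNReal.finite_const_le_of_tsum_ne_top hL (ε := ENNReal.ofReal (Fx (2+ε))) (by
      rw [Ne, ENNReal.ofReal_eq_zero, not_le]; exact Fx_pos (by linarith))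
    refine (h1.image Subtype.val).subset ?_
    rintro x ⟨hx1, hx2⟩
    have hx3 : x ∈ ES μ (-2) 2 := ⟨hx1, fun h => by have := abs_le.2 h; linarith⟩
    refine ⟨⟨x, hx3⟩, ?_, rfl⟩
    show ENNReal.ofReal (Fx (2+ε)) ≤ FSC x
    rw [FSC_eq (by linarith), ← Fx_abs x]
    exact ENNReal.ofReal_le_ofReal (Fx_mono (mem_Ici.2 (by linarith)) (mem_Ici.2 (by linarith)) hx2.le)
  have hfin' : ∀ ε > 0, {x | x ∈ suppSet (μ.map Neg.neg) ∧ 2 + ε < |x|}.Finite := by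
    intro ε hε
    refine ((hfin ε hε).image Neg.neg).subset ?_
    rintro x ⟨hx1, hx2⟩
    exact ⟨-x, ⟨suppSet_neg.1 hx1, by rwa [abs_neg]⟩, neg_neg x⟩
  have hI : IH a b ≠ ⊤ := by
    have : IH a b ≤ ENNReal.ofReal (K + R*(R^2+1) + (2 * Fx (3*R+1) + Λ)) := by
      refine le_of_tendsto' (Isum_tendsto o.toRec) fun m => ENNReal.ofReal_le_ofReal ?_
      rw [hIs]
      obtain ⟨S, hS, h1⟩ := pos_crude o m
      obtain ⟨S', hS', h2⟩ := pos_crude o.refl m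
      have h3 := both S S' hS hS' hL
      have h4 := int_crude o hK m
      linarith
    exact ne_top_of_le_ne_top ENNReal.ofReal_ne_top this
  have hI' : IH a (fun k => - b k) ≠ ⊤ := by
    have : IH a (fun k => - b k) = IH a b := by simp [IH]
    rwa [this]
  rw [hsum]
  have main : ∀ η > 0, IH a b ≤ ENNReal.ofReal (K + Λ + 3 * η) := by
    intro η hη
    refine le_of_tendsto (Isum_tendsto o.toRec) ?_
    filter_upwards [pos_ref o hI hfin hη, pos_ref o.refl hI' hfin' hη, int_ref o hK hfin hη] with m h1 h2 h4
    obtain ⟨S, hS, h1⟩ := h1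
    obtain ⟨S', hS', h2⟩ := h2
    have h3 := both S S' hS hS' hL
    apply ENNReal.ofReal_le_ofReal
    rw [hIs]
    linarith
  have hlim : Tendsto (fun η : ℝ => ENNReal.ofReal (K + Λ + 3 * η)) (𝓝[>] 0) (𝓝 (ENNReal.ofReal (K + Λ))) := by
    apply ENNReal.tendsto_ofReal
    have : Tendsto (fun η : ℝ => K + Λ + 3 * η) (𝓝 0) (𝓝 (K + Λ + 3 * 0)) := by
      apply Continuous.tendsto; fun_prop
    rw [mul_zero, add_zero] at this
    exact this.mono_left nhdsWithin_le_nhds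
  exact ge_of_tendsto hlim (by filter_upwards [self_mem_nhdsWithin] with η hη using main η hη)

theorem final [IsProbabilityMeasure μ] (o : OP μ a b p R) :
    (¬ InS1 μ (-2) 2 → IH a b = ⊤) ∧
    (InS1 μ (-2) 2 → KLdiv SCm μ + ∑' x : (ES μ (-2) 2), FSC (x:ℝ) = IH a b) := by
  have hle : KLdiv SCm μ + ∑' x : (ES μ (-2) 2), FSC (x:ℝ) ≤ IH a b := by
    by_cases hI : IH a b = ⊤
    · rw [hI]; exact le_top
    rw [ENNReal.tsum_eq_iSup_sum, ENNReal.add_iSup]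
    refine iSup_le fun s => ?_
    have := partA o hI (s.map (Function.Embedding.subtype _)) (by
      intro x hx
      obtain ⟨y, -, rfl⟩ := Finset.mem_map.1 hx
      exact y.2)
    rwa [Finset.sum_map] at this
  refine ⟨fun hn => ?_, fun _ => le_antisymm hle (partB o)⟩
  by_contra hI
  apply hn
  have hL : ∑' x : (ES μ (-2) 2), FSC (x:ℝ) ≠ ⊤ := ne_top_of_le_ne_top hI (le_trans le_add_self hle)
  have := Summable.countable_support_ennreal hL
  have hs : (Function.support fun x : (ES μ (-2) 2) => FSC (x:ℝ)) = Set.univ := by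
    ext x
    simp only [Function.mem_support, mem_univ, iff_true]
    have hx : 2 < |(x:ℝ)| := by
      by_contra hc; exact x.2.2 (abs_le.1 (not_lt.1 hc))
    rw [FSC_eq hx.le, Ne, ENNReal.ofReal_eq_zero, not_le, ← Fx_abs]
    exact Fx_pos hx
  rw [hs, Set.countable_univ_iff] at this
  exact Set.countable_coe_iff.1 this

end SumRules
end

namespace SumRules

/-- **Killip–Simon sum rule.** -/
theorem killip_simon_sum_rule (μ : Measure ℝ) [IsProbabilityMeasure μ]
    (hcs : ∃ R : ℝ, μ (Icc (-R) R)ᶜ = 0) (hnt : InfiniteSupport μ)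
    (a b : ℕ → ℝ) (hab : IsJacobi μ a b) :
    (¬ InS1 μ (-2) 2 → IH a b = ⊤) ∧
    (InS1 μ (-2) 2 →
      KLdiv SCm μ + ∑' x : (ES μ (-2) 2), FSC (x : ℝ) = IH a b) := by
  obtain ⟨p, R, o⟩ := OP.of hab hcs
  exact final o

end SumRules
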